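/- Let 5 ≤ N ≤ 12, or 14 ≤ N ≤ 17, or N = 23, let k be a positive even integer, and let (a_n) be complex numbers with a_n = O(n^C) for some C > 0 and a_1 = 1. Suppose F(s) = Σ_{n≥1} a_n n^{−s} satisfies a functional equation of degree 2, level N, weight k (i.e. Φ(s) = (√N/(2π))^s Γ(s) F(s) extends to an entire function, bounded in every vertical strip, with Φ(s) = ε(−1)^{k/2} Φ(k−s) for some ε ∈ {+1,−1}), and that F has an Euler product of degree 2, level N, weight k: for Re(s) large, F(s) = ∏_p F_p(s) over primes p, where F_p(s) = (1 − a_p p^{−s} + p^{k−1−2s})^{−1} if p ∤ N, F_q(s) = (1 − q^{k/2−1−s})^{−1} if q | N and q² ∤ N, and F_q(s) = 1 if q² | N. Then f(z) = Σ_{n≥1} a_n e^{2πinz} satisfies f|_k γ = f for every γ ∈ Γ₀(N). (Theorem 1.) -/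

import Mathlib

open UpperHalfPlane Matrix Complex MatrixGroups Asymptotics Filter Topology
open scoped Manifold

set_option synthInstance.maxHeartbeats 1000000 in
/-- Action of a real 2×2 matrix with positive determinant on the upper
half-plane `ℍ` (junk value `z` if the determinant is not positive). -/
noncomputable def glAct (γ : Matrix (Fin 2) (Fin 2) ℝ) (z : ℍ) : ℍ :=
  if h : 0 < γ.det then
    (⟨Matrix.GeneralLinearGroup.mkOfDetNeZero γ h.ne', by
        simpa [Matrix.GeneralLinearGroup.mkOfDetNeZero] using h⟩ : GL(2, ℝ)⁺) • z
  else z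

/-- For an even integer `k`, the weight-`k` slash action
`(f ∣ₖ γ)(z) = (det γ)^(k/2) (cz+d)^(-k) f(γz)`. -/
noncomputable def slash (k : ℤ) (γ : Matrix (Fin 2) (Fin 2) ℝ) (f : ℍ → ℂ) : ℍ → ℂ :=
  fun z => (γ.det : ℂ) ^ (k / 2) * (γ 1 0 * (z : ℂ) + γ 1 1) ^ (-k) * f (glAct γ z)

/-- An element of `SL(2, ℤ)` as a real matrix. -/
def sl2ToReal (γ : Matrix.SpecialLinearGroup (Fin 2) ℤ) : Matrix (Fin 2) (Fin 2) ℝ :=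
  (γ : Matrix (Fin 2) (Fin 2) ℤ).map (Int.cast)

/-- The function `f(z) = Σ_{n ≥ 1} a_n e^{2πinz}` on the upper half-plane. -/
noncomputable def fourierSeries (a : ℕ → ℂ) : ℍ → ℂ :=
  fun z => ∑' n : ℕ, a (n + 1) *
    Complex.exp (2 * (Real.pi : ℂ) * Complex.I * ((n : ℂ) + 1) * (z : ℂ))

/-- The Dirichlet series `F(s) = Σ_{n ≥ 1} a_n n^{-s}`. -/
noncomputable def dirichletSeries (a : ℕ → ℂ) (s : ℂ) : ℂ :=
  ∑' n : ℕ, a (n + 1) / ((n : ℂ) + 1) ^ s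

/-- The action of the Hecke operator `T_p` in weight `k`:
`f|_k T_p = f|_k ((p,0),(0,1)) + Σ_{b=0}^{p-1} f|_k ((1,b),(0,p))`. -/
noncomputable def heckeT (k : ℤ) (p : ℕ) (f : ℍ → ℂ) : ℍ → ℂ :=
  fun z => slash k !![(p : ℝ), 0; 0, 1] f z +
    ∑ b ∈ Finset.range p, slash k !![1, (b : ℝ); 0, (p : ℝ)] f z

/-- The action of the Atkin–Lehner operator `U_q` in weight `k`:
`f|_k U_q = Σ_{b=0}^{q-1} f|_k ((q,b),(0,q))`. -/
noncomputable def atkinLehnerU (k : ℤ) (q : ℕ) (f : ℍ → ℂ) : ℍ → ℂ :=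
  fun z => ∑ b ∈ Finset.range q, slash k !![(q : ℝ), (b : ℝ); 0, (q : ℝ)] f z

/-- The local factor at the prime `p` of an Euler product of degree 2,
level `N`, and weight `k`. -/
noncomputable def localFactor (a : ℕ → ℂ) (N : ℕ) (k : ℤ) (p : ℕ) (s : ℂ) : ℂ :=
  if p ∣ N then
    (if p ^ 2 ∣ N then 1 else (1 - (p : ℂ) ^ ((k : ℂ) / 2 - 1 - s))⁻¹)
  else (1 - a p * (p : ℂ) ^ (-s) + (p : ℂ) ^ ((k : ℂ) - 1 - 2 * s))⁻¹

/-- Integral `2 × 2` matrices, with arithmetic that the kernel evaluates quickly. -/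
@[ext] structure IntMat where
  a : ℤ
  b : ℤ
  c : ℤ
  d : ℤ
  deriving DecidableEq

namespace IntMat

/-- The determinant. -/
def det (m : IntMat) : ℤ := m.a * m.d - m.b * m.c

/-- The trace. -/
def tr (m : IntMat) : ℤ := m.a + m.d

/-- The product of matrices. -/
def mul (m n : IntMat) : IntMat :=
  ⟨m.a * n.a + m.b * n.c, m.a * n.b + m.b * n.d, m.c * n.a + m.d * n.c, m.c * n.b + m.d * n.d⟩

instance : Mul IntMat := ⟨mul⟩

/-- Multiplication by a scalar. -/
def scale (r : ℤ) (m : IntMat) : IntMat := ⟨r * m.a, r * m.b, r * m.c, r * m.d⟩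

/-- The adjugate matrix. -/
def adj (m : IntMat) : IntMat := ⟨m.d, -m.b, -m.c, m.a⟩

/-- The associated real matrix. -/
def toReal (m : IntMat) : Matrix (Fin 2) (Fin 2) ℝ := !![(m.a : ℝ), m.b; m.c, m.d]

lemma mul_def (m n : IntMat) : m * n =
    ⟨m.a * n.a + m.b * n.c, m.a * n.b + m.b * n.d, m.c * n.a + m.d * n.c,
      m.c * n.b + m.d * n.d⟩ := rfl

lemma det_mul (m n : IntMat) : (m * n).det = m.det * n.det := by
  simp only [det, mul_def]; ring

lemma det_scale (r : ℤ) (m : IntMat) : (scale r m).det = r ^ 2 * m.det := by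
  simp only [det, scale]; ring

lemma det_adj (m : IntMat) : m.adj.det = m.det := by
  simp only [det, adj]; ring

lemma det_toReal (m : IntMat) : m.toReal.det = (m.det : ℝ) := by
  simp [toReal, Matrix.det_fin_two, det]

lemma mul_adj (m : IntMat) : m * m.adj = scale m.det ⟨1, 0, 0, 1⟩ := by
  simp only [mul_def, adj, scale, det, IntMat.mk.injEq]; refine ⟨?_, ?_, ?_, ?_⟩ <;> ring

lemma denom_ne_zero {m : IntMat} (hm : 0 < m.det) (z : ℍ) : (m.c : ℂ) * z + m.d ≠ 0 := by
  intro h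
  have h1 := congrArg Complex.im h
  have h2 := congrArg Complex.re h
  simp at h1 h2
  have hc : m.c = 0 := by
    rcases h1 with h1 | h1
    · exact_mod_cast h1
    · exact absurd h1 z.im_pos.ne'
  have hd : m.d = 0 := by
    rw [hc] at h2; simpa using h2
  simp [det, hc, hd] at hm

lemma coe_glAct {m : IntMat} (hm : 0 < m.det) (z : ℍ) :
    (glAct m.toReal z : ℂ) = (m.a * z + m.b) / (m.c * z + m.d) := by
  have h : 0 < m.toReal.det := by rw [det_toReal]; exact_mod_cast hm
  rw [glAct, dif_pos h]
  change ((Matrix.GeneralLinearGroup.mkOfDetNeZero m.toReal h.ne' • z : ℍ) : ℂ) = _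
  rw [UpperHalfPlane.coe_smul_of_det_pos (by simpa [Matrix.GeneralLinearGroup.mkOfDetNeZero] using h)]
  simp [UpperHalfPlane.num, UpperHalfPlane.denom, Matrix.GeneralLinearGroup.mkOfDetNeZero, toReal]

end IntMat

/-- The weight-`k` slash action of an integral matrix. -/
noncomputable def sl (k : ℤ) (m : IntMat) (f : ℍ → ℂ) : ℍ → ℂ := slash k m.toReal f

section SlashAction

variable {k : ℤ} {f g : ℍ → ℂ} {l m n : IntMat}

lemma sl_apply (k : ℤ) (m : IntMat) (f : ℍ → ℂ) (z : ℍ) :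
    sl k m f z = (m.det : ℂ) ^ (k / 2) * (m.c * (z : ℂ) + m.d) ^ (-k) *
      f (glAct m.toReal z) := by
  simp only [sl, slash, IntMat.det_toReal]
  simp [IntMat.toReal]

lemma sl_add (k : ℤ) (m : IntMat) (f g : ℍ → ℂ) : sl k m (f + g) = sl k m f + sl k m g := by
  ext z; simp only [sl_apply, Pi.add_apply]; ring

lemma sl_sub (k : ℤ) (m : IntMat) (f g : ℍ → ℂ) : sl k m (f - g) = sl k m f - sl k m g := by
  ext z; simp only [sl_apply, Pi.sub_apply]; ring

lemma sl_smul (k : ℤ) (m : IntMat) (u : ℂ) (f : ℍ → ℂ) : sl k m (u • f) = u • sl k m f := by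
  ext z; simp only [sl_apply, Pi.smul_apply, smul_eq_mul]; ring

lemma sl_zero (k : ℤ) (m : IntMat) : sl k m 0 = 0 := by
  ext z; simp [sl_apply]

lemma sl_mul (hm : 0 < m.det) (hn : 0 < n.det) (k : ℤ) (f : ℍ → ℂ) :
    sl k (m * n) f = sl k n (sl k m f) := by
  ext z
  have hmn : 0 < (m * n).det := by rw [IntMat.det_mul]; positivity
  have h0 := IntMat.denom_ne_zero hn z
  have h1 := IntMat.denom_ne_zero hm (glAct n.toReal z)
  have h2 := IntMat.denom_ne_zero hmn z
  have hw : (glAct n.toReal z : ℂ) * (n.c * z + n.d) = n.a * z + n.b := by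
    rw [IntMat.coe_glAct hn, div_mul_cancel₀ _ h0]
  have hj : ((m * n).c * (z : ℂ) + (m * n).d) =
      (m.c * (glAct n.toReal z : ℂ) + m.d) * (n.c * z + n.d) := by
    simp only [IntMat.mul_def]; push_cast
    linear_combination -(m.c : ℂ) * hw
  have hz : glAct (m * n).toReal z = glAct m.toReal (glAct n.toReal z) := by
    apply UpperHalfPlane.ext
    rw [IntMat.coe_glAct hmn, IntMat.coe_glAct hm, hj, div_eq_div_iff (mul_ne_zero h1 h0) h1]
    simp only [IntMat.mul_def]; push_cast
    linear_combination -(m.a : ℂ) * (m.c * (glAct n.toReal z : ℂ) + m.d) * hw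
  simp only [sl_apply]
  rw [hz, hj, IntMat.det_mul, mul_zpow, Int.cast_mul, mul_zpow]
  ring

lemma sl_scale (hk : Even k) {r : ℤ} (hr : r ≠ 0) (hm : 0 < m.det) (f : ℍ → ℂ) :
    sl k (IntMat.scale r m) f = sl k m f := by
  ext z
  have hrm : 0 < (IntMat.scale r m).det := by rw [IntMat.det_scale]; positivity
  have hr' : (r : ℂ) ≠ 0 := by exact_mod_cast hr
  have hz : glAct (IntMat.scale r m).toReal z = glAct m.toReal z := by
    apply UpperHalfPlane.ext
    rw [IntMat.coe_glAct hrm, IntMat.coe_glAct hm]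
    simp only [IntMat.scale]; push_cast
    rw [mul_assoc, mul_assoc, ← mul_add, ← mul_add, mul_div_mul_left _ _ hr']
  obtain ⟨j, rfl⟩ := hk
  have hj : (j + j) / 2 = j := by omega
  simp only [sl_apply]
  rw [hz, IntMat.det_scale, hj]
  simp only [IntMat.scale]; push_cast
  have : (r : ℂ) * m.c * z + r * m.d = r * (m.c * z + m.d) := by ring
  rw [this, mul_zpow, mul_zpow, ← zpow_natCast, ← _root_.zpow_mul]
  have h3 : (r : ℂ) ^ (((2 : ℕ) : ℤ) * j) * (r : ℂ) ^ (-(j + j)) = 1 := by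
    rw [← zpow_add₀ hr']; convert zpow_zero _ using 2; push_cast; ring
  linear_combination (m.det : ℂ) ^ j * (m.c * z + m.d) ^ (-(j + j)) * f (glAct m.toReal z) * h3

lemma sl_one (k : ℤ) (f : ℍ → ℂ) : sl k ⟨1, 0, 0, 1⟩ f = f := by
  ext z
  have h : glAct (IntMat.mk 1 0 0 1).toReal z = z := by
    apply UpperHalfPlane.ext
    rw [IntMat.coe_glAct (by decide)]; simp
  simp [sl_apply, h, IntMat.det]

lemma sl_adj_sl (hk : Even k) (hm : 0 < m.det) (f : ℍ → ℂ) :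
    sl k m.adj (sl k m f) = f := by
  rw [← sl_mul hm (by rwa [IntMat.det_adj]), IntMat.mul_adj,
    sl_scale hk hm.ne' (by decide), sl_one]

/-- Holomorphic functions on the upper half-plane. -/
def Hol (f : ℍ → ℂ) : Prop := DifferentiableOn ℂ (f ∘ ofComplex) {z | 0 < z.im}

lemma Hol.sub (hf : Hol f) (hg : Hol g) : Hol (f - g) := DifferentiableOn.sub hf hg

lemma Hol.smul (hf : Hol f) (u : ℂ) : Hol (u • f) := DifferentiableOn.const_smul hf u

lemma Hol.sl (hf : Hol f) (hm : 0 < m.det) (k : ℤ) : Hol (sl k m f) := by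
  have hd : ∀ z : ℂ, 0 < z.im → (m.c : ℂ) * z + m.d ≠ 0 := fun z hz ↦
    IntMat.denom_ne_zero hm ⟨z, hz⟩
  have hmap : ∀ z : ℂ, ∀ hz : 0 < z.im,
      ((m.a : ℂ) * z + m.b) / (m.c * z + m.d) = glAct m.toReal ⟨z, hz⟩ := fun z hz ↦
    (IntMat.coe_glAct hm ⟨z, hz⟩).symm
  have h1 : DifferentiableOn ℂ (fun z : ℂ ↦ ((m.a : ℂ) * z + m.b) / (m.c * z + m.d))
      {z | 0 < z.im} := by
    apply DifferentiableOn.div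
    · fun_prop
    · fun_prop
    · exact hd
  have h2 : DifferentiableOn ℂ (fun z : ℂ ↦ (m.det : ℂ) ^ (k / 2) * (m.c * z + m.d) ^ (-k) *
      (f ∘ ofComplex) (((m.a : ℂ) * z + m.b) / (m.c * z + m.d))) {z | 0 < z.im} := by
    refine DifferentiableOn.mul (DifferentiableOn.mul (by fun_prop) ?_) ?_
    · intro z hz
      refine DifferentiableWithinAt.zpow (by fun_prop) (Or.inl (hd z hz))
    · refine hf.comp h1 fun z hz ↦ ?_
      simp only [Set.mem_ofPred_eq]
      rw [hmap z hz]; exact (glAct _ _).im_pos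
  refine h2.congr fun z hz ↦ ?_
  simp only [Function.comp_apply, sl_apply]
  rw [ofComplex_apply_of_im_pos hz, hmap z hz, ofComplex_apply]

end SlashAction

section Elliptic

lemma dvd_of_root_of_unity {D t : ℤ} (hD : D ≠ 0) {μ : ℂ} {M : ℕ} (hM : 0 < M)
    (hμ : μ ^ M = 1) (ht : (D : ℂ) * (μ + μ⁻¹ + 2) = t ^ 2) : D ∣ t ^ 2 := by
  have h1 : IsIntegral ℤ μ := IsIntegral.of_pow hM (by rw [hμ]; exact isIntegral_one)
  have h2 : IsIntegral ℤ μ⁻¹ :=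
    IsIntegral.of_pow hM (by rw [inv_pow, hμ, inv_one]; exact isIntegral_one)
  have h3 : IsIntegral ℤ (μ + μ⁻¹ + 2) := (h1.add h2).add (isIntegral_algebraMap (x := (2 : ℤ)))
  have hD' : (D : ℂ) ≠ 0 := by exact_mod_cast hD
  have h4 : μ + μ⁻¹ + 2 = ((((t : ℚ) ^ 2 / D : ℚ)) : ℂ) := by
    push_cast; rw [eq_div_iff hD']; linear_combination ht
  rw [h4] at h3
  have h5 : IsIntegral ℤ ((t : ℚ) ^ 2 / D) :=
    (isIntegral_algebraMap_iff (algebraMap ℚ ℂ).injective).1 h3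
  obtain ⟨y, hy⟩ := IsIntegrallyClosed.isIntegral_iff.1 h5
  refine ⟨y, ?_⟩
  have hD'' : (D : ℚ) ≠ 0 := by exact_mod_cast hD
  have : (y : ℚ) = (t : ℚ) ^ 2 / D := by simpa using hy
  rw [eq_div_iff hD''] at this
  have h6 : (t : ℚ) ^ 2 = ((D * y : ℤ) : ℚ) := by push_cast; linear_combination -this
  exact_mod_cast h6

lemma exists_fixed_point {E : IntMat} (ht : E.tr ^ 2 < 4 * E.det) :
    ∃ z : ℂ, 0 < z.im ∧ (E.c : ℂ) * z ^ 2 + (E.d - E.a) * z - E.b = 0 := by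
  have hc : E.c ≠ 0 := by
    intro hc
    have : (E.a - E.d) ^ 2 < 0 := by
      simp only [IntMat.tr, IntMat.det, hc] at ht; nlinarith
    nlinarith [sq_nonneg (E.a - E.d)]
  set δ : ℝ := 4 * E.det - E.tr ^ 2 with hδ
  have hδ0 : 0 < δ := by
    have : ((E.tr ^ 2 : ℤ) : ℝ) < ((4 * E.det : ℤ) : ℝ) := by exact_mod_cast ht
    push_cast at this; linarith
  have hcR : (E.c : ℝ) ≠ 0 := by exact_mod_cast hc
  have hs : (√δ) ^ 2 = δ := Real.sq_sqrt hδ0.le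
  have habs : |(E.c : ℝ)| ^ 2 = (E.c : ℝ) ^ 2 := sq_abs _
  refine ⟨⟨(E.a - E.d) / (2 * E.c), √δ / (2 * |(E.c : ℝ)|)⟩, by positivity, ?_⟩
  have hδ' : δ = 4 * (E.a * E.d - E.b * E.c) - (E.a + E.d) ^ 2 := by
    rw [hδ]; simp [IntMat.det, IntMat.tr]
  set q := |(E.c : ℝ)|
  have hq : q ≠ 0 := by simpa [q] using hc
  have hy : (√δ / (2 * q)) ^ 2 = δ / (4 * (E.c : ℝ) ^ 2) := by
    rw [div_pow, hs, mul_pow, habs]; norm_num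
  set y := √δ / (2 * q)
  apply Complex.ext
  · simp [pow_two]
    have : (E.c : ℝ) * (y * y) = δ / (4 * E.c) := by
      rw [← pow_two, hy]; field_simp
    have h2 : (E.c : ℝ) * ((E.a - E.d) / (2 * E.c) * ((E.a - E.d) / (2 * E.c))) +
        (E.d - E.a) * ((E.a - E.d) / (2 * E.c)) - E.b = δ / (4 * E.c) := by
      rw [hδ']; field_simp; ring
    linear_combination h2 - this
  · simp [pow_two]
    field_simp
    ring

/-- A holomorphic function which transforms by a sign under an elliptic matrix of infinite
order vanishes. -/
theorem eq_zero_of_elliptic {k : ℤ} (hk : Even k) (hkpos : 0 < k) {h : ℍ → ℂ} (hh : Hol h)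
    {E : IntMat} (hE : 0 < E.det) (ht : E.tr ^ 2 < 4 * E.det) (hnd : ¬ E.det ∣ E.tr ^ 2)
    {u : ℂ} (hu : u ^ 2 = 1) (he : sl k E h = u • h) : h = 0 := by
  obtain ⟨z₀, hz₀, hfix⟩ := exists_fixed_point ht
  have hopen : IsOpen {z : ℂ | 0 < z.im} := isOpen_lt continuous_const Complex.continuous_im
  set F : ℂ → ℂ := h ∘ ofComplex with hF
  have hFan : AnalyticOnNhd ℂ F {z | 0 < z.im} := DifferentiableOn.analyticOnNhd hh hopen
  have hd : ∀ z : ℂ, 0 < z.im → (E.c : ℂ) * z + E.d ≠ 0 := fun z hz ↦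
    IntMat.denom_ne_zero hE ⟨z, hz⟩
  set e : ℂ → ℂ := fun z ↦ ((E.a : ℂ) * z + E.b) / (E.c * z + E.d) with he_def
  have hFe : ∀ z : ℂ, 0 < z.im →
      (E.det : ℂ) ^ (k / 2) * (E.c * z + E.d) ^ (-k) * F (e z) = u * F z := by
    intro z hz
    have h1 := congrFun he ⟨z, hz⟩
    rw [sl_apply, Pi.smul_apply, smul_eq_mul] at h1
    have h2 : e z = (glAct E.toReal ⟨z, hz⟩ : ℂ) := (IntMat.coe_glAct hE ⟨z, hz⟩).symm
    rw [hF, Function.comp_apply, Function.comp_apply, h2, ofComplex_apply,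
      ofComplex_apply_of_im_pos hz]
    exact h1
  set j : ℂ := E.c * z₀ + E.d with hj
  have hj0 : j ≠ 0 := hd z₀ hz₀
  have hez₀ : e z₀ = z₀ := by
    simp only [he_def]
    rw [div_eq_iff hj0]
    linear_combination -hfix
  have hdiff : ∀ z : ℂ, 0 < z.im →
      e z - z₀ = (E.det : ℂ) / ((E.c * z + E.d) * j) * (z - z₀) := by
    intro z hz
    have := hd z hz
    conv_lhs => rw [← hez₀]
    simp only [he_def, ← hj]
    rw [div_sub_div _ _ this hj0, div_mul_eq_mul_div]
    congr 1
    simp only [hj, IntMat.det]; push_cast; ring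
  by_cases hzero : ∀ᶠ z in 𝓝 z₀, F z = 0
  · have hpre : IsPreconnected {z : ℂ | 0 < z.im} :=
      (convex_halfSpace_im_gt 0).isPreconnected
    have h1 := hFan.eqOn_zero_of_preconnected_of_eventuallyEq_zero hpre hz₀ hzero
    ext z
    have := h1 z.im_pos
    simpa [hF] using this
  exfalso
  obtain ⟨n, g, hg, hg0, hgF⟩ :=
    (hFan z₀ hz₀).exists_eventuallyEq_pow_smul_nonzero_iff.2 hzero
  have hcont_den : ContinuousAt (fun z : ℂ ↦ (E.c : ℂ) * z + E.d) z₀ := by fun_prop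
  have hecont : ContinuousAt e z₀ := by
    apply ContinuousAt.div _ hcont_den hj0; fun_prop
  have hetend : Tendsto e (𝓝 z₀) (𝓝 z₀) := by
    have := hecont.tendsto; rwa [hez₀] at this
  have hev : ∀ᶠ z in 𝓝[≠] z₀, (E.det : ℂ) ^ (k / 2) * (E.c * z + E.d) ^ (-k) *
      (((E.det : ℂ) / ((E.c * z + E.d) * j)) ^ n * g (e z)) = u * g z := by
    have hA := (hetend.eventually hgF)
    filter_upwards [nhdsWithin_le_nhds hA, nhdsWithin_le_nhds hgF,
      nhdsWithin_le_nhds (hopen.mem_nhds hz₀), self_mem_nhdsWithin] with z h1 h2 h3 h4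
    have h5 := hFe z h3
    rw [h1, h2, hdiff z h3, smul_eq_mul, smul_eq_mul, mul_pow] at h5
    have h6 : (z - z₀) ^ n ≠ 0 := pow_ne_zero _ (sub_ne_zero.2 h4)
    apply mul_right_cancel₀ h6
    linear_combination h5
  have hgc : ContinuousAt g z₀ := hg.continuousAt
  have hge : ContinuousAt (fun z ↦ g (e z)) z₀ := by
    apply ContinuousAt.comp (g := g) _ hecont
    rwa [hez₀]
  have hL : ContinuousAt (fun z ↦ (E.det : ℂ) ^ (k / 2) * (E.c * z + E.d) ^ (-k) *
      (((E.det : ℂ) / ((E.c * z + E.d) * j)) ^ n * g (e z))) z₀ := by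
    refine ContinuousAt.mul (ContinuousAt.mul continuousAt_const
      (hcont_den.zpow₀ _ (Or.inl hj0))) (ContinuousAt.mul (ContinuousAt.pow
      (ContinuousAt.div continuousAt_const (hcont_den.mul continuousAt_const)
        (mul_ne_zero hj0 hj0)) n) hge)
  have hR : ContinuousAt (fun z ↦ u * g z) z₀ := continuousAt_const.mul hgc
  have hlim := tendsto_nhds_unique
    ((hL.tendsto.mono_left nhdsWithin_le_nhds).congr' hev)
    (hR.tendsto.mono_left (nhdsWithin_le_nhds (s := {z₀}ᶜ)))
  simp only [hez₀, ← hj] at hlim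
  obtain ⟨m, rfl⟩ := hk
  lift m to ℕ using by omega
  have hm2 : ((m : ℤ) + m) / 2 = m := by omega
  set μ : ℂ := (E.det : ℂ) / (j * j) with hμ
  have hDne : (E.det : ℂ) ≠ 0 := by exact_mod_cast hE.ne'
  have hμu : μ ^ (m + n) = u := by
    apply mul_right_cancel₀ hg0
    rw [← hlim, hm2, zpow_natCast, _root_.zpow_neg, pow_add, hμ, div_pow, zpow_add₀ hj0, zpow_natCast,
      mul_pow]
    ring
  have hμ1 : μ ^ (2 * (m + n)) = 1 := by rw [mul_comm, pow_mul, hμu, hu]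
  have hquad : j ^ 2 + E.det = E.tr * j := by
    simp only [hj, IntMat.det, IntMat.tr]; push_cast
    linear_combination (E.c : ℂ) * hfix
  refine hnd (dvd_of_root_of_unity hE.ne' (by omega) hμ1 ?_)
  rw [hμ]
  field_simp
  linear_combination (j ^ 2 + E.det + E.tr * j) * hquad

end Elliptic

section Mellin

open MeasureTheory

lemma norm_Gamma_le {s : ℂ} (hs : 0 < s.re) : ‖Gamma s‖ ≤ Real.Gamma s.re := by
  rw [Gamma_eq_integral hs, Real.Gamma_eq_integral hs, GammaIntegral]
  refine (norm_integral_le_integral_norm _).trans_eq ?_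
  refine setIntegral_congr_fun measurableSet_Ioi fun x hx ↦ ?_
  have hx' : (0 : ℝ) < x := hx
  simp only [norm_mul, norm_cpow_eq_rpow_re_of_pos hx', norm_real, Real.norm_eq_abs, sub_re, one_re,
    abs_of_pos (Real.exp_pos _)]

/-- The exponential series `Σ_{n ≥ 0} a (n + 1) e^{-q(n+1)x}`. -/
noncomputable def expSeries (a : ℕ → ℂ) (q x : ℝ) : ℂ :=
  ∑' n : ℕ, a (n + 1) * (Real.exp (-(q * (n + 1)) * x) : ℂ)

variable {a : ℕ → ℂ} {K C q : ℝ}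

lemma summable_div_rpow (ha : ∀ n, ‖a (n + 1)‖ ≤ K * ((n : ℝ) + 1) ^ C) (hq : 0 < q) {σ : ℝ}
    (hσ : C + 1 < σ) : Summable fun n : ℕ ↦ ‖a (n + 1)‖ / (q * ((n : ℝ) + 1)) ^ σ := by
  have h1 : Summable fun n : ℕ ↦ (1 : ℝ) / ((n : ℝ) + 1) ^ (σ - C) := by
    have := (summable_nat_add_iff 1).mpr
      (Real.summable_one_div_nat_rpow (p := σ - C) |>.mpr (by linarith))
    simpa using this
  refine Summable.of_nonneg_of_le (fun n ↦ by positivity) (fun n ↦ ?_)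
    (h1.mul_left (K * (q ^ σ)⁻¹))
  have hn : (0 : ℝ) < (n : ℝ) + 1 := by positivity
  rw [Real.mul_rpow hq.le hn.le, Real.rpow_sub hn]
  calc ‖a (n + 1)‖ / (q ^ σ * ((n : ℝ) + 1) ^ σ)
      ≤ (K * ((n : ℝ) + 1) ^ C) / (q ^ σ * ((n : ℝ) + 1) ^ σ) := by gcongr; exact ha n
    _ = _ := by
      have := (Real.rpow_pos_of_pos hn C).ne'
      have := (Real.rpow_pos_of_pos hn σ).ne'
      have := (Real.rpow_pos_of_pos hq σ).ne'
      field_simp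

lemma summable_bound_exp (d : ℕ) {t : ℝ} (ht : 0 < t) :
    Summable fun n : ℕ ↦ ((n : ℝ) + 1) ^ d * Real.exp (-t * ((n : ℝ) + 1)) := by
  have := (summable_nat_add_iff 1).mpr (Real.summable_pow_mul_exp_neg_nat_mul d ht)
  simpa using this

lemma norm_le_pow (ha : ∀ n, ‖a (n + 1)‖ ≤ K * ((n : ℝ) + 1) ^ C) (n : ℕ) :
    ‖a (n + 1)‖ ≤ K * ((n : ℝ) + 1) ^ ⌈C⌉₊ := by
  have hK : 0 ≤ K := by
    have := (norm_nonneg _).trans (ha 0)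
    simpa using this
  refine (ha n).trans (mul_le_mul_of_nonneg_left ?_ hK)
  rw [← Real.rpow_natCast]
  exact Real.rpow_le_rpow_of_exponent_le (by linarith [(n.cast_nonneg : (0 : ℝ) ≤ n)])
    (Nat.le_ceil C)

lemma summable_expSeries_norm (ha : ∀ n, ‖a (n + 1)‖ ≤ K * ((n : ℝ) + 1) ^ C)
    {t : ℝ} (ht : 0 < t) : Summable fun n : ℕ ↦ ‖a (n + 1)‖ * Real.exp (-t * ((n : ℝ) + 1)) := by
  refine Summable.of_nonneg_of_le (fun n ↦ by positivity) (fun n ↦ ?_)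
    ((summable_bound_exp ⌈C⌉₊ ht).mul_left K)
  rw [← mul_assoc]
  gcongr
  exact norm_le_pow ha n

lemma hasSum_expSeries (ha : ∀ n, ‖a (n + 1)‖ ≤ K * ((n : ℝ) + 1) ^ C)
    (hq : 0 < q) {x : ℝ} (hx : 0 < x) :
    HasSum (fun n : ℕ ↦ a (n + 1) * (Real.exp (-(q * (n + 1)) * x) : ℂ)) (expSeries a q x) := by
  refine Summable.hasSum (Summable.of_norm ?_)
  refine (summable_expSeries_norm ha (mul_pos hq hx)).congr fun n ↦ ?_
  rw [norm_mul, norm_real, Real.norm_eq_abs, abs_of_pos (Real.exp_pos _)]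
  congr 2; ring

lemma hasSum_mellin_expSeries (hC : 0 ≤ C) (ha : ∀ n, ‖a (n + 1)‖ ≤ K * ((n : ℝ) + 1) ^ C)
    (hq : 0 < q) {s : ℂ} (hs : C + 1 < s.re) :
    HasSum (fun n : ℕ ↦ Gamma s * a (n + 1) / ((q * ((n : ℝ) + 1) : ℝ) : ℂ) ^ s)
      (mellin (expSeries a q) s) :=
  hasSum_mellin (p := fun n : ℕ ↦ q * ((n : ℝ) + 1)) (fun n ↦ Or.inr (by positivity))
    (by linarith) (fun t ht ↦ hasSum_expSeries ha hq ht) (summable_div_rpow ha hq hs)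

lemma continuousOn_expSeries (ha : ∀ n, ‖a (n + 1)‖ ≤ K * ((n : ℝ) + 1) ^ C)
    (hq : 0 < q) : ContinuousOn (expSeries a q) (Set.Ioi 0) := by
  intro x hx
  have hx' : (0 : ℝ) < x := hx
  refine ContinuousAt.continuousWithinAt ?_
  have hU : Set.Ioi (x / 2) ∈ 𝓝 x := Ioi_mem_nhds (by linarith)
  refine ContinuousOn.continuousAt ?_ hU
  refine continuousOn_tsum (fun n ↦ by fun_prop)
    (summable_expSeries_norm ha (t := q * (x / 2)) (by positivity)) fun n y hy ↦ ?_
  rw [norm_mul, norm_real, Real.norm_eq_abs, abs_of_pos (Real.exp_pos _)]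
  have hy' : x / 2 < y := hy
  have : q * (x / 2) * ((n : ℝ) + 1) ≤ q * y * ((n : ℝ) + 1) := by gcongr
  refine mul_le_mul_of_nonneg_left (Real.exp_le_exp.mpr ?_) (norm_nonneg _)
  nlinarith

lemma mellinConvergent_expSeries (hC : 0 ≤ C) (ha : ∀ n, ‖a (n + 1)‖ ≤ K * ((n : ℝ) + 1) ^ C)
    (ha1 : a 1 ≠ 0) (hq : 0 < q) {σ : ℝ} (hσ : C + 1 < σ) :
    MellinConvergent (expSeries a q) (σ : ℂ) := by
  set b : ℕ → ℂ := fun n ↦ (‖a n‖ : ℂ) with hb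
  have hbn : ∀ n, ‖b n‖ = ‖a n‖ := fun n ↦ by simp [hb]
  have hb' : ∀ n, ‖b (n + 1)‖ ≤ K * ((n : ℝ) + 1) ^ C := fun n ↦ by rw [hbn]; exact ha n
  have hsum := hasSum_mellin_expSeries (s := (σ : ℂ)) hC hb' hq (by simpa using hσ)
  have hne : mellin (expSeries b q) (σ : ℂ) ≠ 0 := by
    have hterm : ∀ n : ℕ, Gamma (σ : ℂ) * b (n + 1) / ((q * ((n : ℝ) + 1) : ℝ) : ℂ) ^ (σ : ℂ) =
        ((Real.Gamma σ * ‖a (n + 1)‖ / (q * ((n : ℝ) + 1)) ^ σ : ℝ) : ℂ) := fun n ↦ by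
      rw [Complex.Gamma_ofReal, ← ofReal_cpow (by positivity)]
      push_cast; rfl
    simp only [hterm] at hsum
    have hG : 0 < Real.Gamma σ := Real.Gamma_pos_of_pos (by linarith)
    have hr : Summable fun n : ℕ ↦ Real.Gamma σ * ‖a (n + 1)‖ / (q * ((n : ℝ) + 1)) ^ σ := by
      exact_mod_cast hsum.summable
    rw [← hsum.tsum_eq, ← ofReal_tsum]
    refine ofReal_ne_zero.mpr (hr.tsum_pos (fun n ↦ by positivity) 0 ?_).ne'
    have : 0 < ‖a (0 + 1)‖ := by simpa using ha1
    positivity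
  have hInt : MellinConvergent (expSeries b q) (σ : ℂ) := by
    by_contra h
    exact hne (integral_undef h)
  refine Integrable.mono hInt ?_ ?_
  · refine ContinuousOn.aestronglyMeasurable ?_ measurableSet_Ioi
    have hc : ContinuousOn (fun t : ℝ ↦ (t : ℂ) ^ ((σ : ℂ) - 1)) (Set.Ioi 0) := fun t ht ↦
      (continuousAt_ofReal_cpow_const _ _ (Or.inr (ne_of_gt ht))).continuousWithinAt
    exact hc.smul (continuousOn_expSeries ha hq)
  · refine (ae_restrict_iff' measurableSet_Ioi).mpr (Eventually.of_forall fun t ht ↦ ?_)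
    have ht' : (0 : ℝ) < t := ht
    rw [norm_smul, norm_smul]
    gcongr
    have h1 := hasSum_expSeries ha hq ht'
    have h2 := hasSum_expSeries hb' hq ht'
    have h3 : Summable fun n : ℕ ↦ ‖a (n + 1) * (Real.exp (-(q * (n + 1)) * t) : ℂ)‖ := by
      refine (summable_expSeries_norm ha (mul_pos hq ht')).congr fun n ↦ ?_
      rw [norm_mul, norm_real, Real.norm_eq_abs, abs_of_pos (Real.exp_pos _)]
      congr 2; ring
    have h4 : expSeries b q t =
        ((∑' n : ℕ, ‖a (n + 1) * (Real.exp (-(q * (n + 1)) * t) : ℂ)‖ : ℝ) : ℂ) := by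
      rw [← h2.tsum_eq, ofReal_tsum]
      refine tsum_congr fun n ↦ ?_
      rw [norm_mul, norm_real, Real.norm_eq_abs, abs_of_pos (Real.exp_pos _), ofReal_mul]
    rw [h4, norm_real, Real.norm_of_nonneg (tsum_nonneg fun _ ↦ norm_nonneg _), ← h1.tsum_eq]
    exact norm_tsum_le_tsum_norm h3

end Mellin

section Contour

open MeasureTheory

lemma integral_vertical_eq {G : ℂ → ℂ} (hG : Differentiable ℂ G) {a b K : ℝ} (hab : a ≤ b)
    (hK : ∀ s : ℂ, a ≤ s.re → s.re ≤ b → ‖G s‖ ≤ K * (1 + s.im ^ 2)⁻¹) :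
    ∫ y : ℝ, G (a + y * Complex.I) = ∫ y : ℝ, G (b + y * Complex.I) := by
  have hInt : ∀ c : ℝ, a ≤ c → c ≤ b → Integrable fun y : ℝ ↦ G (c + y * Complex.I) := fun c h1 h2 ↦ by
    refine (integrable_inv_one_add_sq.const_mul K).mono'
      (by have := hG.continuous; fun_prop) (Eventually.of_forall fun y ↦ ?_)
    simpa using hK (c + y * Complex.I) (by simpa using h1) (by simpa using h2)
  have hlim : ∀ c : ℝ, a ≤ c → c ≤ b → Tendsto (fun T : ℝ ↦ ∫ y in (-T)..T, G (c + y * Complex.I)) atTop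
      (𝓝 (∫ y : ℝ, G (c + y * Complex.I))) := fun c h1 h2 ↦
    intervalIntegral_tendsto_integral (hInt c h1 h2) tendsto_neg_atTop_atBot tendsto_id
  have hinv : Tendsto (fun T : ℝ ↦ K * (1 + T ^ 2)⁻¹ * |b - a|) atTop (𝓝 0) := by
    have h1 : Tendsto (fun T : ℝ ↦ 1 + T ^ 2) atTop atTop :=
      tendsto_atTop_add_const_left _ _ (tendsto_pow_atTop two_ne_zero)
    simpa using (h1.inv_tendsto_atTop.const_mul K).mul_const |b - a|
  have hhor : ∀ σ : ℝ → ℝ, (∀ T, (σ T) ^ 2 = T ^ 2) →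
      Tendsto (fun T : ℝ ↦ ∫ x in a..b, G (x + (σ T : ℝ) * Complex.I)) atTop (𝓝 0) := fun σ hσ ↦ by
    refine squeeze_zero_norm (fun T ↦ ?_) hinv
    refine intervalIntegral.norm_integral_le_of_norm_le_const fun x hx ↦ ?_
    rw [Set.uIoc_of_le hab] at hx
    have := hK (x + (σ T : ℝ) * Complex.I) (by simpa using hx.1.le) (by simpa using hx.2)
    simpa [hσ] using this
  have hrect : ∀ T : ℝ, Complex.I * (∫ y in (-T)..T, G (b + y * Complex.I)) - Complex.I * ∫ y in (-T)..T, G (a + y * Complex.I) =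
      (∫ x in a..b, G (x + (T : ℝ) * Complex.I)) - ∫ x in a..b, G (x + ((-T : ℝ) : ℂ) * Complex.I) := fun T ↦ by
    have := Complex.integral_boundary_rect_eq_zero_of_differentiableOn G (a + (-T : ℝ) * Complex.I)
      (b + (T : ℝ) * Complex.I) hG.differentiableOn
    simp at this
    simp only [ofReal_neg, neg_mul]
    linear_combination this
  have h1 := (((hlim b hab le_rfl).const_mul Complex.I).sub ((hlim a le_rfl hab).const_mul Complex.I))
  have h2 := (hhor id fun _ ↦ rfl).sub (hhor (fun T ↦ -T) fun T ↦ by ring)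
  have h3 := tendsto_nhds_unique h1 (h2.congr fun T ↦ (hrect T).symm)
  have h4 : Complex.I * (∫ y : ℝ, G (b + y * Complex.I)) = Complex.I * ∫ y : ℝ, G (a + y * Complex.I) := by
    rw [sub_zero] at h3; exact sub_eq_zero.mp h3
  exact (mul_left_cancel₀ I_ne_zero h4).symm

/-- A functional equation together with decay on one vertical line gives decay in a strip. -/
lemma decay_in_strip {Φ : ℂ → ℂ} (hΦ : Differentiable ℂ Φ)
    (hbdd : ∀ σ₁ σ₂ : ℝ, ∃ M : ℝ, ∀ s : ℂ, σ₁ ≤ s.re → s.re ≤ σ₂ → ‖Φ s‖ ≤ M)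
    {k c : ℝ} (hk : 0 ≤ k) (hc : k < c) {ω : ℂ} (hω : ‖ω‖ = 1)
    (hfe : ∀ s, Φ s = ω * Φ (k - s)) {K : ℝ} (hK : ∀ s : ℂ, s.re = c → ‖s ^ 2 * Φ s‖ ≤ K) :
    ∃ K', ∀ s : ℂ, k - c ≤ s.re → s.re ≤ c → ‖Φ s‖ ≤ K' * (1 + s.im ^ 2)⁻¹ := by
  obtain ⟨M, hM⟩ := hbdd (k - c) c
  have hM0 : 0 ≤ M := (norm_nonneg _).trans (hM c (by simp; linarith) (by simp))
  have hl : ∀ s : ℂ, s.re = k - c → ‖s ^ 2 * Φ s‖ ≤ K := fun s hs ↦ by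
    have h1 := hK (k - s) (by simp [hs])
    rw [hfe s, norm_mul, norm_mul, hω, one_mul]
    refine le_trans ?_ h1
    rw [norm_mul, norm_pow, norm_pow]
    have h2 : ‖s‖ ^ 2 ≤ ‖(k : ℂ) - s‖ ^ 2 := by
      rw [← normSq_eq_norm_sq, ← normSq_eq_norm_sq, normSq_apply, normSq_apply]
      simp only [sub_re, ofReal_re, sub_im, ofReal_im, hs]
      nlinarith
    gcongr
  have hstrip : ∀ s : ℂ, k - c ≤ s.re → s.re ≤ c → ‖s ^ 2 * Φ s‖ ≤ K := fun s h1 h2 ↦ by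
    refine PhragmenLindelof.vertical_strip (f := fun s ↦ s ^ 2 * Φ s) (a := k - c) (b := c)
      (by fun_prop : Differentiable ℂ fun s ↦ s ^ 2 * Φ s).diffContOnCl ?_ hl hK h1 h2
    have hba : 0 < c - (k - c) := by linarith
    set δ := Real.pi / (c - (k - c)) / 2 with hδ
    have hδ0 : 0 < δ := by positivity
    refine ⟨δ, by rw [hδ]; exact half_lt_self (by positivity), 1 / δ, ?_⟩
    refine IsBigO.of_bound (2 * Real.exp c * M) ?_
    refine Filter.mem_inf_of_right ?_
    rw [mem_principal]
    intro z hz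
    simp only [Set.mem_preimage, Set.mem_Ioo] at hz
    simp only [Set.mem_ofPred_eq]
    have hz1 : ‖z‖ ≤ c + |z.im| := (norm_le_abs_re_add_abs_im z).trans (by
      gcongr; rw [abs_le]; constructor <;> linarith)
    have hc0 : 0 ≤ c := hk.trans hc.le
    have h3 : ‖z‖ ^ 2 ≤ 2 * Real.exp c * Real.exp |z.im| := by
      rw [mul_assoc, ← Real.exp_add]
      have h5 : 0 ≤ c + |z.im| := by positivity
      have h4 := Real.quadratic_le_exp_of_nonneg h5
      have h6 : ‖z‖ ^ 2 ≤ (c + |z.im|) ^ 2 := by gcongr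
      nlinarith
    have h7 : Real.exp |z.im| ≤ Real.exp (1 / δ * Real.exp (δ * |z.im|)) := by
      refine Real.exp_le_exp.mpr ?_
      have := Real.add_one_le_exp (δ * |z.im|)
      rw [one_div, ← div_eq_inv_mul, le_div_iff₀ hδ0]
      linarith
    rw [norm_mul, norm_pow, Real.norm_of_nonneg (Real.exp_pos _).le]
    calc ‖z‖ ^ 2 * ‖Φ z‖ ≤ (2 * Real.exp c * Real.exp |z.im|) * M := by
          gcongr; exact hM z hz.1.le hz.2.le
      _ = 2 * Real.exp c * M * Real.exp |z.im| := by ring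
      _ ≤ _ := by gcongr
  refine ⟨K + M, fun s h1 h2 ↦ ?_⟩
  have hp : 0 < 1 + s.im ^ 2 := by positivity
  rw [← div_eq_mul_inv, le_div_iff₀ hp]
  have h3 := hstrip s h1 h2
  have h4 := hM s h1 h2
  rw [norm_mul, norm_pow] at h3
  have h5 : s.im ^ 2 ≤ ‖s‖ ^ 2 := by
    rw [← normSq_eq_norm_sq, normSq_apply]; nlinarith
  nlinarith [norm_nonneg (Φ s), mul_le_mul_of_nonneg_right h5 (norm_nonneg (Φ s))]

/-- Mellin inversion turns the functional equation of `Φ` into a reflection formula. -/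
lemma reflection_of_functional_equation {Φ : ℂ → ℂ} {φ : ℝ → ℂ} (hΦ : Differentiable ℂ Φ)
    {k c K : ℝ} (hkc : k < 2 * c) {ω : ℂ}
    (hfe : ∀ s, Φ s = ω * Φ (k - s))
    (hK : ∀ s : ℂ, k - c ≤ s.re → s.re ≤ c → ‖Φ s‖ ≤ K * (1 + s.im ^ 2)⁻¹)
    (hmel : ∀ s : ℂ, s.re = c → mellin φ s = Φ s) (hconv : MellinConvergent φ (c : ℂ))
    (hφ : ContinuousOn φ (Set.Ioi 0)) {x : ℝ} (hx : 0 < x) :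
    φ x = ω * (x : ℂ) ^ (-(k : ℂ)) * φ (1 / x) := by
  have hvert : VerticalIntegrable (mellin φ) c := by
    have : (fun y : ℝ ↦ mellin φ (c + y * Complex.I)) = fun y : ℝ ↦ Φ (c + y * Complex.I) :=
      funext fun y ↦ hmel _ (by simp)
    rw [VerticalIntegrable, this]
    refine (integrable_inv_one_add_sq.const_mul K).mono'
      (by have := hΦ.continuous; fun_prop) (Eventually.of_forall fun y ↦ ?_)
    simpa using hK (c + y * Complex.I) (by simp; linarith) (by simp)
  have hinv : ∀ t : ℝ, 0 < t →
      φ t = (1 / (2 * Real.pi)) • ∫ y : ℝ, (t : ℂ) ^ (-((c : ℂ) + y * Complex.I)) * Φ (c + y * Complex.I) :=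
    fun t ht ↦ by
      rw [← mellinInv_mellin_eq c φ ht hconv hvert (hφ.continuousAt (Ioi_mem_nhds ht)), mellinInv]
      congr 1
      refine integral_congr_ae (Eventually.of_forall fun y ↦ ?_)
      simp only [smul_eq_mul]
      rw [hmel _ (by simp)]
  have hx0 : (x : ℂ) ≠ 0 := by exact_mod_cast hx.ne'
  have hshift : ∫ y : ℝ, (x : ℂ) ^ (-(((k - c : ℝ) : ℂ) + y * Complex.I)) * Φ ((k - c : ℝ) + y * Complex.I) =
      ∫ y : ℝ, (x : ℂ) ^ (-((c : ℂ) + y * Complex.I)) * Φ (c + y * Complex.I) := by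
    set B := max (x ^ (-(k - c))) (x ^ (-c)) with hB
    refine integral_vertical_eq (G := fun s ↦ (x : ℂ) ^ (-s) * Φ s) (K := B * K) ?_
      (by linarith) fun s h1 h2 ↦ ?_
    · have : Differentiable ℂ fun s : ℂ ↦ (x : ℂ) ^ (-s) :=
        (differentiable_neg).const_cpow (Or.inl hx0)
      exact this.mul hΦ
    · rw [norm_mul, norm_cpow_eq_rpow_re_of_pos hx, mul_assoc]
      refine mul_le_mul ?_ (hK s h1 h2) (norm_nonneg _) (by positivity)
      rw [neg_re]
      rcases le_total 1 x with h | h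
      · exact (Real.rpow_le_rpow_of_exponent_le h (by linarith)).trans (le_max_left _ _)
      · exact (Real.rpow_le_rpow_of_exponent_ge hx h (by linarith)).trans (le_max_right _ _)
  rw [hinv x hx, hinv (1 / x) (by positivity), ← hshift, mul_smul_comm]
  congr 1
  rw [← integral_const_mul, ← integral_neg_eq_self]
  refine integral_congr_ae (Eventually.of_forall fun y ↦ ?_)
  simp only
  rw [hfe]
  have h1 : (k : ℂ) - (((k - c : ℝ) : ℂ) + ((-y : ℝ) : ℂ) * Complex.I) = c + y * Complex.I := by push_cast; ring
  have h2 : (x : ℂ) ^ (-(((k - c : ℝ) : ℂ) + ((-y : ℝ) : ℂ) * Complex.I)) =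
      (x : ℂ) ^ (-(k : ℂ)) * ((1 / x : ℝ) : ℂ) ^ (-((c : ℂ) + y * Complex.I)) := by
    rw [one_div, ofReal_inv, inv_cpow _ _ (by rw [arg_ofReal_of_nonneg hx.le]; exact Real.pi_pos.ne),
      ← Complex.cpow_neg, ← Complex.cpow_add _ _ hx0]
    congr 1; push_cast; ring
  rw [h1, h2]; ring

end Contour

section Fricke

variable {a : ℕ → ℂ} {K C : ℝ}

lemma exists_coeff_bound (hgrowth : (fun n : ℕ ↦ a n) =O[atTop] fun n : ℕ ↦ (n : ℝ) ^ C) :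
    ∃ K, ∀ n : ℕ, ‖a (n + 1)‖ ≤ K * ((n : ℝ) + 1) ^ C := by
  have h := hgrowth.comp_tendsto (tendsto_add_atTop_nat 1)
  rw [isBigO_nat_atTop_iff] at h
  · obtain ⟨K, hK⟩ := h
    refine ⟨K, fun n ↦ ?_⟩
    have := hK n
    simp only [Function.comp_apply, Nat.cast_add, Nat.cast_one] at this
    rwa [Real.norm_of_nonneg (by positivity)] at this
  · intro n hn
    simp only [Function.comp_apply, Nat.cast_add, Nat.cast_one] at hn
    have : (0 : ℝ) < ((n : ℝ) + 1) ^ C := by positivity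
    linarith

lemma hol_fourierSeries (ha : ∀ n, ‖a (n + 1)‖ ≤ K * ((n : ℝ) + 1) ^ C) :
    Hol (fourierSeries a) := by
  have key : ∀ z : ℂ, 0 < z.im → DifferentiableAt ℂ (fun z : ℂ ↦ ∑' n : ℕ, a (n + 1) *
      Complex.exp (2 * (Real.pi : ℂ) * Complex.I * ((n : ℂ) + 1) * z)) z := fun z hz ↦ by
    have hopen : IsOpen {w : ℂ | z.im / 2 < w.im} := isOpen_lt continuous_const continuous_im
    refine DifferentiableOn.differentiableAt (s := {w : ℂ | z.im / 2 < w.im}) ?_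
      (hopen.mem_nhds (by simp only [Set.mem_ofPred_eq]; linarith))
    refine Complex.differentiableOn_tsum_of_summable_norm
      (summable_expSeries_norm ha (t := 2 * Real.pi * (z.im / 2)) (by positivity))
      (fun n ↦ by fun_prop) hopen fun n w hw ↦ ?_
    rw [norm_mul, Complex.norm_exp]
    refine mul_le_mul_of_nonneg_left (Real.exp_le_exp.mpr ?_) (norm_nonneg _)
    have h1 : (2 * (Real.pi : ℂ) * Complex.I * ((n : ℂ) + 1) * w).re =
        -(2 * Real.pi * w.im * ((n : ℝ) + 1)) := by
      have : 2 * (Real.pi : ℂ) * Complex.I * ((n : ℂ) + 1) * w =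
        ((2 * Real.pi * ((n : ℝ) + 1) : ℝ) : ℂ) * (Complex.I * w) := by push_cast; ring
      rw [this, re_ofReal_mul]; simp; ring
    have hw' : z.im / 2 < w.im := hw
    have h2 : 2 * Real.pi * (z.im / 2) * ((n : ℝ) + 1) ≤ 2 * Real.pi * w.im * ((n : ℝ) + 1) := by
      gcongr
    rw [h1]; linarith
  refine DifferentiableOn.congr (f := fun z : ℂ ↦ ∑' n : ℕ, a (n + 1) *
      Complex.exp (2 * (Real.pi : ℂ) * Complex.I * ((n : ℂ) + 1) * z))
    (fun z hz ↦ (key z hz).differentiableWithinAt) fun z hz ↦ ?_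
  simp only [Function.comp_apply, fourierSeries]
  rw [ofComplex_apply_of_im_pos hz]

lemma Hol.eq_zero_of_imaginary_axis {g : ℍ → ℂ} (hg : Hol g)
    (h0 : ∀ y : ℝ, 0 < y → (g ∘ ofComplex) (Complex.I * y) = 0) : g = 0 := by
  have hopen : IsOpen {z : ℂ | 0 < z.im} := isOpen_lt continuous_const continuous_im
  have hconn : IsPreconnected {z : ℂ | 0 < z.im} := (convex_halfSpace_im_gt 0).isPreconnected
  have hfreq : ∃ᶠ z in 𝓝[≠] Complex.I, (g ∘ ofComplex) z = 0 := by
    have ht : Tendsto (fun t : ℝ ↦ Complex.I * (t : ℂ)) (𝓝[≠] 1) (𝓝[≠] Complex.I) := by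
      refine tendsto_nhdsWithin_iff.mpr ⟨?_, ?_⟩
      · refine tendsto_nhdsWithin_of_tendsto_nhds ?_
        have : Continuous fun t : ℝ ↦ Complex.I * (t : ℂ) := by fun_prop
        simpa using this.tendsto 1
      · filter_upwards [self_mem_nhdsWithin] with t ht h
        refine ht ?_
        have := congrArg Complex.im h
        simpa using this
    refine ht.frequently (Eventually.frequently ?_)
    have : Set.Ioi (0 : ℝ) ∈ 𝓝[≠] (1 : ℝ) := mem_nhdsWithin_of_mem_nhds (Ioi_mem_nhds one_pos)
    filter_upwards [this] with t ht using h0 t ht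
  have := (hg.analyticOnNhd hopen).eqOn_zero_of_preconnected_of_frequently_eq_zero hconn
    (show Complex.I ∈ {z : ℂ | 0 < z.im} by simp) hfreq
  ext z
  have hz := this (show (z : ℂ) ∈ {z : ℂ | 0 < z.im} from z.im_pos)
  simpa using hz

/-- Hecke's converse theorem: the functional equation of the Dirichlet series gives the
behaviour of `f` under the Fricke involution. -/
lemma fricke_eigenfunction {N : ℕ} (hN : 0 < N) {k : ℤ} (hkpos : 0 < k) (hkeven : Even k)
    (ha1 : a 1 = 1) (hC : 0 < C) (ha : ∀ n, ‖a (n + 1)‖ ≤ K * ((n : ℝ) + 1) ^ C)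
    {ε : ℝ} (hε : ε = 1 ∨ ε = -1) {Φ : ℂ → ℂ} (hΦ : Differentiable ℂ Φ)
    (hΦeq : ∀ s : ℂ, C + 2 < s.re →
      Φ s = ((Real.sqrt N : ℂ) / (2 * (Real.pi : ℂ))) ^ s * Complex.Gamma s * dirichletSeries a s)
    (hΦbdd : ∀ σ₁ σ₂ : ℝ, ∃ M : ℝ, ∀ s : ℂ, σ₁ ≤ s.re → s.re ≤ σ₂ → ‖Φ s‖ ≤ M)
    (hΦfe : ∀ s : ℂ, Φ s = (ε : ℂ) * (-1 : ℂ) ^ (k / 2) * Φ ((k : ℂ) - s)) :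
    sl k ⟨0, -1, N, 0⟩ (fourierSeries a) = (ε : ℂ) • fourierSeries a := by
  have hNr : (0 : ℝ) < N := by exact_mod_cast hN
  have hsq : 0 < Real.sqrt N := Real.sqrt_pos.mpr hNr
  set q : ℝ := 2 * Real.pi / Real.sqrt N with hqdef
  have hq : 0 < q := by positivity
  set ω : ℂ := (ε : ℂ) * (-1 : ℂ) ^ (k / 2) with hωdef
  have hε2 : (ε : ℂ) * ε = 1 := by rcases hε with rfl | rfl <;> simp
  have hω : ‖ω‖ = 1 := by
    rw [hωdef, norm_mul, norm_zpow, norm_neg, norm_one, _root_.one_zpow, mul_one]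
    rcases hε with rfl | rfl <;> simp
  have hkr : (0 : ℝ) < k := by exact_mod_cast hkpos
  set c : ℝ := k + C + 3 with hcdef
  have hmel : ∀ s : ℂ, s.re = c → mellin (expSeries a q) s = Φ s := fun s hs ↦ by
    have h1 := hasSum_mellin_expSeries hC.le ha hq (s := s) (by rw [hs]; linarith)
    rw [hΦeq s (by rw [hs]; linarith), ← h1.tsum_eq, dirichletSeries, ← tsum_mul_left]
    refine tsum_congr fun n ↦ ?_
    have h2 : (((q * ((n : ℝ) + 1) : ℝ) : ℂ)) ^ s = (q : ℂ) ^ s * ((n : ℂ) + 1) ^ s := by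
      rw [ofReal_mul, mul_cpow_ofReal_nonneg hq.le (by positivity)]
      push_cast; rfl
    have h3 : ((Real.sqrt N : ℂ) / (2 * (Real.pi : ℂ))) ^ s = ((q : ℂ) ^ s)⁻¹ := by
      rw [← inv_cpow _ _ (by rw [arg_ofReal_of_nonneg hq.le]; exact Real.pi_pos.ne)]
      congr 1; rw [hqdef]; push_cast; rw [inv_div]
    rw [h2, h3, div_mul_eq_div_div]
    field_simp
  have hdecay : ∀ s : ℂ, s.re = c → ‖s ^ 2 * Φ s‖ ≤ Real.Gamma (c + 2) *
      ∑' n : ℕ, ‖a (n + 1)‖ / (q * ((n : ℝ) + 1)) ^ c := fun s hs ↦ by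
    have hc0 : 0 < c := by positivity
    have h1 := hasSum_mellin_expSeries hC.le ha hq (s := s) (by rw [hs]; linarith)
    have hs0 : s ≠ 0 := fun h ↦ by rw [h] at hs; simp at hs; linarith
    have hs1 : s + 1 ≠ 0 := fun h ↦ by
      have := congrArg Complex.re h; simp [hs] at this; linarith
    have hG : Gamma (s + 2) = (s + 1) * (s * Gamma s) := by
      rw [← Gamma_add_one s hs0, ← Gamma_add_one (s + 1) hs1]; congr 1; ring
    have h2 : ‖s‖ ≤ ‖s + 1‖ := by
      rw [← abs_of_nonneg (norm_nonneg s), ← abs_of_nonneg (norm_nonneg (s + 1)), ← sq_le_sq,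
        ← normSq_eq_norm_sq, ← normSq_eq_norm_sq, normSq_apply, normSq_apply]
      simp only [add_re, one_re, add_im, one_im, hs]
      nlinarith
    have h3 : ‖s ^ 2 * Gamma s‖ ≤ Real.Gamma (c + 2) := by
      calc ‖s ^ 2 * Gamma s‖ = ‖s‖ * (‖s‖ * ‖Gamma s‖) := by rw [norm_mul, norm_pow]; ring
        _ ≤ ‖s + 1‖ * (‖s‖ * ‖Gamma s‖) := by gcongr
        _ = ‖Gamma (s + 2)‖ := by rw [hG, norm_mul, norm_mul]
        _ ≤ Real.Gamma (s + 2).re := norm_Gamma_le (by simp [hs]; linarith)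
        _ = _ := by simp [hs]
    have hsum := summable_div_rpow ha hq (σ := c) (by linarith)
    rw [← hmel s hs, ← h1.tsum_eq, ← tsum_mul_left, ← tsum_mul_left]
    have hterm : ∀ n : ℕ, ‖s ^ 2 * (Gamma s * a (n + 1) / ((q * ((n : ℝ) + 1) : ℝ) : ℂ) ^ s)‖ ≤
        Real.Gamma (c + 2) * (‖a (n + 1)‖ / (q * ((n : ℝ) + 1)) ^ c) := fun n ↦ by
      have : s ^ 2 * (Gamma s * a (n + 1) / ((q * ((n : ℝ) + 1) : ℝ) : ℂ) ^ s) =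
        (s ^ 2 * Gamma s) * (a (n + 1) / ((q * ((n : ℝ) + 1) : ℝ) : ℂ) ^ s) := by ring
      rw [this, norm_mul, norm_div, norm_cpow_eq_rpow_re_of_pos (by positivity), hs]
      gcongr
    exact tsum_of_norm_bounded (hsum.mul_left _).hasSum hterm
  obtain ⟨K', hK'⟩ := decay_in_strip hΦ hΦbdd hkr.le (by linarith : (k : ℝ) < c) hω
    (by simpa using hΦfe) hdecay
  have hrefl : ∀ x : ℝ, 0 < x →
      expSeries a q x = ω * (x : ℂ) ^ (-((k : ℝ) : ℂ)) * expSeries a q (1 / x) := fun x hx ↦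
    reflection_of_functional_equation hΦ (by linarith) (by simpa using hΦfe) hK' hmel
      (mellinConvergent_expSeries hC.le ha (by simp [ha1]) hq (by linarith))
      (continuousOn_expSeries ha hq) hx
  have hf : ∀ (z : ℍ) (x : ℝ), (z : ℂ) = Complex.I * ((x / Real.sqrt N : ℝ) : ℂ) →
      fourierSeries a z = expSeries a q x := fun z x hz ↦ by
    rw [fourierSeries, expSeries]
    refine tsum_congr fun n ↦ ?_
    rw [hz, ofReal_exp]
    congr 2
    rw [hqdef]; push_cast
    linear_combination (2 * (Real.pi : ℂ) * ((n : ℂ) + 1) * (x / (Real.sqrt N : ℂ))) * I_mul_I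
  have hdet : 0 < (⟨0, -1, N, 0⟩ : IntMat).det := by simp [IntMat.det, hN]
  rw [← sub_eq_zero]
  refine Hol.eq_zero_of_imaginary_axis (((hol_fourierSeries ha).sl hdet k).sub
    ((hol_fourierSeries ha).smul _)) fun y hy ↦ ?_
  set x : ℝ := y * Real.sqrt N with hxdef
  have hx : 0 < x := by positivity
  have hz : 0 < (Complex.I * (y : ℂ)).im := by simpa using hy
  have hsqc : (Real.sqrt N : ℂ) ≠ 0 := by exact_mod_cast hsq.ne'
  have hyc : (y : ℂ) ≠ 0 := by exact_mod_cast hy.ne'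
  have hNs : (Real.sqrt N : ℂ) * Real.sqrt N = N := by
    exact_mod_cast Real.mul_self_sqrt hNr.le
  have hNc : (N : ℂ) ≠ 0 := by exact_mod_cast hN.ne'
  simp only [Function.comp_apply, Pi.sub_apply, Pi.smul_apply, smul_eq_mul]
  rw [ofComplex_apply_of_im_pos hz, sl_apply]
  rw [hf ⟨_, hz⟩ x (by simp [hxdef, hsqc]), hf (glAct _ _) (1 / x) ?_, hrefl x hx]
  · obtain ⟨j, rfl⟩ := hkeven
    have hj : (j + j) / 2 = j := by omega
    rw [hωdef, hj]
    have h1 : ((⟨0, -1, N, 0⟩ : IntMat).det : ℂ) = N := by simp [IntMat.det]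
    have h2 : (x : ℂ) ^ (-(((j + j : ℤ) : ℝ) : ℂ)) = (x : ℂ) ^ (-(j + j)) := by
      rw [← cpow_intCast]; push_cast; rfl
    rw [h1, h2, hxdef]
    simp only [Int.cast_zero, add_zero, Int.cast_natCast]
    have h3 : (N : ℂ) ^ j * ((N : ℂ) * (Complex.I * y)) ^ (-(j + j)) =
        (-1) ^ j * ((y * Real.sqrt N : ℝ) : ℂ) ^ (-(j + j)) := by
      have h4 : (N : ℂ) * (Complex.I * y) = Real.sqrt N * (Complex.I * (y * Real.sqrt N)) := by
        rw [← hNs]; ring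
      have h5 : ∀ w : ℂ, w ^ (-(j + j)) = (w * w) ^ (-j) := fun w ↦ by
        rcases eq_or_ne w 0 with rfl | hw
        · rcases eq_or_ne j 0 with rfl | hj0
          · simp
          · rw [_root_.zero_zpow _ (by omega), mul_zero, _root_.zero_zpow _ (by omega)]
        · rw [mul_zpow, ← zpow_add₀ hw]; congr 1; ring
      have h6 : (N : ℂ) ^ j * (N : ℂ) ^ (-j) = 1 := by rw [← zpow_add₀ hNc]; simp
      have h7 : ((-1 : ℂ)) ^ (-j) = (-1) ^ j := by
        rw [_root_.zpow_neg, ← _root_.inv_zpow]; norm_num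
      rw [h4, mul_zpow, h5 (Real.sqrt N : ℂ), hNs, ← mul_assoc, h6, one_mul, mul_zpow, h5 Complex.I,
        I_mul_I, h7]
      push_cast; rfl
    rw [h3]
    linear_combination (-(-1) ^ j * ((y * Real.sqrt N : ℝ) : ℂ) ^ (-(j + j)) *
      expSeries a q (1 / (y * Real.sqrt N))) * hε2
  · rw [IntMat.coe_glAct hdet]
    simp only [Int.cast_zero, zero_mul, zero_add, add_zero, Int.cast_neg, Int.cast_one,
      Int.cast_natCast]
    rw [hxdef, div_eq_iff (by simp [hNc, hyc])]
    push_cast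
    rw [← hNs]
    field_simp
    rw [I_sq]

end Fricke

section EulerFactor

/-- The coefficients of the power series `(1 - A X + B X²)⁻¹`. -/
def quadCoeff (A B : ℂ) : ℕ → ℂ
  | 0 => 1
  | 1 => A
  | n + 2 => A * quadCoeff A B (n + 1) - B * quadCoeff A B n

lemma norm_quadCoeff_le {A B : ℂ} {r : ℝ} (hr : 0 ≤ r) (hA : ‖A‖ ≤ r / 2)
    (hB : ‖B‖ ≤ r ^ 2 / 2) (n : ℕ) : ‖quadCoeff A B n‖ ≤ r ^ n := by
  induction n using Nat.strong_induction_on with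
  | _ n ih =>
    match n with
    | 0 => simp [quadCoeff]
    | 1 => simpa [quadCoeff] using hA.trans (half_le_self hr)
    | n + 2 =>
      have h1 := ih (n + 1) (by omega)
      have h2 := ih n (by omega)
      rw [quadCoeff]
      refine (norm_sub_le _ _).trans ?_
      rw [norm_mul, norm_mul]
      calc ‖A‖ * ‖quadCoeff A B (n + 1)‖ + ‖B‖ * ‖quadCoeff A B n‖
          ≤ r / 2 * r ^ (n + 1) + r ^ 2 / 2 * r ^ n := by gcongr
        _ = r ^ (n + 2) := by ring

lemma tsum_quadCoeff {A B X : ℂ} (h : Summable fun n ↦ quadCoeff A B n * X ^ n) :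
    ∑' n, quadCoeff A B n * X ^ n = (1 - A * X + B * X ^ 2)⁻¹ := by
  apply eq_inv_of_mul_eq_one_left
  have h1 : Summable fun n ↦ quadCoeff A B (n + 1) * X ^ (n + 1) := (summable_nat_add_iff 1).mpr h
  have e0 := h.tsum_eq_zero_add
  have e1 := h1.tsum_eq_zero_add
  have e2 : ∑' n, quadCoeff A B (n + 1 + 1) * X ^ (n + 1 + 1) =
      A * X * (∑' n, quadCoeff A B (n + 1) * X ^ (n + 1)) -
        B * X ^ 2 * ∑' n, quadCoeff A B n * X ^ n := by
    rw [← tsum_mul_left, ← tsum_mul_left, ← (h1.mul_left _).tsum_sub (h.mul_left _)]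
    refine tsum_congr fun n ↦ ?_
    rw [quadCoeff]; ring
  rw [e2] at e1
  simp only [quadCoeff, zero_add, pow_zero, mul_one, pow_one] at e0 e1
  linear_combination e0 * (1 - A * X) + e1

/-- The multiplicative function with given values at prime powers. -/
noncomputable def multExt (u : ℕ → ℕ → ℂ) (n : ℕ) : ℂ :=
  if n = 0 then 0 else n.factorization.prod u

variable {u : ℕ → ℕ → ℂ}

lemma multExt_mul {m n : ℕ} (hmn : m.Coprime n) :
    multExt u (m * n) = multExt u m * multExt u n := by
  rcases eq_or_ne m 0 with rfl | hm
  · simp [multExt]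
  rcases eq_or_ne n 0 with rfl | hn
  · simp [multExt]
  rw [multExt, multExt, multExt, if_neg hm, if_neg hn, if_neg (mul_ne_zero hm hn),
    Nat.factorization_mul_of_coprime hmn, Finsupp.prod_add_index_of_disjoint]
  simpa using hmn.disjoint_primeFactors

lemma multExt_one : multExt u 1 = 1 := by simp [multExt]

lemma multExt_prime_pow (hu : ∀ p, u p 0 = 1) {p : ℕ} (hp : p.Prime) (e : ℕ) :
    multExt u (p ^ e) = u p e := by
  rw [multExt, if_neg (pow_ne_zero _ hp.ne_zero), hp.factorization_pow,
    Finsupp.prod_single_index (hu p)]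

lemma norm_multExt_le {D : ℕ} (h : ∀ p : ℕ, p.Prime → ∀ e : ℕ, ‖u p e‖ ≤ ((p : ℝ) ^ D) ^ e)
    (n : ℕ) (hn : n ≠ 0) : ‖multExt u n‖ ≤ (n : ℝ) ^ D := by
  rw [multExt, if_neg hn]
  have h1 : (n : ℝ) ^ D = n.factorization.prod fun p e ↦ ((p : ℝ) ^ D) ^ e := by
    conv_lhs => rw [← Nat.prod_factorization_pow_eq_self hn]
    rw [Finsupp.prod, Finsupp.prod, Nat.cast_prod, ← Finset.prod_pow]
    refine Finset.prod_congr rfl fun p _ ↦ ?_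
    rw [Nat.cast_pow, pow_right_comm]
  rw [h1, Finsupp.prod, Finsupp.prod, norm_prod]
  refine Finset.prod_le_prod (fun _ _ ↦ norm_nonneg _) fun p hp ↦ h p ?_ _
  exact Nat.prime_of_mem_primeFactors (by simpa using hp)

lemma natCast_pow_cpow (p e : ℕ) (s : ℂ) : ((p ^ e : ℕ) : ℂ) ^ s = ((p : ℂ) ^ s) ^ e := by
  induction e with
  | zero => simp
  | succ e ih => rw [pow_succ, pow_succ, Nat.cast_mul, natCast_mul_natCast_cpow, ih]

/-- A Dirichlet series with an Euler product whose local factors are `(1 - A X + B X²)⁻¹`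
satisfies the corresponding recursions. -/
lemma coeff_recursion_of_eulerProduct {a : ℕ → ℂ} {A B : ℕ → ℂ} {K : ℝ} {E D : ℕ}
    (ha : ∀ n : ℕ, ‖a (n + 1)‖ ≤ K * ((n : ℝ) + 1) ^ E)
    (hA : ∀ p : ℕ, p.Prime → ‖A p‖ ≤ (p : ℝ) ^ D / 2)
    (hB : ∀ p : ℕ, p.Prime → ‖B p‖ ≤ ((p : ℝ) ^ D) ^ 2 / 2) {x₀ : ℝ}
    (hEuler : ∀ s : ℂ, x₀ < s.re → dirichletSeries a s =
      ∏' p : Nat.Primes, (1 - A p * ((p : ℕ) : ℂ) ^ (-s) + B p * (((p : ℕ) : ℂ) ^ (-s)) ^ 2)⁻¹)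
    {p : ℕ} (hp : p.Prime) {n : ℕ} (hn : n ≠ 0) :
    (¬ p ∣ n → a (p * n) = A p * a n) ∧ a (p * (p * n)) = A p * a (p * n) - B p * a n := by
  set u : ℕ → ℕ → ℂ := fun p ↦ quadCoeff (A p) (B p) with hu
  have hu0 : ∀ p, u p 0 = 1 := fun p ↦ rfl
  set b := multExt u with hb
  have hbn : ∀ n : ℕ, n ≠ 0 → ‖b n‖ ≤ 1 * (n : ℝ) ^ ((D : ℝ) : ℝ) := fun n hn ↦ by
    rw [one_mul, Real.rpow_natCast]
    exact norm_multExt_le (fun p hp e ↦ norm_quadCoeff_le (by positivity) (hA p hp) (hB p hp) e)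
      n hn
  have hb0 : b 0 = 0 := by simp [hb, multExt]
  have han : ∀ n : ℕ, n ≠ 0 → ‖a n‖ ≤ K * (n : ℝ) ^ ((E : ℝ) : ℝ) := fun n hn ↦ by
    obtain ⟨m, rfl⟩ := Nat.exists_eq_succ_of_ne_zero hn
    rw [Real.rpow_natCast]
    simpa using ha m
  have habsb : LSeries.abscissaOfAbsConv b < ⊤ :=
    (LSeries.abscissaOfAbsConv_le_of_le_const_mul_rpow ⟨_, hbn⟩).trans_lt (by
      exact_mod_cast EReal.coe_lt_top ((D : ℝ) + 1))
  have habsa : LSeries.abscissaOfAbsConv a < ⊤ :=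
    (LSeries.abscissaOfAbsConv_le_of_le_const_mul_rpow ⟨_, han⟩).trans_lt (by
      exact_mod_cast EReal.coe_lt_top ((E : ℝ) + 1))
  have hdir : ∀ s : ℂ, (E : ℝ) + 1 < s.re → LSeries a s = dirichletSeries a s := fun s hs ↦ by
    have hsum : LSeriesSummable a s :=
      LSeriesSummable_of_le_const_mul_rpow (x := (E : ℝ) + 1) hs ⟨K, by simpa using han⟩
    rw [LSeries, hsum.tsum_eq_zero_add, LSeries.term_zero, zero_add, dirichletSeries]
    refine tsum_congr fun n ↦ ?_
    rw [LSeries.term_of_ne_zero (Nat.succ_ne_zero n)]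
    push_cast; rfl
  have hLb : ∀ s : ℂ, (D : ℝ) + 1 < s.re → LSeries b s =
      ∏' p : Nat.Primes, (1 - A p * ((p : ℕ) : ℂ) ^ (-s) + B p * (((p : ℕ) : ℂ) ^ (-s)) ^ 2)⁻¹ :=
    fun s hs ↦ by
    have hsum : LSeriesSummable b s :=
      LSeriesSummable_of_le_const_mul_rpow (x := (D : ℝ) + 1) hs ⟨1, by simpa using hbn⟩
    have hfun : LSeries.term b s = fun n ↦ b n * (n : ℂ) ^ (-s) :=
      funext (LSeries.term_def₀ hb0 s)
    rw [LSeriesSummable, hfun] at hsum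
    have hprod := EulerProduct.eulerProduct_hasProd (f := fun n ↦ b n * (n : ℂ) ^ (-s))
      (by simp [hb, multExt_one])
      (fun {m n} hmn ↦ by
        rw [hb, multExt_mul hmn, Nat.cast_mul, natCast_mul_natCast_cpow]; ring)
      hsum.norm (by simp [hb0])
    rw [LSeries, hfun, ← hprod.tprod_eq]
    refine tprod_congr fun p ↦ ?_
    have hpe : ∀ e : ℕ, b ((p : ℕ) ^ e) * (((p : ℕ) ^ e : ℕ) : ℂ) ^ (-s) =
        quadCoeff (A p) (B p) e * (((p : ℕ) : ℂ) ^ (-s)) ^ e := fun e ↦ by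
      rw [hb, multExt_prime_pow hu0 p.2, natCast_pow_cpow]
    refine (tsum_congr hpe).trans (tsum_quadCoeff ?_)
    have := hsum.comp_injective (Nat.pow_right_injective p.2.two_le)
    refine this.congr fun e ↦ ?_
    rw [← hpe]; rfl
  have hab : ∀ {n : ℕ}, n ≠ 0 → a n = b n := fun {n} hn ↦ by
    refine LSeries.eq_of_LSeries_eventually_eq habsa habsb ?_ hn
    filter_upwards [eventually_gt_atTop x₀, eventually_gt_atTop ((E : ℝ) + 1),
      eventually_gt_atTop ((D : ℝ) + 1)] with x h1 h2 h3
    rw [hdir x (by simpa using h2), hLb x (by simpa using h3), hEuler x (by simpa using h1)]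
  have hp0 := hp.ne_zero
  rw [hab hn, hab (mul_ne_zero hp0 hn), hab (mul_ne_zero hp0 (mul_ne_zero hp0 hn))]
  obtain ⟨e, m, hm, rfl⟩ := Nat.exists_eq_pow_mul_and_not_dvd hn p hp.ne_one
  have hcop : ∀ j : ℕ, b (p ^ j * m) = u p j * b m := fun j ↦ by
    rw [hb, multExt_mul (((hp.coprime_iff_not_dvd).mpr hm).pow_left j), multExt_prime_pow hu0 hp]
  constructor
  · intro hdvd
    obtain rfl : e = 0 := by
      by_contra he
      exact hdvd (Dvd.dvd.mul_right (dvd_pow_self p he) m)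
    have := hcop 1
    rw [pow_one] at this
    rw [pow_zero, one_mul, this]
    simp [hu, quadCoeff]
  · have e1 : p * (p ^ e * m) = p ^ (e + 1) * m := by ring
    have e2 : p * (p * (p ^ e * m)) = p ^ (e + 2) * m := by ring
    rw [e2, e1, hcop, hcop, hcop]
    simp only [hu, quadCoeff]; ring

end EulerFactor

section Hecke

variable {a : ℕ → ℂ} {K C : ℝ}

lemma hasSum_fourierSeries (ha : ∀ n, ‖a (n + 1)‖ ≤ K * ((n : ℝ) + 1) ^ C) (z : ℍ) :
    HasSum (fun n : ℕ ↦ (if n = 0 then 0 else a n) *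
      Complex.exp (2 * (Real.pi : ℂ) * Complex.I * n * z)) (fourierSeries a z) := by
  have hs : Summable fun n : ℕ ↦ a (n + 1) *
      Complex.exp (2 * (Real.pi : ℂ) * Complex.I * ((n : ℂ) + 1) * (z : ℂ)) := by
    refine Summable.of_norm ?_
    refine (summable_expSeries_norm ha (t := 2 * Real.pi * z.im)
      (by have := z.im_pos; positivity)).congr fun n ↦ ?_
    rw [norm_mul, Complex.norm_exp]
    congr 2
    have : 2 * (Real.pi : ℂ) * Complex.I * ((n : ℂ) + 1) * z =
      ((2 * Real.pi * ((n : ℝ) + 1) : ℝ) : ℂ) * (Complex.I * z) := by push_cast; ring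
    rw [this, re_ofReal_mul]; simp; ring
  rw [← hasSum_nat_add_iff' 1]
  simpa [fourierSeries] using hs.hasSum

lemma sum_exp_div (p : ℕ) (hp : p ≠ 0) (n : ℕ) :
    ∑ b ∈ Finset.range p, Complex.exp (2 * (Real.pi : ℂ) * Complex.I * n * (b / p)) =
      if p ∣ n then (p : ℂ) else 0 := by
  have hζ := Complex.isPrimitiveRoot_exp p hp
  set ζ := Complex.exp (2 * Real.pi * Complex.I / p) with hζdef
  have h1 : ∀ b : ℕ, Complex.exp (2 * (Real.pi : ℂ) * Complex.I * n * (b / p)) = (ζ ^ n) ^ b :=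
    fun b ↦ by
      rw [hζdef, ← Complex.exp_nat_mul, ← Complex.exp_nat_mul]; congr 1; ring
  simp only [h1]
  split_ifs with h
  · rw [(hζ.pow_eq_one_iff_dvd n).mpr h]; simp
  · have h2 : ζ ^ n ≠ 1 := fun h' ↦ h ((hζ.pow_eq_one_iff_dvd n).mp h')
    rw [geom_sum_eq h2, ← pow_mul, mul_comm n, pow_mul, hζ.pow_eq_one]; simp

/-- The action of the Hecke operator on `f` in terms of the coefficient recursion. -/
lemma hecke_of_recursion (ha : ∀ n, ‖a (n + 1)‖ ≤ K * ((n : ℝ) + 1) ^ C) {p : ℕ} (hp : p ≠ 0)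
    {A B : ℂ} (hrec : ∀ n, n ≠ 0 → (¬ p ∣ n → a (p * n) = A * a n) ∧
      a (p * (p * n)) = A * a (p * n) - B * a n) {h : ℕ} :
    (∑ b ∈ Finset.range p, sl (2 * h : ℕ) ⟨1, b, 0, p⟩ (fourierSeries a)) +
      (B * (p : ℂ) ^ (1 - 2 * h : ℤ)) • sl (2 * h : ℕ) ⟨p, 0, 0, 1⟩ (fourierSeries a) =
      (A * (p : ℂ) ^ (1 - h : ℤ)) • fourierSeries a := by
  ext z
  have hp0 : (p : ℂ) ≠ 0 := by exact_mod_cast hp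
  have hpz : (0 : ℤ) < p := by exact_mod_cast Nat.pos_of_ne_zero hp
  set c : ℕ → ℂ := fun n ↦ if n = 0 then 0 else a n with hc
  have hinj : Function.Injective fun m : ℕ ↦ p * m := fun m n hmn ↦
    Nat.eq_of_mul_eq_mul_left (Nat.pos_of_ne_zero hp) hmn
  have hcrec : ∀ n, c (p * n) + B * (if p ∣ n then c (n / p) else 0) = A * c n := fun n ↦ by
    rcases eq_or_ne n 0 with rfl | hn
    · simp [hc]
    simp only [hc, mul_eq_zero, hp, hn, false_or, if_false]
    split_ifs with h1 h2
    · obtain ⟨m, rfl⟩ := h1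
      rw [Nat.mul_div_cancel_left _ (Nat.pos_of_ne_zero hp)] at h2
      simp [h2] at hn
    · obtain ⟨m, rfl⟩ := h1
      rw [Nat.mul_div_cancel_left _ (Nat.pos_of_ne_zero hp)] at h2 ⊢
      rw [(hrec m h2).2]; ring
    · rw [(hrec n hn).1 h1]; ring
  have hd1 : ∀ b : ℕ, 0 < (⟨1, b, 0, p⟩ : IntMat).det := fun b ↦ by
    simpa [IntMat.det] using hpz
  have hd2 : 0 < (⟨p, 0, 0, 1⟩ : IntMat).det := by simpa [IntMat.det] using hpz
  have hS1 : HasSum (fun m : ℕ ↦ (p : ℂ) * c (p * m) *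
      Complex.exp (2 * (Real.pi : ℂ) * Complex.I * m * z))
      (∑ b ∈ Finset.range p, fourierSeries a (glAct (⟨1, b, 0, p⟩ : IntMat).toReal z)) := by
    have h1 := hasSum_sum (s := Finset.range p) fun b _ ↦
      hasSum_fourierSeries ha (glAct (⟨1, b, 0, p⟩ : IntMat).toReal z)
    have h2 : ∀ n : ℕ, (∑ b ∈ Finset.range p, (if n = 0 then 0 else a n) *
        Complex.exp (2 * (Real.pi : ℂ) * Complex.I * n *
          (glAct (⟨1, b, 0, p⟩ : IntMat).toReal z : ℍ))) =
        c n * Complex.exp (2 * (Real.pi : ℂ) * Complex.I * n * (z / p)) *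
          if p ∣ n then (p : ℂ) else 0 := fun n ↦ by
      rw [← sum_exp_div p hp, Finset.mul_sum]
      refine Finset.sum_congr rfl fun b _ ↦ ?_
      rw [mul_assoc (c n), ← Complex.exp_add, IntMat.coe_glAct (hd1 b)]
      congr 2
      simp only [Int.cast_zero, Int.cast_one, Int.cast_natCast, zero_mul, zero_add, one_mul]
      ring
    simp only [h2] at h1
    rw [← hinj.hasSum_iff] at h1
    · refine h1.congr_fun ?_
      intro m
      simp only [Function.comp_apply, dvd_mul_right, if_true]
      have : 2 * (Real.pi : ℂ) * Complex.I * ((p * m : ℕ) : ℂ) * (z / p) =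
          2 * (Real.pi : ℂ) * Complex.I * m * z := by push_cast; field_simp
      rw [this]; ring
    · intro n hn
      rw [if_neg, mul_zero]
      rintro ⟨m, rfl⟩
      exact hn ⟨m, rfl⟩
  have hS2 : HasSum (fun n : ℕ ↦ (if p ∣ n then c (n / p) else 0) *
      Complex.exp (2 * (Real.pi : ℂ) * Complex.I * n * z))
      (fourierSeries a (glAct (⟨p, 0, 0, 1⟩ : IntMat).toReal z)) := by
    rw [← hinj.hasSum_iff]
    · refine (hasSum_fourierSeries ha (glAct (⟨p, 0, 0, 1⟩ : IntMat).toReal z)).congr_fun ?_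
      intro m
      simp only [Function.comp_apply, dvd_mul_right, if_true]
      rw [Nat.mul_div_cancel_left _ (Nat.pos_of_ne_zero hp), IntMat.coe_glAct hd2]
      congr 2
      push_cast; ring
    · intro n hn
      rw [if_neg, zero_mul]
      rintro ⟨m, rfl⟩
      exact hn ⟨m, rfl⟩
  have hS := (hS1.add (hS2.mul_left (p * B))).unique (((hasSum_fourierSeries ha z).mul_left
    (p * A)).congr_fun fun n ↦ by
      have := hcrec n
      simp only [hc] at this ⊢
      linear_combination ((p : ℂ) * Complex.exp (2 * (Real.pi : ℂ) * Complex.I * n * z)) * this)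
  have hk2 : (((2 * h : ℕ) : ℤ)) / 2 = h := by omega
  have e1 : ∀ b : ℕ, sl (2 * h : ℕ) ⟨1, b, 0, p⟩ (fourierSeries a) z =
      (p : ℂ) ^ (-h : ℤ) * fourierSeries a (glAct (⟨1, b, 0, p⟩ : IntMat).toReal z) := fun b ↦ by
    rw [sl_apply, hk2]
    have : ((⟨1, b, 0, p⟩ : IntMat).det : ℂ) = p := by simp [IntMat.det]
    rw [this]
    simp only [Int.cast_zero, zero_mul, zero_add, Int.cast_natCast]
    rw [← zpow_add₀ hp0]
    congr 2; push_cast; ring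
  have e2 : sl (2 * h : ℕ) ⟨p, 0, 0, 1⟩ (fourierSeries a) z =
      (p : ℂ) ^ (h : ℤ) * fourierSeries a (glAct (⟨p, 0, 0, 1⟩ : IntMat).toReal z) := by
    rw [sl_apply, hk2]
    have : ((⟨p, 0, 0, 1⟩ : IntMat).det : ℂ) = p := by simp [IntMat.det]
    rw [this]
    simp
  simp only [Pi.add_apply, Finset.sum_apply, Pi.smul_apply, smul_eq_mul, e1, e2]
  rw [← Finset.mul_sum]
  have e3 : (p : ℂ) ^ (1 - h : ℤ) = p * (p : ℂ) ^ (-h : ℤ) := by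
    rw [sub_eq_add_neg, zpow_add₀ hp0, zpow_one]
  have e4 : (p : ℂ) ^ (1 - 2 * h : ℤ) * (p : ℂ) ^ (h : ℤ) = p * (p : ℂ) ^ (-h : ℤ) := by
    rw [← e3, ← zpow_add₀ hp0]; congr 1; ring
  rw [e3]
  linear_combination (p : ℂ) ^ (-h : ℤ) * hS +
    B * fourierSeries a (glAct (⟨p, 0, 0, 1⟩ : IntMat).toReal z) * e4

lemma sl_translation (a : ℕ → ℂ) (k : ℤ) :
    sl k ⟨1, 1, 0, 1⟩ (fourierSeries a) = fourierSeries a := by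
  ext z
  have hd : 0 < (⟨1, 1, 0, 1⟩ : IntMat).det := by decide
  rw [sl_apply]
  have hdet : (⟨1, 1, 0, 1⟩ : IntMat).det = 1 := by decide
  simp only [hdet]
  simp only [Int.cast_one, Int.cast_zero, zero_mul, zero_add, _root_.one_zpow, one_mul, mul_one]
  rw [fourierSeries, fourierSeries]
  refine tsum_congr fun n ↦ ?_
  rw [IntMat.coe_glAct hd]
  congr 1
  have : 2 * (Real.pi : ℂ) * Complex.I * ((n : ℂ) + 1) *
      (((1 : ℤ) * (z : ℂ) + (1 : ℤ)) / ((0 : ℤ) * z + (1 : ℤ))) =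
      2 * (Real.pi : ℂ) * Complex.I * ((n : ℂ) + 1) * z +
        ((n + 1 : ℕ) : ℂ) * (2 * Real.pi * Complex.I) := by push_cast; ring
  rw [this, Complex.exp_add, Complex.exp_nat_mul_two_pi_mul_I, mul_one]

/-- The linear coefficient of the Euler factor at `p` of level `N` and weight `2 h`. -/
noncomputable def eulerLin (a : ℕ → ℂ) (N h p : ℕ) : ℂ :=
  if p ∣ N then (if p ^ 2 ∣ N then 0 else (p : ℂ) ^ (h - 1)) else a p

/-- The quadratic coefficient of the Euler factor at `p` of level `N` and weight `2 h`. -/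
noncomputable def eulerQuad (N h p : ℕ) : ℂ := if p ∣ N then 0 else (p : ℂ) ^ (2 * h - 1)

lemma localFactor_eq {N h p : ℕ} (hh : 0 < h) (hp : p ≠ 0) (s : ℂ) :
    localFactor a N ((2 * h : ℕ) : ℤ) p s =
      (1 - eulerLin a N h p * (p : ℂ) ^ (-s) + eulerQuad N h p * ((p : ℂ) ^ (-s)) ^ 2)⁻¹ := by
  have hp0 : (p : ℂ) ≠ 0 := by exact_mod_cast hp
  unfold localFactor eulerLin eulerQuad
  split_ifs with h1 h2
  · simp
  · have : (p : ℂ) ^ ((((2 * h : ℕ) : ℤ) : ℂ) / 2 - 1 - s) = (p : ℂ) ^ (h - 1) * (p : ℂ) ^ (-s) := by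
      rw [← cpow_natCast, ← Complex.cpow_add _ _ hp0, Nat.cast_sub hh]
      congr 1; push_cast; ring
    rw [this]; simp
  · have : (p : ℂ) ^ ((((2 * h : ℕ) : ℤ) : ℂ) - 1 - 2 * s) =
        (p : ℂ) ^ (2 * h - 1) * ((p : ℂ) ^ (-s)) ^ 2 := by
      rw [← cpow_natCast, ← Complex.cpow_nat_mul, ← Complex.cpow_add _ _ hp0,
        Nat.cast_sub (by omega)]
      congr 1; push_cast; ring
    rw [this]

/-- The Hecke relations for `f` that follow from the Euler product. -/
lemma hecke_of_eulerProduct {N h : ℕ} (hh : 0 < h)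
    (ha : ∀ n, ‖a (n + 1)‖ ≤ K * ((n : ℝ) + 1) ^ C) {x₀ : ℝ}
    (hEuler : ∀ s : ℂ, x₀ < s.re →
      dirichletSeries a s = ∏' p : Nat.Primes, localFactor a N ((2 * h : ℕ) : ℤ) (p : ℕ) s)
    {p : ℕ} (hp : p.Prime) :
    (∑ b ∈ Finset.range p, sl (2 * h : ℕ) ⟨1, b, 0, p⟩ (fourierSeries a)) +
      (eulerQuad N h p * (p : ℂ) ^ (1 - 2 * h : ℤ)) •
        sl (2 * h : ℕ) ⟨p, 0, 0, 1⟩ (fourierSeries a) =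
      (eulerLin a N h p * (p : ℂ) ^ (1 - h : ℤ)) • fourierSeries a := by
  refine hecke_of_recursion ha hp.ne_zero fun n hn ↦ ?_
  obtain ⟨m, hm⟩ := pow_unbounded_of_one_lt (2 * K) (one_lt_two)
  set E := ⌈C⌉₊ with hE
  have ha' := norm_le_pow ha
  refine coeff_recursion_of_eulerProduct (A := eulerLin a N h) (B := eulerQuad N h)
    (D := E + m + h) ha' ?_ ?_ (x₀ := x₀) (fun s hs ↦ ?_) hp hn
  · intro p hp
    have h2 : (2 : ℝ) ≤ p := by exact_mod_cast hp.two_le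
    have h1 : (1 : ℝ) ≤ p := by linarith
    rw [le_div_iff₀ two_pos]
    unfold eulerLin
    split_ifs
    · simp
    · rw [norm_pow, Complex.norm_natCast]
      calc (p : ℝ) ^ (h - 1) * 2 ≤ (p : ℝ) ^ (h - 1) * p := by gcongr
        _ = (p : ℝ) ^ h := by rw [← pow_succ]; congr 1; omega
        _ ≤ _ := pow_le_pow_right₀ h1 (by omega)
    · have h3 := ha' (p - 1)
      have h4 : (((p - 1 : ℕ) : ℝ) + 1) = p := by
        rw [Nat.cast_sub hp.one_le]; simp
      rw [Nat.sub_add_cancel hp.one_le, h4, ← hE] at h3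
      calc ‖a p‖ * 2 ≤ (K * (p : ℝ) ^ E) * 2 := by gcongr
        _ = (2 * K) * (p : ℝ) ^ E := by ring
        _ ≤ 2 ^ m * (p : ℝ) ^ E := by gcongr
        _ ≤ (p : ℝ) ^ m * (p : ℝ) ^ E := by gcongr
        _ = (p : ℝ) ^ (E + m) := by rw [pow_add]; ring
        _ ≤ _ := pow_le_pow_right₀ h1 (by omega)
  · intro p hp
    have h2 : (2 : ℝ) ≤ p := by exact_mod_cast hp.two_le
    have h1 : (1 : ℝ) ≤ p := by linarith
    rw [le_div_iff₀ two_pos, ← pow_mul]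
    unfold eulerQuad
    split_ifs
    · simp
    · rw [norm_pow, Complex.norm_natCast]
      calc (p : ℝ) ^ (2 * h - 1) * 2 ≤ (p : ℝ) ^ (2 * h - 1) * p := by gcongr
        _ = (p : ℝ) ^ (2 * h) := by rw [← pow_succ]; congr 1; omega
        _ ≤ _ := pow_le_pow_right₀ h1 (by nlinarith)
  · rw [hEuler s hs]
    exact tprod_congr fun p ↦ localFactor_eq hh p.2.ne_zero s

end Hecke

/-- The sign `(-1)^i e^j`. -/
def sgn (e : ℂ) (s : Bool × Bool) : ℂ := (bif s.1 then -1 else 1) * (bif s.2 then e else 1)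

/-- The product of two signs. -/
def sgnMul (s t : Bool × Bool) : Bool × Bool := (s.1 ^^ t.1, s.2 ^^ t.2)

lemma sgn_mul {e : ℂ} (he : e ^ 2 = 1) (s t : Bool × Bool) :
    sgn e (sgnMul s t) = sgn e s * sgn e t := by
  have h : e * e = 1 := by rw [← sq, he]
  rcases s with ⟨_ | _, _ | _⟩ <;> rcases t with ⟨_ | _, _ | _⟩ <;> simp [sgn, sgnMul, h]

lemma sgn_sq {e : ℂ} (he : e ^ 2 = 1) (s : Bool × Bool) : sgn e s ^ 2 = 1 := by
  rcases s with ⟨_ | _, _ | _⟩ <;> simp [sgn, he]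

lemma sgn_mul_self {e : ℂ} (he : e ^ 2 = 1) (s : Bool × Bool) : sgn e s * sgn e s = 1 := by
  rw [← sq, sgn_sq he]

lemma sgn_one (e : ℂ) : sgn e (false, false) = 1 := by simp [sgn]

lemma sgn_neg_one (e : ℂ) : sgn e (true, false) = -1 := by simp [sgn]

/-- A matrix together with the sign of its action on a fixed function. -/
structure SignedMat where
  m : IntMat
  s : Bool × Bool

/-- `g.m` acts on `f` through the sign `g.s`. -/
def Fixes (k : ℤ) (e : ℂ) (f : ℍ → ℂ) (g : SignedMat) : Prop :=
  0 < g.m.det ∧ sl k g.m f = sgn e g.s • f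

/-- The product of a word in the matrices `G` and their adjugates: the letter `n > 0` is the
entry of index `n - 1`, and `-n` is its adjugate. -/
def wordProd (G : List SignedMat) : List ℤ → SignedMat
  | [] => ⟨⟨1, 0, 0, 1⟩, (false, false)⟩
  | n :: w =>
    match G[n.natAbs - 1]? with
    | none => ⟨⟨1, 0, 0, 1⟩, (false, false)⟩
    | some g => ⟨(if 0 < n then g.m else g.m.adj) * (wordProd G w).m, sgnMul g.s (wordProd G w).s⟩

/-- Proportionality of matrices. -/
def proportional (m n : IntMat) : Bool :=
  let r := if m.a = 0 then (m.b, n.b) else (m.a, n.a)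
  r.1 ≠ 0 && r.2 ≠ 0 && decide (IntMat.scale r.1 n = IntMat.scale r.2 m)

/-- The word `w` in `G` has sign `s` and carries `B` to `A` up to a scalar. -/
def wordLinks (G : List SignedMat) (w : List ℤ) (s : Bool × Bool) (A B : IntMat) : Bool :=
  decide (0 < A.det) && decide (0 < B.det) && decide ((wordProd G w).s = s) &&
    proportional A ((wordProd G w).m * B)

section Words

variable {k : ℤ} {e : ℂ} {f : ℍ → ℂ} {G : List SignedMat}

lemma Fixes.adj (hk : Even k) (he : e ^ 2 = 1) {m : IntMat} {s : Bool × Bool}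
    (h : Fixes k e f ⟨m, s⟩) : sl k m.adj f = sgn e s • f := by
  have h1 := sl_adj_sl hk h.1 f
  rw [h.2, sl_smul] at h1
  nth_rewrite 2 [← h1]
  rw [smul_smul, sgn_mul_self he, one_smul]

lemma fixes_wordProd (hk : Even k) (he : e ^ 2 = 1) (hG : ∀ g ∈ G, Fixes k e f g) (w : List ℤ) :
    Fixes k e f (wordProd G w) := by
  have h1 : Fixes k e f ⟨⟨1, 0, 0, 1⟩, (false, false)⟩ :=
    ⟨by decide, by simp only [sgn_one, sl_one, one_smul]⟩
  induction w with
  | nil => exact h1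
  | cons n w ih =>
    rw [wordProd]
    split
    · exact h1
    · rename_i g hg
      have hgm := hG g (List.mem_of_getElem? hg)
      have hd : 0 < (if 0 < n then g.m else g.m.adj).det := by
        split
        · exact hgm.1
        · rw [IntMat.det_adj]; exact hgm.1
      refine ⟨by rw [IntMat.det_mul]; exact mul_pos hd ih.1, ?_⟩
      rw [sl_mul hd ih.1]
      have : sl k (if 0 < n then g.m else g.m.adj) f = sgn e g.s • f := by
        split
        · exact hgm.2
        · exact Fixes.adj hk he hgm
      rw [this, sl_smul, ih.2, sgn_mul he, smul_smul]

lemma sl_eq_of_proportional (hk : Even k) {m n : IntMat} (hm : 0 < m.det) (hn : 0 < n.det)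
    (h : proportional m n = true) : sl k m f = sl k n f := by
  simp only [proportional, ne_eq, Bool.and_eq_true, decide_eq_true_eq, decide_not,
    Bool.not_eq_eq_eq_not, Bool.not_true, decide_eq_false_iff_not] at h
  obtain ⟨⟨h1, h2⟩, h3⟩ := h
  rw [← sl_scale hk h2 hm, ← h3, sl_scale hk h1 hn]

lemma sl_of_wordLinks (hk : Even k) (he : e ^ 2 = 1) (hG : ∀ g ∈ G, Fixes k e f g) (w : List ℤ)
    {s : Bool × Bool} {A B : IntMat} (h : wordLinks G w s A B = true) :
    sl k A f = sgn e s • sl k B f := by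
  simp only [wordLinks, Bool.and_eq_true, decide_eq_true_eq] at h
  obtain ⟨⟨⟨hA, hB⟩, hs⟩, hp⟩ := h
  have hw := fixes_wordProd hk he hG w
  rw [sl_eq_of_proportional hk hA (by rw [IntMat.det_mul]; exact mul_pos hw.1 hB) hp,
    sl_mul hw.1 hB, hw.2, sl_smul, hs]

/-- The defect of invariance of `f` under `R`. -/
noncomputable def defect (k : ℤ) (f : ℍ → ℂ) (R : IntMat) : ℍ → ℂ := sl k R f - f

lemma fixes_of_defect {R : IntMat} (hR : 0 < R.det) (h : defect k f R = 0) :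
    Fixes k e f ⟨R, (false, false)⟩ :=
  ⟨hR, by rw [sgn_one, one_smul]; exact sub_eq_zero.mp h⟩

lemma row_zero (hk : Even k) (he : e ^ 2 = 1) (hG : ∀ g ∈ G, Fixes k e f g) (w : List ℤ)
    {s : Bool × Bool} {A B : IntMat} (h : wordLinks G w s A B = true) :
    sl k A f - sgn e s • sl k B f = 0 := by
  rw [sl_of_wordLinks hk he hG w h, sub_self]

lemma row_defect (hk : Even k) (he : e ^ 2 = 1) (hG : ∀ g ∈ G, Fixes k e f g) (v w : List ℤ)
    {s t : Bool × Bool} {A B : IntMat} (R Z : IntMat) (hR : 0 < R.det)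
    (h : (wordLinks G v t A (R * Z) && wordLinks G w (sgnMul s t) B Z) = true) :
    sl k A f - sgn e s • sl k B f = sgn e t • sl k Z (defect k f R) := by
  rw [Bool.and_eq_true] at h
  have hZ : 0 < Z.det := by
    have := h.2
    simp only [wordLinks, Bool.and_eq_true, decide_eq_true_eq] at this
    exact this.1.1.2
  rw [sl_of_wordLinks hk he hG v h.1, sl_of_wordLinks hk he hG w h.2, defect, sl_sub,
    sl_mul hR hZ, smul_smul, sgn_mul he, ← mul_assoc, sgn_mul_self he, one_mul, smul_sub]

lemma row_neg_defect (hk : Even k) (he : e ^ 2 = 1) (hG : ∀ g ∈ G, Fixes k e f g) (v w : List ℤ)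
    {s t : Bool × Bool} {A B : IntMat} (R Z : IntMat) (hR : 0 < R.det)
    (h : (wordLinks G v (sgnMul (true, false) t) A Z &&
      wordLinks G w (sgnMul s (sgnMul (true, false) t)) B (R * Z)) = true) :
    sl k A f - sgn e s • sl k B f = sgn e t • sl k Z (defect k f R) := by
  rw [Bool.and_eq_true] at h
  have hZ : 0 < Z.det := by
    have := h.1
    simp only [wordLinks, Bool.and_eq_true, decide_eq_true_eq] at this
    exact this.1.1.2
  rw [sl_of_wordLinks hk he hG v h.1, sl_of_wordLinks hk he hG w h.2, defect, sl_sub,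
    sl_mul hR hZ, smul_smul, sgn_mul he s, ← mul_assoc, sgn_mul_self he, one_mul, sgn_mul he,
    sgn_neg_one, smul_sub, neg_one_mul, _root_.neg_smul, _root_.neg_smul]
  abel

/-- The relation between values of `f` obtained by translating a Hecke eigenvector equation. -/
lemma sum_sub_eq_zero_of_hecke {L : List IntMat} {u : ℂ}
    (hL : (L.map fun A => sl k A f).sum = u • f) (hpos : ∀ A ∈ L, 0 < A.det) {t : IntMat}
    {s : Bool × Bool} (ht : Fixes k e f ⟨t, s⟩) {P : List (IntMat × IntMat)}
    (h1 : P.map Prod.fst = L) (h2 : (P.map Prod.snd).Perm L) :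
    (P.map fun q => sl k (q.1 * t) f - sgn e s • sl k q.2 f).sum = 0 := by
  have hsum : ∀ P : List (IntMat × IntMat), (∀ q ∈ P, 0 < q.1.det) →
      (P.map fun q => sl k (q.1 * t) f - sgn e s • sl k q.2 f).sum =
      sl k t ((P.map Prod.fst).map fun A => sl k A f).sum -
        sgn e s • ((P.map Prod.snd).map fun A => sl k A f).sum := by
    intro P hP
    induction P with
    | nil => simp [sl_zero]
    | cons q P ih =>
      simp only [List.map_cons, List.sum_cons]
      rw [ih fun q hq => hP q (List.mem_cons_of_mem _ hq), sl_add,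
        sl_mul (hP q List.mem_cons_self) ht.1, smul_add]
      abel
  rw [hsum P fun q hq => hpos _ (h1 ▸ List.mem_map_of_mem hq), h1,
    (h2.map fun A => sl k A f).sum_eq, hL, sl_smul, ht.2, smul_comm, sub_self]

/-- `E` carries `g` to `h` up to the sign `s`. -/
def Carries (k : ℤ) (e : ℂ) (E : IntMat) (s : Bool × Bool) (g h : ℍ → ℂ) : Prop :=
  0 < E.det ∧ sl k E g = sgn e s • h

lemma Carries.trans (he : e ^ 2 = 1) {E F : IntMat} {s t : Bool × Bool} {g h j : ℍ → ℂ}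
    (h1 : Carries k e E s g h) (h2 : Carries k e F t h j) :
    Carries k e (E * F) (sgnMul s t) g j := by
  refine ⟨by rw [IntMat.det_mul]; exact mul_pos h1.1 h2.1, ?_⟩
  rw [sl_mul h1.1 h2.1, h1.2, sl_smul, h2.2, smul_smul, sgn_mul he]

lemma Carries.symm (hk : Even k) (he : e ^ 2 = 1) {E : IntMat} {s : Bool × Bool} {g h : ℍ → ℂ}
    (h1 : Carries k e E s g h) : Carries k e E.adj s h g := by
  refine ⟨by rw [IntMat.det_adj]; exact h1.1, ?_⟩
  have h2 := sl_adj_sl hk h1.1 g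
  rw [h1.2, sl_smul] at h2
  rw [← h2, smul_smul, sgn_mul_self he, one_smul]

lemma carries_of_sum_eq_zero (hk : Even k) (he : e ^ 2 = 1) {Y Z : IntMat} (hY : 0 < Y.det)
    (hZ : 0 < Z.det) {s t : Bool × Bool} {g h : ℍ → ℂ}
    (h0 : sgn e s • sl k Y g + sgn e t • sl k Z h = 0) :
    Carries k e (Y * Z.adj) (sgnMul (true, false) (sgnMul s t)) g h := by
  have hZ' : 0 < Z.adj.det := by rw [IntMat.det_adj]; exact hZ
  refine ⟨by rw [IntMat.det_mul]; exact mul_pos hY hZ', ?_⟩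
  rw [sl_mul hY hZ', sgn_mul he, sgn_mul he, sgn_neg_one]
  have h1 : sl k Y g = (-1 * (sgn e s * sgn e t)) • sl k Z h := by
    have h2 := congrArg (fun x => sgn e s • x) h0
    simp only [smul_add, smul_smul, sgn_mul_self he, one_smul, smul_zero] at h2
    rw [eq_neg_of_add_eq_zero_left h2, neg_one_mul, _root_.neg_smul]
  rw [h1, sl_smul, sl_adj_sl hk hZ]

lemma eq_zero_of_sgn_smul_sl (hk : Even k) (he : e ^ 2 = 1) {Z : IntMat} (hZ : 0 < Z.det)
    {s : Bool × Bool} {g : ℍ → ℂ} (h0 : sgn e s • sl k Z g = 0) : g = 0 := by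
  have h1 : sgn e s ≠ 0 := fun h => by simpa [h] using sgn_sq he s
  have h2 := (smul_eq_zero.mp h0).resolve_left h1
  rw [← sl_adj_sl hk hZ g, h2, sl_zero]

lemma defect_eq_zero_of_carries (hk : Even k) (hkpos : 0 < k) (he : e ^ 2 = 1) (hf : Hol f)
    {R E : IntMat} {s : Bool × Bool} (hR : 0 < R.det)
    (h : Carries k e E s (defect k f R) (defect k f R))
    (hE : E.tr ^ 2 < 4 * E.det ∧ ¬ E.det ∣ E.tr ^ 2) : defect k f R = 0 :=
  eq_zero_of_elliptic hk hkpos ((hf.sl hR k).sub hf) h.1 hE.1 hE.2 (sgn_sq he s) h.2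

/-- A table of representatives of right cosets, together with the coset and a word for the
product of each with `S`, `T` and `T⁻¹`, certifies invariance under `Γ₀(N)`. -/
def coversGamma0 (N : ℤ) (G : List SignedMat) (tbl : List (IntMat × List (ℕ × List ℤ))) : Bool :=
  tbl.all fun row => decide (row.1.det = 1) && (decide (¬ N ∣ row.1.c) || row.1 = ⟨1, 0, 0, 1⟩) &&
    ([(⟨0, -1, 1, 0⟩, 0), (⟨0, 1, -1, 0⟩, 0), (⟨1, 1, 0, 1⟩, 1), (⟨1, -1, 0, 1⟩, 2)] :
      List (IntMat × ℕ)).all fun g =>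
        match row.2[g.2]? with
        | none => false
        | some jw =>
          match tbl[jw.1]? with
          | none => false
          | some row' => wordLinks G jw.2 (false, false) (row.1 * g.1) row'.1 &&
              decide (N ∣ (row.1 * g.1 * row'.1.adj).c)

/-- The integral matrix of an element of `SL(2, ℤ)`. -/
def ofSL (γ : SpecialLinearGroup (Fin 2) ℤ) : IntMat := ⟨γ 0 0, γ 0 1, γ 1 0, γ 1 1⟩

lemma det_ofSL (γ : SpecialLinearGroup (Fin 2) ℤ) : (ofSL γ).det = 1 := by
  have := γ.det_coe
  rw [Matrix.det_fin_two] at this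
  exact this

lemma ofSL_mul (γ δ : SpecialLinearGroup (Fin 2) ℤ) : ofSL (γ * δ) = ofSL γ * ofSL δ := by
  simp [ofSL, IntMat.mul_def, Matrix.mul_apply, Fin.sum_univ_two]

lemma ofSL_inv (γ : SpecialLinearGroup (Fin 2) ℤ) : ofSL γ⁻¹ = (ofSL γ).adj := by
  have h : (γ⁻¹).1 = _ := (Matrix.SpecialLinearGroup.coe_inv γ).trans (Matrix.adjugate_fin_two _)
  change (⟨(γ⁻¹).1 0 0, (γ⁻¹).1 0 1, (γ⁻¹).1 1 0, (γ⁻¹).1 1 1⟩ : IntMat) = _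
  rw [h]; simp [ofSL, IntMat.adj]

lemma toReal_ofSL (γ : SpecialLinearGroup (Fin 2) ℤ) : (ofSL γ).toReal = sl2ToReal γ := by
  ext i j
  fin_cases i <;> fin_cases j <;> simp [ofSL, IntMat.toReal, sl2ToReal]

theorem invariant_of_coversGamma0 (hk : Even k) (he : e ^ 2 = 1)
    (hG : ∀ g ∈ G, Fixes k e f g) {N : ℕ} {tbl : List (IntMat × List (ℕ × List ℤ))}
    (hone : ∃ x ∈ tbl, x.1 = ⟨1, 0, 0, 1⟩) (h : coversGamma0 N G tbl = true) :
    ∀ γ ∈ CongruenceSubgroup.Gamma0 N, slash k (sl2ToReal γ) f = f := by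
  simp only [coversGamma0, List.all_eq_true, Bool.and_eq_true, decide_eq_true_eq,
    Bool.or_eq_true] at h
  have hstep : ∀ x ∈ tbl, ∀ g : IntMat, g ∈ ([⟨0, -1, 1, 0⟩, ⟨0, 1, -1, 0⟩, ⟨1, 1, 0, 1⟩,
      ⟨1, -1, 0, 1⟩] : List IntMat) → ∃ y ∈ tbl, sl k (x.1 * g) f = sl k y.1 f ∧
        (N : ℤ) ∣ (x.1 * g * y.1.adj).c := by
    intro x hx g hg
    obtain ⟨n, hn⟩ : ∃ n, (g, n) ∈ ([(⟨0, -1, 1, 0⟩, 0), (⟨0, 1, -1, 0⟩, 0), (⟨1, 1, 0, 1⟩, 1),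
        (⟨1, -1, 0, 1⟩, 2)] : List (IntMat × ℕ)) := by
      simp only [List.mem_cons, List.not_mem_nil, or_false] at hg
      rcases hg with rfl | rfl | rfl | rfl
      · exact ⟨0, by simp⟩
      · exact ⟨0, by simp⟩
      · exact ⟨1, by simp⟩
      · exact ⟨2, by simp⟩
    have h1 := (h x hx).2 (g, n) hn
    split at h1
    · simp at h1
    · split at h1
      · simp at h1
      · rename_i y hy
        simp only [Bool.and_eq_true, decide_eq_true_eq] at h1
        refine ⟨y, List.mem_of_getElem? hy, ?_, h1.2⟩
        rw [sl_of_wordLinks hk he hG _ h1.1, sgn_one, one_smul]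
  have hall : ∀ γ : SpecialLinearGroup (Fin 2) ℤ, ∃ x ∈ tbl, sl k (ofSL γ) f = sl k x.1 f ∧
      (N : ℤ) ∣ (ofSL γ * x.1.adj).c := by
    have key : ∀ (γ δ : SpecialLinearGroup (Fin 2) ℤ), ofSL δ ∈ ([⟨0, -1, 1, 0⟩, ⟨0, 1, -1, 0⟩,
        ⟨1, 1, 0, 1⟩, ⟨1, -1, 0, 1⟩] : List IntMat) →
        (∃ x ∈ tbl, sl k (ofSL γ) f = sl k x.1 f ∧ (N : ℤ) ∣ (ofSL γ * x.1.adj).c) →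
        ∃ x ∈ tbl, sl k (ofSL (γ * δ)) f = sl k x.1 f ∧
          (N : ℤ) ∣ (ofSL (γ * δ) * x.1.adj).c := by
      rintro γ δ hδ ⟨x, hx, hx1, hx2⟩
      obtain ⟨y, hy, hy1, hy2⟩ := hstep x hx _ hδ
      have hd : 0 < (ofSL δ).det := by rw [det_ofSL]; exact one_pos
      have hxd := (h x hx).1.1
      refine ⟨y, hy, ?_, ?_⟩
      · rw [ofSL_mul, sl_mul (by rw [det_ofSL]; exact one_pos) hd, hx1, ← hy1,
          sl_mul (by rw [hxd]; exact one_pos) hd]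
      · have : (ofSL (γ * δ) * y.1.adj).c =
            (ofSL γ * x.1.adj).c * (x.1 * ofSL δ * y.1.adj).a +
            (ofSL γ * x.1.adj).d * (x.1 * ofSL δ * y.1.adj).c := by
          rw [ofSL_mul]
          simp only [IntMat.mul_def, IntMat.adj]
          simp only [IntMat.det] at hxd
          linear_combination (-1 : ℤ) * (((ofSL γ).c * (ofSL δ).a + (ofSL γ).d * (ofSL δ).c) *
            y.1.d - ((ofSL γ).c * (ofSL δ).b + (ofSL γ).d * (ofSL δ).d) * y.1.c) * hxd
        rw [this]
        exact dvd_add (hx2.mul_right _) (hy2.mul_left _)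
    intro γ
    have hγ : γ ∈ Subgroup.closure ({ModularGroup.S, ModularGroup.T} :
        Set (SpecialLinearGroup (Fin 2) ℤ)) := by
      rw [SpecialLinearGroup.SL2Z_generators]; trivial
    induction hγ using Subgroup.closure_induction_right with
    | one =>
      obtain ⟨x, hx, hx1⟩ := hone
      refine ⟨x, hx, by rw [hx1]; simp [ofSL], by rw [hx1]; simp [ofSL, IntMat.mul_def, IntMat.adj]⟩
    | mul_right γ δ _ hδ ih =>
      apply key _ _ _ ih
      rcases hδ with rfl | rfl
      · simp [ofSL, ModularGroup.S]
      · simp [ofSL, ModularGroup.T]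
    | mul_inv_cancel γ δ _ hδ ih =>
      apply key _ _ _ ih
      rcases hδ with rfl | rfl
      · rw [ofSL_inv]; simp [ofSL, IntMat.adj, ModularGroup.S]
      · rw [ofSL_inv]; simp [ofSL, IntMat.adj, ModularGroup.T]
  intro γ hγ
  obtain ⟨x, hx, hx1, hx2⟩ := hall γ
  have hc : (N : ℤ) ∣ (ofSL γ).c := by
    rw [CongruenceSubgroup.Gamma0_mem, ZMod.intCast_zmod_eq_zero_iff_dvd] at hγ
    exact hγ
  have hxc : (N : ℤ) ∣ x.1.c := by
    have hd := det_ofSL γ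
    have : x.1.c = x.1.a * 0 + (ofSL γ).c * (x.1.c * (-(ofSL γ).b) + x.1.d * (ofSL γ).a) -
        (ofSL γ).a * (ofSL γ * x.1.adj).c := by
      simp only [IntMat.mul_def, IntMat.adj]
      simp only [IntMat.det] at hd
      linear_combination (-x.1.c) * hd
    rw [this]
    exact dvd_sub (dvd_add (by simp) (hc.mul_right _)) (hx2.mul_left _)
  have hx3 := (h x hx).1.2.resolve_left (not_not.mpr hxc)
  rw [← toReal_ofSL]
  change sl k (ofSL γ) f = f
  rw [hx1, hx3, sl_one]

end Words

section Words

variable {k : ℤ} {e : ℂ} {f : ℍ → ℂ} {G : List SignedMat}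

lemma fixes_of_wordLinks (hk : Even k) (he : e ^ 2 = 1) (hG : ∀ g ∈ G, Fixes k e f g)
    (w : List ℤ) {s : Bool × Bool} {A : IntMat} (h : wordLinks G w s A ⟨1, 0, 0, 1⟩ = true) :
    Fixes k e f ⟨A, s⟩ := by
  refine ⟨?_, by rw [sl_of_wordLinks hk he hG w h, sl_one]⟩
  simp only [wordLinks, Bool.and_eq_true, decide_eq_true_eq] at h
  exact h.1.1.1

end Words

/-- What the functional equation and the Euler factors at `2` and `3` say about `f`. -/
structure HeckeForm (N : ℕ) (k : ℤ) (e : ℂ) (f : ℍ → ℂ) : Prop where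
  even : Even k
  pos : 0 < k
  sq : e ^ 2 = 1
  hol : Hol f
  translation : Fixes k e f ⟨⟨1, 1, 0, 1⟩, (false, false)⟩
  fricke : Fixes k e f ⟨⟨0, -1, N, 0⟩, (false, true)⟩
  hecke_two : ¬ 2 ∣ N → ∃ u : ℂ, (([⟨2, 0, 0, 1⟩, ⟨1, 0, 0, 2⟩, ⟨1, 1, 0, 2⟩] :
    List IntMat).map fun A => sl k A f).sum = u • f
  hecke_three : ¬ 3 ∣ N → ∃ u : ℂ, (([⟨3, 0, 0, 1⟩, ⟨1, 0, 0, 3⟩, ⟨1, 1, 0, 3⟩, ⟨1, 2, 0, 3⟩] :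
    List IntMat).map fun A => sl k A f).sum = u • f
  atkin_two : 2 ∣ N → sl k ⟨1, 0, 0, 2⟩ f + sl k ⟨1, 1, 0, 2⟩ f = if 4 ∣ N then 0 else f

namespace HeckeForm

variable {N : ℕ} {k : ℤ} {e : ℂ} {f : ℍ → ℂ}

lemma fixes_of_four_dvd (h : HeckeForm N k e f) (hN : 4 ∣ N) :
    Fixes k e f ⟨⟨2, 1, 0, 2⟩, (true, false)⟩ := by
  refine ⟨by decide, ?_⟩
  have h1 := h.atkin_two (dvd_trans (by norm_num) hN)
  rw [if_pos hN] at h1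
  have h2 := congrArg (sl k ⟨2, 0, 0, 1⟩) h1
  rw [sl_add, ← sl_mul (by decide) (by decide), ← sl_mul (by decide) (by decide), sl_zero,
    sl_eq_of_proportional (n := ⟨1, 0, 0, 1⟩) h.even (by decide) (by decide) (by decide), sl_one,
    sl_eq_of_proportional (n := ⟨2, 1, 0, 2⟩) h.even (by decide) (by decide) (by decide)] at h2
  rw [sgn_neg_one, eq_neg_of_add_eq_zero_right h2, neg_one_smul]

lemma fixes_of_not_four_dvd (h : HeckeForm N k e f) {M : ℕ} (hM : N = 2 * M) (hN : ¬ 4 ∣ N) :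
    Fixes k e f ⟨⟨2, -1, -N, M + 1⟩, (true, false)⟩ := by
  have hNM : (N : ℤ) = 2 * M := by exact_mod_cast hM
  have hM0 : 0 < (N : ℤ) := by
    have := h.fricke.1
    simpa [IntMat.det] using this
  have hd : 0 < (⟨1, 0, -M, 1⟩ : IntMat).det := by simp [IntMat.det]
  refine ⟨by simp only [IntMat.det]; rw [hNM]; ring_nf; decide, ?_⟩
  have h1 := h.atkin_two ⟨M, hM⟩
  rw [if_neg hN] at h1
  have h2 := congrArg (sl k ⟨2, 0, 0, 1⟩) h1
  rw [sl_add, ← sl_mul (by decide) (by decide), ← sl_mul (by decide) (by decide),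
    sl_eq_of_proportional (n := ⟨1, 0, 0, 1⟩) h.even (by decide) (by decide) (by decide), sl_one,
    sl_eq_of_proportional (n := ⟨2, 1, 0, 2⟩) h.even (by decide) (by decide) (by decide)] at h2
  have h3 := congrArg (sl k ⟨0, -1, N, 0⟩) h2
  have hHd : 0 < (⟨0, -1, N, 0⟩ : IntMat).det := h.fricke.1
  have e1 : (⟨2, 0, 0, 1⟩ : IntMat) * ⟨0, -1, N, 0⟩ = ⟨0, -1, N, 0⟩ * ⟨1, 0, 0, 2⟩ := by
    simp [IntMat.mul_def]
  have e2 : (⟨2, 1, 0, 2⟩ : IntMat) * ⟨0, -1, N, 0⟩ =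
      ⟨0, -1, N, 0⟩ * IntMat.scale 2 ⟨1, 0, -M, 1⟩ := by
    simp [IntMat.mul_def, IntMat.scale, hNM, mul_comm]
  rw [sl_add, ← sl_mul (by decide) hHd, ← sl_mul (by decide) hHd, e1, e2,
    sl_mul hHd (n := ⟨1, 0, 0, 2⟩) (by decide),
    sl_mul hHd (by rw [IntMat.det_scale]; positivity), h.fricke.2,
    sl_smul, sl_smul, sl_scale h.even (by decide) hd, ← smul_add] at h3
  have hs : sgn e (false, true) ≠ 0 := fun hs => by simpa [hs] using sgn_sq h.sq (false, true)
  have h4 := smul_right_injective _ hs h3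
  have h5 : sl k ⟨1, 0, -M, 1⟩ f = (-1 : ℂ) • sl k ⟨1, 1, 0, 2⟩ f := by
    rw [neg_one_smul, eq_neg_iff_add_eq_zero]
    have h6 : f + (sl k ⟨1, 0, -M, 1⟩ f + sl k ⟨1, 1, 0, 2⟩ f) = f := by
      rw [← add_assoc, h4, h1]
    exact add_eq_left.mp h6
  have e3 : (⟨2, -1, -N, M + 1⟩ : IntMat) = ⟨1, 0, -M, 1⟩ * (⟨1, 1, 0, 2⟩ : IntMat).adj := by
    simp only [IntMat.mul_def, IntMat.adj, hNM, IntMat.mk.injEq]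
    refine ⟨?_, ?_, ?_, ?_⟩ <;> ring
  rw [e3, sl_mul hd (by decide), h5, sl_smul, sl_adj_sl h.even (by decide), sgn_neg_one]

end HeckeForm

/-- Invariance under `Γ₀(5)`. -/
theorem HeckeForm.invariant_five {k : ℤ} {e : ℂ} {f : ℍ → ℂ} (h : HeckeForm 5 k e f) :
    ∀ γ ∈ CongruenceSubgroup.Gamma0 5, slash k (sl2ToReal γ) f = f := by
  have hG0 : ∀ g ∈ ([⟨⟨1, 1, 0, 1⟩, (false, false)⟩, ⟨⟨0, -1, 5, 0⟩, (false,
    true)⟩] : List SignedMat),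
      Fixes k e f g := by
    simp only [List.forall_mem_cons]
    exact ⟨h.translation, h.fricke, by simp⟩
  have hd0 : defect k f ⟨2, -1, -5, 3⟩ = 0 := by
    obtain ⟨u, hu⟩ := h.hecke_two (by decide)
    have hr := sum_sub_eq_zero_of_hecke hu (by decide)
      (fixes_of_wordLinks h.even h.sq hG0 [2] (A := ⟨0, -1, 5, 0⟩) (s := (false, true))
        (by decide +kernel))
      (P := [(⟨2, 0, 0, 1⟩, ⟨1, 0, 0, 2⟩), (⟨1, 0, 0, 2⟩, ⟨2, 0, 0, 1⟩), (⟨1, 1, 0, 2⟩, ⟨1, 1, 0,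
        2⟩)]) rfl (by decide)
    simp only [List.map_cons, List.map_nil, List.sum_cons, List.sum_nil, add_zero, zero_add,
      row_zero h.even h.sq hG0 [2] (s := (false, true)) (A := (⟨2, 0, 0, 1⟩ * ⟨0, -1, 5, 0⟩))
        (B := ⟨1, 0, 0, 2⟩) (by decide +kernel),
      row_zero h.even h.sq hG0 [2] (s := (false, true)) (A := (⟨1, 0, 0, 2⟩ * ⟨0, -1, 5, 0⟩))
        (B := ⟨2, 0, 0, 1⟩) (by decide +kernel),
      row_neg_defect h.even h.sq hG0 [] [2] (s := (false, true)) (t := (true, false)) (A := (⟨1, 1,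
        0, 2⟩ * ⟨0, -1, 5, 0⟩)) (B := ⟨1, 1, 0, 2⟩)
        ⟨2, -1, -5, 3⟩ ⟨5, -1, 10, 0⟩ (by decide) (by decide +kernel)] at hr
    exact eq_zero_of_sgn_smul_sl h.even h.sq (by decide) hr
  have hG1 : ∀ g ∈ ([⟨⟨2, -1, -5, 3⟩, (false, false)⟩, ⟨⟨1, 1, 0, 1⟩, (false, false)⟩, ⟨⟨0, -1, 5,
    0⟩, (false, true)⟩] : List SignedMat),
      Fixes k e f g :=
    List.forall_mem_cons.2 ⟨fixes_of_defect (by decide) hd0, hG0⟩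
  exact invariant_of_coversGamma0 h.even h.sq hG1
    (tbl := [
      (⟨1, 0, 0, 1⟩, [(1, []), (0, [2]), (0, [-2])]),
      (⟨0, 1, -1, 0⟩, [(0, []), (2, []), (3, [])]),
      (⟨0, 1, -1, -1⟩, [(3, [-2]), (4, []), (1, [])]),
      (⟨0, 1, -1, 1⟩, [(2, [2]), (1, []), (5, [])]),
      (⟨0, 1, -1, -2⟩, [(4, [1, 2]), (5, [3, 2, 3]), (2, [])]),
      (⟨0, 1, -1, 2⟩, [(5, [-1, 3, 2, 3]), (3, []), (4, [3, -2, 3])])])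
    ⟨_, List.mem_cons_self, rfl⟩ (by decide +kernel)

/-- Invariance under `Γ₀(6)`. -/
theorem HeckeForm.invariant_six {k : ℤ} {e : ℂ} {f : ℍ → ℂ} (h : HeckeForm 6 k e f) :
    ∀ γ ∈ CongruenceSubgroup.Gamma0 6, slash k (sl2ToReal γ) f = f := by
  have hG0 : ∀ g ∈ ([⟨⟨1, 1, 0, 1⟩, (false, false)⟩, ⟨⟨0, -1, 6, 0⟩, (false, true)⟩, ⟨⟨2, -1, -6,
    4⟩, (true, false)⟩] : List SignedMat),
      Fixes k e f g := by
    simp only [List.forall_mem_cons]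
    exact ⟨h.translation, h.fricke, h.fixes_of_not_four_dvd (M := 3) (by decide)
      (by decide), by simp⟩
  exact invariant_of_coversGamma0 h.even h.sq hG0
    (tbl := [
      (⟨1, 0, 0, 1⟩, [(1, []), (0, [1]), (0, [-1])]),
      (⟨0, 1, -1, 0⟩, [(0, []), (2, []), (3, [])]),
      (⟨0, 1, -1, -1⟩, [(3, [-1]), (4, []), (1, [])]),
      (⟨0, 1, -1, 1⟩, [(2, [1]), (1, []), (5, [])]),
      (⟨0, 1, -1, -2⟩, [(6, []), (7, []), (2, [])]),
      (⟨0, 1, -1, 2⟩, [(8, []), (3, []), (7, [2, -1, 2])]),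
      (⟨1, 0, -2, 1⟩, [(4, []), (8, [-1]), (9, [])]),
      (⟨0, 1, -1, -3⟩, [(10, []), (5, [2, 1, 2]), (4, [])]),
      (⟨1, 0, 2, 1⟩, [(5, []), (9, [-3, 2, 1, -3, 2, 1]), (6, [1])]),
      (⟨1, -1, -2, 3⟩, [(11, []), (6, []), (8, [3, 1, 2, 3, 1, 2])]),
      (⟨1, 0, -3, 1⟩, [(7, []), (11, []), (11, [3, 3, 1])]),
      (⟨1, 1, -3, -2⟩, [(9, []), (10, [3, 1, -3]), (10, [])])])
    ⟨_, List.mem_cons_self, rfl⟩ (by decide +kernel)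

/-- Invariance under `Γ₀(7)`. -/
theorem HeckeForm.invariant_seven {k : ℤ} {e : ℂ} {f : ℍ → ℂ} (h : HeckeForm 7 k e f) :
    ∀ γ ∈ CongruenceSubgroup.Gamma0 7, slash k (sl2ToReal γ) f = f := by
  have hG0 : ∀ g ∈ ([⟨⟨1, 1, 0, 1⟩, (false, false)⟩, ⟨⟨0, -1, 7, 0⟩, (false,
    true)⟩] : List SignedMat),
      Fixes k e f g := by
    simp only [List.forall_mem_cons]
    exact ⟨h.translation, h.fricke, by simp⟩
  have hd0 : defect k f ⟨2, -1, -7, 4⟩ = 0 := by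
    obtain ⟨u, hu⟩ := h.hecke_two (by decide)
    have hr := sum_sub_eq_zero_of_hecke hu (by decide)
      (fixes_of_wordLinks h.even h.sq hG0 [2] (A := ⟨0, -1, 7, 0⟩) (s := (false, true))
        (by decide +kernel))
      (P := [(⟨2, 0, 0, 1⟩, ⟨1, 0, 0, 2⟩), (⟨1, 0, 0, 2⟩, ⟨2, 0, 0, 1⟩), (⟨1, 1, 0, 2⟩, ⟨1, 1, 0,
        2⟩)]) rfl (by decide)
    simp only [List.map_cons, List.map_nil, List.sum_cons, List.sum_nil, add_zero, zero_add,
      row_zero h.even h.sq hG0 [2] (s := (false, true)) (A := (⟨2, 0, 0, 1⟩ * ⟨0, -1, 7, 0⟩))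
        (B := ⟨1, 0, 0, 2⟩) (by decide +kernel),
      row_zero h.even h.sq hG0 [2] (s := (false, true)) (A := (⟨1, 0, 0, 2⟩ * ⟨0, -1, 7, 0⟩))
        (B := ⟨2, 0, 0, 1⟩) (by decide +kernel),
      row_neg_defect h.even h.sq hG0 [] [2] (s := (false, true)) (t := (true, false)) (A := (⟨1, 1,
        0, 2⟩ * ⟨0, -1, 7, 0⟩)) (B := ⟨1, 1, 0, 2⟩)
        ⟨2, -1, -7, 4⟩ ⟨7, -1, 14, 0⟩ (by decide) (by decide +kernel)] at hr
    exact eq_zero_of_sgn_smul_sl h.even h.sq (by decide) hr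
  have hG1 : ∀ g ∈ ([⟨⟨2, -1, -7, 4⟩, (false, false)⟩, ⟨⟨1, 1, 0, 1⟩, (false, false)⟩, ⟨⟨0, -1, 7,
    0⟩, (false, true)⟩] : List SignedMat),
      Fixes k e f g :=
    List.forall_mem_cons.2 ⟨fixes_of_defect (by decide) hd0, hG0⟩
  exact invariant_of_coversGamma0 h.even h.sq hG1
    (tbl := [
      (⟨1, 0, 0, 1⟩, [(1, []), (0, [2]), (0, [-2])]),
      (⟨0, 1, -1, 0⟩, [(0, []), (2, []), (3, [])]),
      (⟨0, 1, -1, -1⟩, [(3, [-2]), (4, []), (1, [])]),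
      (⟨0, 1, -1, 1⟩, [(2, [2]), (1, []), (5, [])]),
      (⟨0, 1, -1, -2⟩, [(6, []), (6, [1, 2]), (2, [])]),
      (⟨0, 1, -1, 2⟩, [(7, []), (3, []), (7, [3, -2, -1, 3])]),
      (⟨1, 0, -2, 1⟩, [(4, []), (7, [-2]), (4, [-2, -1])]),
      (⟨1, 0, 2, 1⟩, [(5, []), (5, [-1, 3, 2, 3]), (6, [2])])])
    ⟨_, List.mem_cons_self, rfl⟩ (by decide +kernel)

/-- Invariance under `Γ₀(8)`. -/
theorem HeckeForm.invariant_eight {k : ℤ} {e : ℂ} {f : ℍ → ℂ} (h : HeckeForm 8 k e f) :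
    ∀ γ ∈ CongruenceSubgroup.Gamma0 8, slash k (sl2ToReal γ) f = f := by
  have hG0 : ∀ g ∈ ([⟨⟨1, 1, 0, 1⟩, (false, false)⟩, ⟨⟨0, -1, 8, 0⟩, (false, true)⟩, ⟨⟨2, 1, 0, 2⟩,
    (true, false)⟩] : List SignedMat),
      Fixes k e f g := by
    simp only [List.forall_mem_cons]
    exact ⟨h.translation, h.fricke, h.fixes_of_four_dvd (by decide), by simp⟩
  exact invariant_of_coversGamma0 h.even h.sq hG0
    (tbl := [
      (⟨1, 0, 0, 1⟩, [(1, []), (0, [1]), (0, [-1])]),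
      (⟨0, 1, -1, 0⟩, [(0, []), (2, []), (3, [])]),
      (⟨0, 1, -1, -1⟩, [(3, [-1]), (4, []), (1, [])]),
      (⟨0, 1, -1, 1⟩, [(2, [1]), (1, []), (5, [])]),
      (⟨0, 1, -1, -2⟩, [(6, []), (7, []), (2, [])]),
      (⟨0, 1, -1, 2⟩, [(8, []), (3, []), (9, [])]),
      (⟨1, 0, -2, 1⟩, [(4, []), (8, [-1]), (8, [-3, 2, -1, 2, -3])]),
      (⟨0, 1, -1, -3⟩, [(9, [-3, 2, -1, 2, -3]), (10, []), (4, [])]),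
      (⟨1, 0, 2, 1⟩, [(5, []), (6, [3, 2, 1, 2, 3]), (6, [1])]),
      (⟨0, 1, -1, 3⟩, [(7, [3, 2, 1, 2, 3]), (5, []), (10, [2, -1, 2])]),
      (⟨0, 1, -1, -4⟩, [(11, []), (9, [2, 1, 2]), (7, [])]),
      (⟨1, 0, -4, 1⟩, [(10, []), (11, [-3, 2, -3, 2, 3, 2, -3, 2]), (11, [2, 3, 2, -1, 2, -3,
        2])])])
    ⟨_, List.mem_cons_self, rfl⟩ (by decide +kernel)

/-- Invariance under `Γ₀(9)`. -/
theorem HeckeForm.invariant_nine {k : ℤ} {e : ℂ} {f : ℍ → ℂ} (h : HeckeForm 9 k e f) :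
    ∀ γ ∈ CongruenceSubgroup.Gamma0 9, slash k (sl2ToReal γ) f = f := by
  have hG0 : ∀ g ∈ ([⟨⟨1, 1, 0, 1⟩, (false, false)⟩, ⟨⟨0, -1, 9, 0⟩, (false,
    true)⟩] : List SignedMat),
      Fixes k e f g := by
    simp only [List.forall_mem_cons]
    exact ⟨h.translation, h.fricke, by simp⟩
  have hd0 : defect k f ⟨2, -1, -9, 5⟩ = 0 := by
    obtain ⟨u, hu⟩ := h.hecke_two (by decide)
    have hr := sum_sub_eq_zero_of_hecke hu (by decide)
      (fixes_of_wordLinks h.even h.sq hG0 [2] (A := ⟨0, -1, 9, 0⟩) (s := (false, true))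
        (by decide +kernel))
      (P := [(⟨2, 0, 0, 1⟩, ⟨1, 0, 0, 2⟩), (⟨1, 0, 0, 2⟩, ⟨2, 0, 0, 1⟩), (⟨1, 1, 0, 2⟩, ⟨1, 1, 0,
        2⟩)]) rfl (by decide)
    simp only [List.map_cons, List.map_nil, List.sum_cons, List.sum_nil, add_zero, zero_add,
      row_zero h.even h.sq hG0 [2] (s := (false, true)) (A := (⟨2, 0, 0, 1⟩ * ⟨0, -1, 9, 0⟩))
        (B := ⟨1, 0, 0, 2⟩) (by decide +kernel),
      row_zero h.even h.sq hG0 [2] (s := (false, true)) (A := (⟨1, 0, 0, 2⟩ * ⟨0, -1, 9, 0⟩))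
        (B := ⟨2, 0, 0, 1⟩) (by decide +kernel),
      row_neg_defect h.even h.sq hG0 [] [2] (s := (false, true)) (t := (true, false)) (A := (⟨1, 1,
        0, 2⟩ * ⟨0, -1, 9, 0⟩)) (B := ⟨1, 1, 0, 2⟩)
        ⟨2, -1, -9, 5⟩ ⟨9, -1, 18, 0⟩ (by decide) (by decide +kernel)] at hr
    exact eq_zero_of_sgn_smul_sl h.even h.sq (by decide) hr
  have hG1 : ∀ g ∈ ([⟨⟨2, -1, -9, 5⟩, (false, false)⟩, ⟨⟨1, 1, 0, 1⟩, (false, false)⟩, ⟨⟨0, -1, 9,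
    0⟩, (false, true)⟩] : List SignedMat),
      Fixes k e f g :=
    List.forall_mem_cons.2 ⟨fixes_of_defect (by decide) hd0, hG0⟩
  exact invariant_of_coversGamma0 h.even h.sq hG1
    (tbl := [
      (⟨1, 0, 0, 1⟩, [(1, []), (0, [2]), (0, [-2])]),
      (⟨0, 1, -1, 0⟩, [(0, []), (2, []), (3, [])]),
      (⟨0, 1, -1, -1⟩, [(3, [-2]), (4, []), (1, [])]),
      (⟨0, 1, -1, 1⟩, [(2, [2]), (1, []), (5, [])]),
      (⟨0, 1, -1, -2⟩, [(6, []), (7, []), (2, [])]),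
      (⟨0, 1, -1, 2⟩, [(8, []), (3, []), (9, [])]),
      (⟨1, 0, -2, 1⟩, [(4, []), (8, [-2]), (7, [-2, -1])]),
      (⟨0, 1, -1, -3⟩, [(10, []), (6, [1, 2]), (4, [])]),
      (⟨1, 0, 2, 1⟩, [(5, []), (9, [-1, 3, 2, 3]), (6, [2])]),
      (⟨0, 1, -1, 3⟩, [(11, []), (5, []), (8, [3, -2, -1, 3])]),
      (⟨1, 0, -3, 1⟩, [(7, []), (10, [-2, -1]), (10, [1, 2])]),
      (⟨1, 0, 3, 1⟩, [(9, []), (11, [3, -2, -1, 3]), (11, [-1, 3, 2, 3])])])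
    ⟨_, List.mem_cons_self, rfl⟩ (by decide +kernel)

/-- Invariance under `Γ₀(10)`. -/
theorem HeckeForm.invariant_ten {k : ℤ} {e : ℂ} {f : ℍ → ℂ} (h : HeckeForm 10 k e f) :
    ∀ γ ∈ CongruenceSubgroup.Gamma0 10, slash k (sl2ToReal γ) f = f := by
  have hG0 : ∀ g ∈ ([⟨⟨1, 1, 0, 1⟩, (false, false)⟩, ⟨⟨0, -1, 10, 0⟩, (false, true)⟩, ⟨⟨2, -1, -10,
    6⟩, (true, false)⟩] : List SignedMat),
      Fixes k e f g := by
    simp only [List.forall_mem_cons]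
    exact ⟨h.translation, h.fricke, h.fixes_of_not_four_dvd (M := 5) (by decide)
      (by decide), by simp⟩
  exact invariant_of_coversGamma0 h.even h.sq hG0
    (tbl := [
      (⟨1, 0, 0, 1⟩, [(1, []), (0, [1]), (0, [-1])]),
      (⟨0, 1, -1, 0⟩, [(0, []), (2, []), (3, [])]),
      (⟨0, 1, -1, -1⟩, [(3, [-1]), (4, []), (1, [])]),
      (⟨0, 1, -1, 1⟩, [(2, [1]), (1, []), (5, [])]),
      (⟨0, 1, -1, -2⟩, [(6, []), (7, []), (2, [])]),
      (⟨0, 1, -1, 2⟩, [(8, []), (3, []), (9, [])]),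
      (⟨1, 0, -2, 1⟩, [(4, []), (8, [-1]), (10, [])]),
      (⟨0, 1, -1, -3⟩, [(7, [3, 1, 3, 1]), (11, []), (4, [])]),
      (⟨1, 0, 2, 1⟩, [(5, []), (12, []), (6, [1])]),
      (⟨0, 1, -1, 3⟩, [(9, [2, -1, -3, -1, -3, 2]), (5, []), (13, [])]),
      (⟨1, -1, -2, 3⟩, [(11, [3, 1, 3, 1]), (6, []), (14, [])]),
      (⟨0, 1, -1, -4⟩, [(10, [3, 1, 3, 1]), (15, []), (7, [])]),
      (⟨1, 1, 2, 3⟩, [(13, [2, -1, -3, -1, -3, 2]), (14, [-3, 2, 1, -3, 2, 1]), (8, [])]),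
      (⟨0, 1, -1, 4⟩, [(12, [2, -1, -3, -1, -3, 2]), (9, []), (15, [2, -1, 2])]),
      (⟨1, -2, -2, 5⟩, [(16, []), (10, []), (12, [-1, -3, 2, -1, -3, 2])]),
      (⟨0, 1, -1, -5⟩, [(17, []), (13, [2, 1, 2]), (11, [])]),
      (⟨2, 1, -5, -2⟩, [(14, []), (17, [-1, -3, -3]), (17, [3, 1, 3, 1])]),
      (⟨1, 0, -5, 1⟩, [(15, []), (16, [3, 1, 3, 1]), (16, [3, 3, 1])])])
    ⟨_, List.mem_cons_self, rfl⟩ (by decide +kernel)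

/-- Invariance under `Γ₀(11)`. -/
theorem HeckeForm.invariant_eleven {k : ℤ} {e : ℂ} {f : ℍ → ℂ} (h : HeckeForm 11 k e f) :
    ∀ γ ∈ CongruenceSubgroup.Gamma0 11, slash k (sl2ToReal γ) f = f := by
  have hG0 : ∀ g ∈ ([⟨⟨1, 1, 0, 1⟩, (false, false)⟩, ⟨⟨0, -1, 11, 0⟩, (false,
    true)⟩] : List SignedMat),
      Fixes k e f g := by
    simp only [List.forall_mem_cons]
    exact ⟨h.translation, h.fricke, by simp⟩
  have hd0 : defect k f ⟨2, -1, -11, 6⟩ = 0 := by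
    obtain ⟨u, hu⟩ := h.hecke_two (by decide)
    have hr := sum_sub_eq_zero_of_hecke hu (by decide)
      (fixes_of_wordLinks h.even h.sq hG0 [2] (A := ⟨0, -1, 11, 0⟩) (s := (false, true))
        (by decide +kernel))
      (P := [(⟨2, 0, 0, 1⟩, ⟨1, 0, 0, 2⟩), (⟨1, 0, 0, 2⟩, ⟨2, 0, 0, 1⟩), (⟨1, 1, 0, 2⟩, ⟨1, 1, 0,
        2⟩)]) rfl (by decide)
    simp only [List.map_cons, List.map_nil, List.sum_cons, List.sum_nil, add_zero, zero_add,
      row_zero h.even h.sq hG0 [2] (s := (false, true)) (A := (⟨2, 0, 0, 1⟩ * ⟨0, -1, 11, 0⟩))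
        (B := ⟨1, 0, 0, 2⟩) (by decide +kernel),
      row_zero h.even h.sq hG0 [2] (s := (false, true)) (A := (⟨1, 0, 0, 2⟩ * ⟨0, -1, 11, 0⟩))
        (B := ⟨2, 0, 0, 1⟩) (by decide +kernel),
      row_neg_defect h.even h.sq hG0 [] [2] (s := (false, true)) (t := (true, false)) (A := (⟨1, 1,
        0, 2⟩ * ⟨0, -1, 11, 0⟩)) (B := ⟨1, 1, 0, 2⟩)
        ⟨2, -1, -11, 6⟩ ⟨11, -1, 22, 0⟩ (by decide) (by decide +kernel)] at hr
    exact eq_zero_of_sgn_smul_sl h.even h.sq (by decide) hr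
  have hG1 : ∀ g ∈ ([⟨⟨2, -1, -11, 6⟩, (false, false)⟩, ⟨⟨1, 1, 0, 1⟩, (false, false)⟩, ⟨⟨0, -1,
    11, 0⟩, (false, true)⟩] : List SignedMat),
      Fixes k e f g :=
    List.forall_mem_cons.2 ⟨fixes_of_defect (by decide) hd0, hG0⟩
  have hc1_0 : Carries k e (⟨14, -12, -22, 19⟩ * ⟨44, 26, 55, 33⟩) (true, true)
      (defect k f ⟨3, 2, -11, -7⟩) (defect k f ⟨3, 2, -11, -7⟩) := by
    obtain ⟨u, hu⟩ := h.hecke_two (by decide)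
    have hr := sum_sub_eq_zero_of_hecke hu (by decide)
      (fixes_of_wordLinks h.even h.sq hG1 [-1, -2] (A := ⟨6, -5, 11, -9⟩) (s := (false, false))
        (by decide +kernel))
      (P := [(⟨2, 0, 0, 1⟩, ⟨1, 1, 0, 2⟩), (⟨1, 0, 0, 2⟩, ⟨2, 0, 0, 1⟩), (⟨1, 1, 0, 2⟩, ⟨1, 0, 0,
        2⟩)]) rfl (by decide)
    simp only [List.map_cons, List.map_nil, List.sum_cons, List.sum_nil, add_zero, zero_add,
      row_zero h.even h.sq hG1 [2, 3, -2, 3, -2] (s := (false, false)) (A := (⟨2, 0, 0, 1⟩ * ⟨6,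
        -5, 11, -9⟩)) (B := ⟨1, 1, 0, 2⟩) (by decide +kernel),
      row_neg_defect h.even h.sq hG1 [3, -2, -1, 3, 2] [2, 2] (s := (false, false)) (t := (true,
        false)) (A := (⟨1, 0, 0, 2⟩ * ⟨6, -5, 11, -9⟩)) (B := ⟨2, 0, 0, 1⟩)
        ⟨3, 2, -11, -7⟩ ⟨14, -12, -22, 19⟩ (by decide) (by decide +kernel),
      row_neg_defect h.even h.sq hG1 [2, 3, 2] [-1, 3, 2] (s := (false, false)) (t := (true,
        true)) (A := (⟨1, 1, 0, 2⟩ * ⟨6, -5, 11, -9⟩)) (B := ⟨1, 0, 0, 2⟩)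
        ⟨3, 2, -11, -7⟩ ⟨33, -26, -55, 44⟩ (by decide) (by decide +kernel)] at hr
    exact carries_of_sum_eq_zero h.even h.sq (by decide) (by decide) hr
  have hd1 : defect k f ⟨3, 2, -11, -7⟩ = 0 :=
    defect_eq_zero_of_carries h.even h.pos h.sq h.hol (by decide) hc1_0 (by decide +kernel)
  have hG2 : ∀ g ∈ ([⟨⟨3, 2, -11, -7⟩, (false, false)⟩, ⟨⟨2, -1, -11, 6⟩, (false, false)⟩, ⟨⟨1, 1,
    0, 1⟩, (false, false)⟩, ⟨⟨0, -1, 11, 0⟩, (false, true)⟩] : List SignedMat),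
      Fixes k e f g :=
    List.forall_mem_cons.2 ⟨fixes_of_defect (by decide) hd1, hG1⟩
  exact invariant_of_coversGamma0 h.even h.sq hG2
    (tbl := [
      (⟨1, 0, 0, 1⟩, [(1, []), (0, [3]), (0, [-3])]),
      (⟨0, 1, -1, 0⟩, [(0, []), (2, []), (3, [])]),
      (⟨0, 1, -1, -1⟩, [(3, [-3]), (4, []), (1, [])]),
      (⟨0, 1, -1, 1⟩, [(2, [3]), (1, []), (5, [])]),
      (⟨0, 1, -1, -2⟩, [(6, []), (7, []), (2, [])]),
      (⟨0, 1, -1, 2⟩, [(8, []), (3, []), (9, [])]),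
      (⟨1, 0, -2, 1⟩, [(4, []), (8, [-3]), (10, [])]),
      (⟨0, 1, -1, -3⟩, [(11, []), (10, [2, 3]), (4, [])]),
      (⟨1, 0, 2, 1⟩, [(5, []), (11, [3, -1]), (6, [3])]),
      (⟨0, 1, -1, 3⟩, [(10, [4, 1, -3, -2, 4, 3]), (5, []), (11, [4, 1, -3, -2, 4, 3])]),
      (⟨1, -1, -2, 3⟩, [(9, [-3, -2, 1, -3]), (6, []), (7, [-3, -2])]),
      (⟨1, 0, -3, 1⟩, [(7, []), (9, [-3, -2, 1, -3]), (8, [1, -3])])])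
    ⟨_, List.mem_cons_self, rfl⟩ (by decide +kernel)

/-- Invariance under `Γ₀(12)`. -/
theorem HeckeForm.invariant_twelve {k : ℤ} {e : ℂ} {f : ℍ → ℂ} (h : HeckeForm 12 k e f) :
    ∀ γ ∈ CongruenceSubgroup.Gamma0 12, slash k (sl2ToReal γ) f = f := by
  have hG0 : ∀ g ∈ ([⟨⟨1, 1, 0, 1⟩, (false, false)⟩, ⟨⟨0, -1, 12, 0⟩, (false, true)⟩, ⟨⟨2, 1, 0,
    2⟩, (true, false)⟩] : List SignedMat),
      Fixes k e f g := by
    simp only [List.forall_mem_cons]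
    exact ⟨h.translation, h.fricke, h.fixes_of_four_dvd (by decide), by simp⟩
  exact invariant_of_coversGamma0 h.even h.sq hG0
    (tbl := [
      (⟨1, 0, 0, 1⟩, [(1, []), (0, [1]), (0, [-1])]),
      (⟨0, 1, -1, 0⟩, [(0, []), (2, []), (3, [])]),
      (⟨0, 1, -1, -1⟩, [(3, [-1]), (4, []), (1, [])]),
      (⟨0, 1, -1, 1⟩, [(2, [1]), (1, []), (5, [])]),
      (⟨0, 1, -1, -2⟩, [(6, []), (7, []), (2, [])]),
      (⟨0, 1, -1, 2⟩, [(8, []), (3, []), (9, [])]),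
      (⟨1, 0, -2, 1⟩, [(4, []), (8, [-1]), (10, [])]),
      (⟨0, 1, -1, -3⟩, [(11, []), (12, []), (4, [])]),
      (⟨1, 0, 2, 1⟩, [(5, []), (10, [3, 2, 1, 2, 3]), (6, [1])]),
      (⟨0, 1, -1, 3⟩, [(13, []), (5, []), (14, [])]),
      (⟨1, -1, -2, 3⟩, [(15, []), (6, []), (8, [-3, 2, -1, 2, -3])]),
      (⟨1, 0, -3, 1⟩, [(7, []), (15, []), (16, [])]),
      (⟨0, 1, -1, -4⟩, [(17, []), (18, []), (7, [])]),
      (⟨1, 0, 3, 1⟩, [(9, []), (16, [3, 2, 3, 2, 1, 2, 3, 2, 3]), (15, [3, 2, 1, 2, 3])]),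
      (⟨0, 1, -1, 4⟩, [(19, []), (9, []), (20, [])]),
      (⟨1, 1, -3, -2⟩, [(10, []), (13, [-3, 2, -1, 2, -3]), (11, [])]),
      (⟨1, -1, -3, 4⟩, [(21, []), (11, []), (13, [-3, 2, -3, 2, -1, 2, -3, 2, -3])]),
      (⟨1, 0, -4, 1⟩, [(12, []), (21, []), (19, [2, 3, 2, 1, 2, 3, 2])]),
      (⟨0, 1, -1, -5⟩, [(20, [2, 3, 2, 1, 2, 3, 2]), (22, []), (12, [])]),
      (⟨1, 0, 4, 1⟩, [(14, []), (17, [2, -3, 2, -1, 2, -3, 2]), (21, [3, 2, 3, 2, 1, 2, 3, 2, 3])]),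
      (⟨0, 1, -1, 5⟩, [(18, [2, -3, 2, -1, 2, -3, 2]), (14, []), (22, [2, -1, 2])]),
      (⟨1, 1, -4, -3⟩, [(16, []), (19, [-3, 2, -3, 2, -1, 2, -3, 2, -3]), (17, [])]),
      (⟨0, 1, -1, -6⟩, [(23, []), (20, [2, 1, 2]), (18, [])]),
      (⟨1, 0, -6, 1⟩, [(22, []), (23, [2, 3, 2, 1, 2, -3, 2]), (23, [2, 3, 2, -1, 2, -3, 2])])])
    ⟨_, List.mem_cons_self, rfl⟩ (by decide +kernel)

/-- Invariance under `Γ₀(14)`. -/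
theorem HeckeForm.invariant_fourteen {k : ℤ} {e : ℂ} {f : ℍ → ℂ} (h : HeckeForm 14 k e f) :
    ∀ γ ∈ CongruenceSubgroup.Gamma0 14, slash k (sl2ToReal γ) f = f := by
  have hG0 : ∀ g ∈ ([⟨⟨1, 1, 0, 1⟩, (false, false)⟩, ⟨⟨0, -1, 14, 0⟩, (false, true)⟩, ⟨⟨2, -1, -14,
    8⟩, (true, false)⟩] : List SignedMat),
      Fixes k e f g := by
    simp only [List.forall_mem_cons]
    exact ⟨h.translation, h.fricke, h.fixes_of_not_four_dvd (M := 7) (by decide)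
      (by decide), by simp⟩
  have hc0_0 : Carries k e (⟨7, 5, -14, -7⟩ * ⟨-7, -6, 28, 21⟩) (false, false)
      (defect k f ⟨3, 2, -14, -9⟩) (defect k f ⟨3, 2, -14, -9⟩) := by
    obtain ⟨u, hu⟩ := h.hecke_three (by decide)
    have hr := sum_sub_eq_zero_of_hecke hu (by decide)
      (fixes_of_wordLinks h.even h.sq hG0 [-3, 2, 1, 2] (A := ⟨6, -1, 14, -2⟩) (s := (true,
        false)) (by decide +kernel))
      (P := [(⟨3, 0, 0, 1⟩, ⟨1, 2, 0, 3⟩), (⟨1, 0, 0, 3⟩, ⟨3, 0, 0, 1⟩), (⟨1, 1, 0, 3⟩, ⟨1, 0, 0,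
        3⟩), (⟨1, 2, 0, 3⟩, ⟨1, 1, 0, 3⟩)]) rfl (by decide)
    simp only [List.map_cons, List.map_nil, List.sum_cons, List.sum_nil, add_zero, zero_add,
      row_defect h.even h.sq hG0 [1, 2] [-3, 2, 1] (s := (true, false)) (t := (false, true)) (A :=
        (⟨3, 0, 0, 1⟩ * ⟨6, -1, 14, -2⟩)) (B := ⟨1, 2, 0, 3⟩)
        ⟨3, 2, -14, -9⟩ ⟨7, 5, -14, -7⟩ (by decide) (by decide +kernel),
      row_zero h.even h.sq hG0 [2, -1, -3, 2] (s := (true, false)) (A := (⟨1, 0, 0, 3⟩ * ⟨6, -1,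
        14, -2⟩)) (B := ⟨3, 0, 0, 1⟩) (by decide +kernel),
      row_zero h.even h.sq hG0 [-3, 2, 1, 1, 2] (s := (true, false)) (A := (⟨1, 1, 0, 3⟩ * ⟨6, -1,
        14, -2⟩)) (B := ⟨1, 0, 0, 3⟩) (by decide +kernel),
      row_neg_defect h.even h.sq hG0 [1, 3, 1, 3, 1, 2, 1] [2, -1, -3] (s := (true, false)) (t :=
        (true, true)) (A := (⟨1, 2, 0, 3⟩ * ⟨6, -1, 14, -2⟩)) (B := ⟨1, 1, 0, 3⟩)
        ⟨3, 2, -14, -9⟩ ⟨21, 6, -28, -7⟩ (by decide) (by decide +kernel)] at hr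
    exact carries_of_sum_eq_zero h.even h.sq (by decide) (by decide) hr
  have hd0 : defect k f ⟨3, 2, -14, -9⟩ = 0 :=
    defect_eq_zero_of_carries h.even h.pos h.sq h.hol (by decide) (hc0_0.symm h.even h.sq)
      (by decide +kernel)
  have hG1 : ∀ g ∈ ([⟨⟨3, 2, -14, -9⟩, (false, false)⟩, ⟨⟨1, 1, 0, 1⟩, (false, false)⟩, ⟨⟨0, -1,
    14, 0⟩, (false, true)⟩, ⟨⟨2, -1, -14, 8⟩, (true, false)⟩] : List SignedMat),
      Fixes k e f g :=
    List.forall_mem_cons.2 ⟨fixes_of_defect (by decide) hd0, hG0⟩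
  exact invariant_of_coversGamma0 h.even h.sq hG1
    (tbl := [
      (⟨1, 0, 0, 1⟩, [(1, []), (0, [2]), (0, [-2])]),
      (⟨0, 1, -1, 0⟩, [(0, []), (2, []), (3, [])]),
      (⟨0, 1, -1, -1⟩, [(3, [-2]), (4, []), (1, [])]),
      (⟨0, 1, -1, 1⟩, [(2, [2]), (1, []), (5, [])]),
      (⟨0, 1, -1, -2⟩, [(6, []), (7, []), (2, [])]),
      (⟨0, 1, -1, 2⟩, [(8, []), (3, []), (9, [])]),
      (⟨1, 0, -2, 1⟩, [(4, []), (8, [-2]), (10, [])]),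
      (⟨0, 1, -1, -3⟩, [(11, []), (12, []), (4, [])]),
      (⟨1, 0, 2, 1⟩, [(5, []), (13, []), (6, [2])]),
      (⟨0, 1, -1, 3⟩, [(14, []), (5, []), (15, [])]),
      (⟨1, -1, -2, 3⟩, [(15, [-2, -4, -2, -4, 1, -2]), (6, []), (16, [])]),
      (⟨1, 0, -3, 1⟩, [(7, []), (15, [-2, -4, -2, -4, 1, -2]), (17, [])]),
      (⟨0, 1, -1, -4⟩, [(13, [1, -2]), (14, [1, -2]), (7, [])]),
      (⟨1, 1, 2, 3⟩, [(12, [2, -1]), (18, []), (8, [])]),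
      (⟨1, 0, 3, 1⟩, [(9, []), (19, []), (12, [2, -1])]),
      (⟨0, 1, -1, 4⟩, [(10, [3, -2, -4, 1, -2, -4, 3, 2]), (9, []), (11, [3, -2, -4, 1, -2, -4, 3,
        2])]),
      (⟨1, -2, -2, 5⟩, [(19, [-2, -4, -2, -4, 1, -2]), (10, []), (20, [])]),
      (⟨1, -1, -3, 4⟩, [(18, [1, -2]), (11, []), (21, [])]),
      (⟨1, 2, 2, 5⟩, [(17, [2, -1]), (20, [-4, 3, 2, -4, 3, 2]), (13, [])]),
      (⟨1, 1, 3, 4⟩, [(16, [3, -2, -4, 1, -2, -4, 3, 2]), (21, [3, 1, -2, -4, 1, -2, -4, 3, 2]),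
        (14, [])]),
      (⟨1, -3, -2, 7⟩, [(22, []), (16, []), (18, [-2, -4, 3, -2, -4, 3])]),
      (⟨1, -2, -3, 7⟩, [(23, []), (17, []), (19, [-2, -4, 1, -2, -4, 1, -2])]),
      (⟨3, 1, -7, -2⟩, [(20, []), (23, [-2, -4, 3, 1, -2, -4, 3, 2]), (23, [-2, -4, -1, 4, 2])]),
      (⟨2, 1, -7, -3⟩, [(21, []), (22, [-2, -4, 1, 4, 2]), (22, [1, -2, -4, 3, 2, -4, 3, 2])])])
    ⟨_, List.mem_cons_self, rfl⟩ (by decide +kernel)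

/-- Invariance under `Γ₀(15)`. -/
theorem HeckeForm.invariant_fifteen {k : ℤ} {e : ℂ} {f : ℍ → ℂ} (h : HeckeForm 15 k e f) :
    ∀ γ ∈ CongruenceSubgroup.Gamma0 15, slash k (sl2ToReal γ) f = f := by
  have hG0 : ∀ g ∈ ([⟨⟨1, 1, 0, 1⟩, (false, false)⟩, ⟨⟨0, -1, 15, 0⟩, (false,
    true)⟩] : List SignedMat),
      Fixes k e f g := by
    simp only [List.forall_mem_cons]
    exact ⟨h.translation, h.fricke, by simp⟩
  have hd0 : defect k f ⟨2, -1, -15, 8⟩ = 0 := by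
    obtain ⟨u, hu⟩ := h.hecke_two (by decide)
    have hr := sum_sub_eq_zero_of_hecke hu (by decide)
      (fixes_of_wordLinks h.even h.sq hG0 [2] (A := ⟨0, -1, 15, 0⟩) (s := (false, true))
        (by decide +kernel))
      (P := [(⟨2, 0, 0, 1⟩, ⟨1, 0, 0, 2⟩), (⟨1, 0, 0, 2⟩, ⟨2, 0, 0, 1⟩), (⟨1, 1, 0, 2⟩, ⟨1, 1, 0,
        2⟩)]) rfl (by decide)
    simp only [List.map_cons, List.map_nil, List.sum_cons, List.sum_nil, add_zero, zero_add,
      row_zero h.even h.sq hG0 [2] (s := (false, true)) (A := (⟨2, 0, 0, 1⟩ * ⟨0, -1, 15, 0⟩))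
        (B := ⟨1, 0, 0, 2⟩) (by decide +kernel),
      row_zero h.even h.sq hG0 [2] (s := (false, true)) (A := (⟨1, 0, 0, 2⟩ * ⟨0, -1, 15, 0⟩))
        (B := ⟨2, 0, 0, 1⟩) (by decide +kernel),
      row_neg_defect h.even h.sq hG0 [] [2] (s := (false, true)) (t := (true, false)) (A := (⟨1, 1,
        0, 2⟩ * ⟨0, -1, 15, 0⟩)) (B := ⟨1, 1, 0, 2⟩)
        ⟨2, -1, -15, 8⟩ ⟨15, -1, 30, 0⟩ (by decide) (by decide +kernel)] at hr
    exact eq_zero_of_sgn_smul_sl h.even h.sq (by decide) hr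
  have hG1 : ∀ g ∈ ([⟨⟨2, -1, -15, 8⟩, (false, false)⟩, ⟨⟨1, 1, 0, 1⟩, (false, false)⟩, ⟨⟨0, -1,
    15, 0⟩, (false, true)⟩] : List SignedMat),
      Fixes k e f g :=
    List.forall_mem_cons.2 ⟨fixes_of_defect (by decide) hd0, hG0⟩
  have hc1_0 : Carries k e (⟨1, -2, 0, 2⟩ * ⟨7, 5, 15, 11⟩) (false, false)
      (defect k f ⟨4, 3, -15, -11⟩) (defect k f ⟨4, 3, -15, -11⟩) := by
    obtain ⟨u, hu⟩ := h.hecke_two (by decide)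
    have hr := sum_sub_eq_zero_of_hecke hu (by decide)
      (fixes_of_wordLinks h.even h.sq hG1 [1] (A := ⟨2, -1, -15, 8⟩) (s := (false, false))
        (by decide +kernel))
      (P := [(⟨2, 0, 0, 1⟩, ⟨1, 0, 0, 2⟩), (⟨1, 0, 0, 2⟩, ⟨2, 0, 0, 1⟩), (⟨1, 1, 0, 2⟩, ⟨1, 1, 0,
        2⟩)]) rfl (by decide)
    simp only [List.map_cons, List.map_nil, List.sum_cons, List.sum_nil, add_zero, zero_add,
      row_defect h.even h.sq hG1 [] [2] (s := (false, false)) (t := (false, false)) (A := (⟨2, 0,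
        0, 1⟩ * ⟨2, -1, -15, 8⟩)) (B := ⟨1, 0, 0, 2⟩)
        ⟨4, 3, -15, -11⟩ ⟨1, -2, 0, 2⟩ (by decide) (by decide +kernel),
      row_zero h.even h.sq hG1 [3, 2, 3, -2] (s := (false, false)) (A := (⟨1, 0, 0, 2⟩ * ⟨2, -1,
        -15, 8⟩)) (B := ⟨2, 0, 0, 1⟩) (by decide +kernel),
      row_neg_defect h.even h.sq hG1 [-1, 3, 2, 3, 2] [2] (s := (false, false)) (t := (true,
        false)) (A := (⟨1, 1, 0, 2⟩ * ⟨2, -1, -15, 8⟩)) (B := ⟨1, 1, 0, 2⟩)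
        ⟨4, 3, -15, -11⟩ ⟨11, -5, -15, 7⟩ (by decide) (by decide +kernel)] at hr
    exact carries_of_sum_eq_zero h.even h.sq (by decide) (by decide) hr
  have hd1 : defect k f ⟨4, 3, -15, -11⟩ = 0 :=
    defect_eq_zero_of_carries h.even h.pos h.sq h.hol (by decide) (hc1_0.symm h.even h.sq)
      (by decide +kernel)
  have hG2 : ∀ g ∈ ([⟨⟨4, 3, -15, -11⟩, (false, false)⟩, ⟨⟨2, -1, -15, 8⟩, (false, false)⟩, ⟨⟨1, 1,
    0, 1⟩, (false, false)⟩, ⟨⟨0, -1, 15, 0⟩, (false, true)⟩] : List SignedMat),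
      Fixes k e f g :=
    List.forall_mem_cons.2 ⟨fixes_of_defect (by decide) hd1, hG1⟩
  have hd2 : defect k f ⟨11, 7, -30, -19⟩ = 0 := by
    obtain ⟨u, hu⟩ := h.hecke_two (by decide)
    have hr := sum_sub_eq_zero_of_hecke hu (by decide)
      (fixes_of_wordLinks h.even h.sq hG2 [1] (A := ⟨4, 3, -15, -11⟩) (s := (false, false))
        (by decide +kernel))
      (P := [(⟨2, 0, 0, 1⟩, ⟨1, 1, 0, 2⟩), (⟨1, 0, 0, 2⟩, ⟨2, 0, 0, 1⟩), (⟨1, 1, 0, 2⟩, ⟨1, 0, 0,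
        2⟩)]) rfl (by decide)
    simp only [List.map_cons, List.map_nil, List.sum_cons, List.sum_nil, add_zero, zero_add,
      row_zero h.even h.sq hG2 [-3, -2, 4, 3, 4] (s := (false, false)) (A := (⟨2, 0, 0, 1⟩ * ⟨4, 3,
        -15, -11⟩)) (B := ⟨1, 1, 0, 2⟩) (by decide +kernel),
      row_zero h.even h.sq hG2 [2, 3, 3] (s := (false, false)) (A := (⟨1, 0, 0, 2⟩ * ⟨4, 3, -15,
        -11⟩)) (B := ⟨2, 0, 0, 1⟩) (by decide +kernel),
      row_neg_defect h.even h.sq hG2 [3] [] (s := (false, false)) (t := (true, false)) (A := (⟨1,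
        1, 0, 2⟩ * ⟨4, 3, -15, -11⟩)) (B := ⟨1, 0, 0, 2⟩)
        ⟨11, 7, -30, -19⟩ ⟨19, 14, -30, -22⟩ (by decide) (by decide +kernel)] at hr
    exact eq_zero_of_sgn_smul_sl h.even h.sq (by decide) hr
  have hG3 : ∀ g ∈ ([⟨⟨11, 7, -30, -19⟩, (false, false)⟩, ⟨⟨4, 3, -15, -11⟩, (false, false)⟩, ⟨⟨2,
    -1, -15, 8⟩, (false, false)⟩, ⟨⟨1, 1, 0, 1⟩, (false, false)⟩, ⟨⟨0, -1, 15, 0⟩, (false,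
    true)⟩] : List SignedMat),
      Fixes k e f g :=
    List.forall_mem_cons.2 ⟨fixes_of_defect (by decide) hd2, hG2⟩
  exact invariant_of_coversGamma0 h.even h.sq hG3
    (tbl := [
      (⟨1, 0, 0, 1⟩, [(1, []), (0, [4]), (0, [-4])]),
      (⟨0, 1, -1, 0⟩, [(0, []), (2, []), (3, [])]),
      (⟨0, 1, -1, -1⟩, [(3, [-4]), (4, []), (1, [])]),
      (⟨0, 1, -1, 1⟩, [(2, [4]), (1, []), (5, [])]),
      (⟨0, 1, -1, -2⟩, [(6, []), (7, []), (2, [])]),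
      (⟨0, 1, -1, 2⟩, [(8, []), (3, []), (9, [])]),
      (⟨1, 0, -2, 1⟩, [(4, []), (8, [-4]), (10, [])]),
      (⟨0, 1, -1, -3⟩, [(11, []), (12, []), (4, [])]),
      (⟨1, 0, 2, 1⟩, [(5, []), (13, []), (6, [4])]),
      (⟨0, 1, -1, 3⟩, [(14, []), (5, []), (15, [])]),
      (⟨1, -1, -2, 3⟩, [(16, []), (6, []), (17, [])]),
      (⟨1, 0, -3, 1⟩, [(7, []), (16, []), (14, [2, -4])]),
      (⟨0, 1, -1, -4⟩, [(15, [2, -4]), (17, [3, 4]), (7, [])]),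
      (⟨1, 1, 2, 3⟩, [(18, []), (19, []), (8, [])]),
      (⟨1, 0, 3, 1⟩, [(9, []), (11, [5, 2, -4, 5]), (18, [])]),
      (⟨0, 1, -1, 4⟩, [(12, [5, 2, -4, 5]), (9, []), (19, [5, -4, -3, 5])]),
      (⟨1, 1, -3, -2⟩, [(10, []), (20, []), (11, [])]),
      (⟨1, -2, -2, 5⟩, [(21, []), (10, []), (12, [-4, -3])]),
      (⟨1, -1, 3, -2⟩, [(13, []), (14, []), (20, [4, -1])]),
      (⟨1, 2, 2, 5⟩, [(22, []), (15, [-3, 5, 4, 5]), (13, [])]),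
      (⟨1, 2, -3, -5⟩, [(23, []), (18, [1, -4]), (16, [])]),
      (⟨2, 1, -5, -2⟩, [(17, []), (22, [-4, -3, 2, -4, 5, -4, -3, 5]), (23, [])]),
      (⟨2, -1, 5, -2⟩, [(19, []), (23, [4, -1]), (21, [5, 3, 4, 2, -4, -3, 5, 4])]),
      (⟨2, -1, -5, 3⟩, [(20, []), (21, []), (22, [1, -4])])])
    ⟨_, List.mem_cons_self, rfl⟩ (by decide +kernel)

/-- Invariance under `Γ₀(16)`. -/
theorem HeckeForm.invariant_sixteen {k : ℤ} {e : ℂ} {f : ℍ → ℂ} (h : HeckeForm 16 k e f) :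
    ∀ γ ∈ CongruenceSubgroup.Gamma0 16, slash k (sl2ToReal γ) f = f := by
  have hG0 : ∀ g ∈ ([⟨⟨1, 1, 0, 1⟩, (false, false)⟩, ⟨⟨0, -1, 16, 0⟩, (false, true)⟩, ⟨⟨2, 1, 0,
    2⟩, (true, false)⟩] : List SignedMat),
      Fixes k e f g := by
    simp only [List.forall_mem_cons]
    exact ⟨h.translation, h.fricke, h.fixes_of_four_dvd (by decide), by simp⟩
  exact invariant_of_coversGamma0 h.even h.sq hG0
    (tbl := [
      (⟨1, 0, 0, 1⟩, [(1, []), (0, [1]), (0, [-1])]),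
      (⟨0, 1, -1, 0⟩, [(0, []), (2, []), (3, [])]),
      (⟨0, 1, -1, -1⟩, [(3, [-1]), (4, []), (1, [])]),
      (⟨0, 1, -1, 1⟩, [(2, [1]), (1, []), (5, [])]),
      (⟨0, 1, -1, -2⟩, [(6, []), (7, []), (2, [])]),
      (⟨0, 1, -1, 2⟩, [(8, []), (3, []), (9, [])]),
      (⟨1, 0, -2, 1⟩, [(4, []), (8, [-1]), (10, [])]),
      (⟨0, 1, -1, -3⟩, [(11, []), (12, []), (4, [])]),
      (⟨1, 0, 2, 1⟩, [(5, []), (13, []), (6, [1])]),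
      (⟨0, 1, -1, 3⟩, [(14, []), (5, []), (15, [])]),
      (⟨1, -1, -2, 3⟩, [(16, []), (6, []), (13, [-3, 2, -1, 2, -3])]),
      (⟨1, 0, -3, 1⟩, [(7, []), (16, []), (12, [-3, 2, -3, 2, -3, 2, -3, 2])]),
      (⟨0, 1, -1, -4⟩, [(17, []), (11, [2, 3, 2, 3, 2, 3, 2, 3]), (7, [])]),
      (⟨1, 1, 2, 3⟩, [(18, []), (10, [3, 2, 1, 2, 3]), (8, [])]),
      (⟨1, 0, 3, 1⟩, [(9, []), (15, [3, 2, 3, 2, 3, 2, 3, 2]), (18, [])]),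
      (⟨0, 1, -1, 4⟩, [(19, []), (9, []), (14, [2, -3, 2, -3, 2, -3, 2, -3])]),
      (⟨1, 1, -3, -2⟩, [(10, []), (20, []), (11, [])]),
      (⟨1, 0, -4, 1⟩, [(12, []), (17, [-3, 2, -3, 2, -3, 2, -3, 2]), (17, [2, 3, 2, 3, 2, 3, 2,
        3])]),
      (⟨1, -1, 3, -2⟩, [(13, []), (14, []), (21, [])]),
      (⟨1, 0, 4, 1⟩, [(15, []), (19, [2, -3, 2, -3, 2, -3, 2, -3]), (19, [3, 2, 3, 2, 3, 2, 3,
        2])]),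
      (⟨1, 2, -3, -5⟩, [(21, [-3, 2, -1, 2, -3]), (22, []), (16, [])]),
      (⟨1, -2, 3, -5⟩, [(20, [3, 2, 1, 2, 3]), (18, []), (22, [3, 2, 3, 2, 1, 2, 3, 2, 3])]),
      (⟨1, 3, -3, -8⟩, [(23, []), (21, [-3, 2, -3, 2, -1, 2, -3, 2, -3]), (20, [])]),
      (⟨3, -1, -8, 3⟩, [(22, []), (23, [-3, 2, -3, 2, 1, 2, 3, 2, 3]), (23, [-3, 2, -3, 2, -1, 2,
        3, 2, 3])])])
    ⟨_, List.mem_cons_self, rfl⟩ (by decide +kernel)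

/-- Invariance under `Γ₀(17)`. -/
theorem HeckeForm.invariant_seventeen {k : ℤ} {e : ℂ} {f : ℍ → ℂ} (h : HeckeForm 17 k e f) :
    ∀ γ ∈ CongruenceSubgroup.Gamma0 17, slash k (sl2ToReal γ) f = f := by
  have hG0 : ∀ g ∈ ([⟨⟨1, 1, 0, 1⟩, (false, false)⟩, ⟨⟨0, -1, 17, 0⟩, (false,
    true)⟩] : List SignedMat),
      Fixes k e f g := by
    simp only [List.forall_mem_cons]
    exact ⟨h.translation, h.fricke, by simp⟩
  have hd0 : defect k f ⟨2, -1, -17, 9⟩ = 0 := by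
    obtain ⟨u, hu⟩ := h.hecke_two (by decide)
    have hr := sum_sub_eq_zero_of_hecke hu (by decide)
      (fixes_of_wordLinks h.even h.sq hG0 [2] (A := ⟨0, -1, 17, 0⟩) (s := (false, true))
        (by decide +kernel))
      (P := [(⟨2, 0, 0, 1⟩, ⟨1, 0, 0, 2⟩), (⟨1, 0, 0, 2⟩, ⟨2, 0, 0, 1⟩), (⟨1, 1, 0, 2⟩, ⟨1, 1, 0,
        2⟩)]) rfl (by decide)
    simp only [List.map_cons, List.map_nil, List.sum_cons, List.sum_nil, add_zero, zero_add,
      row_zero h.even h.sq hG0 [2] (s := (false, true)) (A := (⟨2, 0, 0, 1⟩ * ⟨0, -1, 17, 0⟩))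
        (B := ⟨1, 0, 0, 2⟩) (by decide +kernel),
      row_zero h.even h.sq hG0 [2] (s := (false, true)) (A := (⟨1, 0, 0, 2⟩ * ⟨0, -1, 17, 0⟩))
        (B := ⟨2, 0, 0, 1⟩) (by decide +kernel),
      row_neg_defect h.even h.sq hG0 [] [2] (s := (false, true)) (t := (true, false)) (A := (⟨1, 1,
        0, 2⟩ * ⟨0, -1, 17, 0⟩)) (B := ⟨1, 1, 0, 2⟩)
        ⟨2, -1, -17, 9⟩ ⟨17, -1, 34, 0⟩ (by decide) (by decide +kernel)] at hr
    exact eq_zero_of_sgn_smul_sl h.even h.sq (by decide) hr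
  have hG1 : ∀ g ∈ ([⟨⟨2, -1, -17, 9⟩, (false, false)⟩, ⟨⟨1, 1, 0, 1⟩, (false, false)⟩, ⟨⟨0, -1,
    17, 0⟩, (false, true)⟩] : List SignedMat),
      Fixes k e f g :=
    List.forall_mem_cons.2 ⟨fixes_of_defect (by decide) hd0, hG0⟩
  have hc1_0 : Carries k e (⟨51, 21, -85, -34⟩ * ⟨-9, -6, 17, 11⟩) (true, true)
      (defect k f ⟨5, 3, -17, -10⟩) (defect k f ⟨3, 2, -17, -11⟩) := by
    obtain ⟨u, hu⟩ := h.hecke_three (by decide)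
    have hr := sum_sub_eq_zero_of_hecke hu (by decide)
      (fixes_of_wordLinks h.even h.sq hG1 [-1, 3, 2] (A := ⟨17, 8, 34, 17⟩) (s := (false, true))
        (by decide +kernel))
      (P := [(⟨3, 0, 0, 1⟩, ⟨1, 2, 0, 3⟩), (⟨1, 0, 0, 3⟩, ⟨1, 1, 0, 3⟩), (⟨1, 1, 0, 3⟩, ⟨3, 0, 0,
        1⟩), (⟨1, 2, 0, 3⟩, ⟨1, 0, 0, 3⟩)]) rfl (by decide)
    simp only [List.map_cons, List.map_nil, List.sum_cons, List.sum_nil, add_zero, zero_add,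
      row_zero h.even h.sq hG1 [2, -1, 3] (s := (false, true)) (A := (⟨3, 0, 0, 1⟩ * ⟨17, 8, 34,
        17⟩)) (B := ⟨1, 2, 0, 3⟩) (by decide +kernel),
      row_neg_defect h.even h.sq hG1 [3, -2, -1, 3, 2] [3] (s := (false, true)) (t := (true,
        false)) (A := (⟨1, 0, 0, 3⟩ * ⟨17, 8, 34, 17⟩)) (B := ⟨1, 1, 0, 3⟩)
        ⟨5, 3, -17, -10⟩ ⟨51, 21, -85, -34⟩ (by decide) (by decide +kernel),
      row_zero h.even h.sq hG1 [-1, 3, 2, 2] (s := (false, true)) (A := (⟨1, 1, 0, 3⟩ * ⟨17, 8, 34,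
        17⟩)) (B := ⟨3, 0, 0, 1⟩) (by decide +kernel),
      row_neg_defect h.even h.sq hG1 [2, 3, 2] [] (s := (false, true)) (t := (true, true)) (A :=
        (⟨1, 2, 0, 3⟩ * ⟨17, 8, 34, 17⟩)) (B := ⟨1, 0, 0, 3⟩)
        ⟨3, 2, -17, -11⟩ ⟨11, 6, -17, -9⟩ (by decide) (by decide +kernel)] at hr
    exact carries_of_sum_eq_zero h.even h.sq (by decide) (by decide) hr
  have hc1_1 : Carries k e (⟨34, 1, -51, 0⟩ * ⟨2, 1, 17, 10⟩) (true, true)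
      (defect k f ⟨3, 2, -17, -11⟩) (defect k f ⟨5, 3, -17, -10⟩) := by
    obtain ⟨u, hu⟩ := h.hecke_three (by decide)
    have hr := sum_sub_eq_zero_of_hecke hu (by decide)
      (fixes_of_wordLinks h.even h.sq hG1 [3] (A := ⟨0, 1, -17, 0⟩) (s := (false, true))
        (by decide +kernel))
      (P := [(⟨3, 0, 0, 1⟩, ⟨1, 0, 0, 3⟩), (⟨1, 0, 0, 3⟩, ⟨3, 0, 0, 1⟩), (⟨1, 1, 0, 3⟩, ⟨1, 1, 0,
        3⟩), (⟨1, 2, 0, 3⟩, ⟨1, 2, 0, 3⟩)]) rfl (by decide)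
    simp only [List.map_cons, List.map_nil, List.sum_cons, List.sum_nil, add_zero, zero_add,
      row_zero h.even h.sq hG1 [3] (s := (false, true)) (A := (⟨3, 0, 0, 1⟩ * ⟨0, 1, -17, 0⟩))
        (B := ⟨1, 0, 0, 3⟩) (by decide +kernel),
      row_zero h.even h.sq hG1 [3] (s := (false, true)) (A := (⟨1, 0, 0, 3⟩ * ⟨0, 1, -17, 0⟩))
        (B := ⟨3, 0, 0, 1⟩) (by decide +kernel),
      row_neg_defect h.even h.sq hG1 [2] [3] (s := (false, true)) (t := (true, false)) (A := (⟨1,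
        1, 0, 3⟩ * ⟨0, 1, -17, 0⟩)) (B := ⟨1, 1, 0, 3⟩)
        ⟨3, 2, -17, -11⟩ ⟨34, 1, -51, 0⟩ (by decide) (by decide +kernel),
      row_neg_defect h.even h.sq hG1 [-1, 3, 2] [2] (s := (false, true)) (t := (true, true)) (A :=
        (⟨1, 2, 0, 3⟩ * ⟨0, 1, -17, 0⟩)) (B := ⟨1, 2, 0, 3⟩)
        ⟨5, 3, -17, -10⟩ ⟨10, -1, -17, 2⟩ (by decide) (by decide +kernel)] at hr
    exact carries_of_sum_eq_zero h.even h.sq (by decide) (by decide) hr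
  have hd1 : defect k f ⟨5, 3, -17, -10⟩ = 0 :=
    defect_eq_zero_of_carries h.even h.pos h.sq h.hol (by decide) (hc1_0.trans h.sq hc1_1)
      (by decide +kernel)
  have hG2 : ∀ g ∈ ([⟨⟨5, 3, -17, -10⟩, (false, false)⟩, ⟨⟨2, -1, -17, 9⟩, (false, false)⟩, ⟨⟨1, 1,
    0, 1⟩, (false, false)⟩, ⟨⟨0, -1, 17, 0⟩, (false, true)⟩] : List SignedMat),
      Fixes k e f g :=
    List.forall_mem_cons.2 ⟨fixes_of_defect (by decide) hd1, hG1⟩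
  have hd2 : defect k f ⟨4, 1, -17, -4⟩ = 0 := by
    obtain ⟨u, hu⟩ := h.hecke_two (by decide)
    have hr := sum_sub_eq_zero_of_hecke hu (by decide)
      (fixes_of_wordLinks h.even h.sq hG2 [1] (A := ⟨5, 3, -17, -10⟩) (s := (false, false))
        (by decide +kernel))
      (P := [(⟨2, 0, 0, 1⟩, ⟨1, 0, 0, 2⟩), (⟨1, 0, 0, 2⟩, ⟨1, 1, 0, 2⟩), (⟨1, 1, 0, 2⟩, ⟨2, 0, 0,
        1⟩)]) rfl (by decide)
    simp only [List.map_cons, List.map_nil, List.sum_cons, List.sum_nil, add_zero, zero_add,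
      row_zero h.even h.sq hG2 [-1] (s := (false, false)) (A := (⟨2, 0, 0, 1⟩ * ⟨5, 3, -17, -10⟩))
        (B := ⟨1, 0, 0, 2⟩) (by decide +kernel),
      row_zero h.even h.sq hG2 [4, 3, -1, 4] (s := (false, false)) (A := (⟨1, 0, 0, 2⟩ * ⟨5, 3,
        -17, -10⟩)) (B := ⟨1, 1, 0, 2⟩) (by decide +kernel),
      row_neg_defect h.even h.sq hG2 [3, -1] [-3] (s := (false, false)) (t := (true, false)) (A :=
        (⟨1, 1, 0, 2⟩ * ⟨5, 3, -17, -10⟩)) (B := ⟨2, 0, 0, 1⟩)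
        ⟨4, 1, -17, -4⟩ ⟨8, 5, -34, -21⟩ (by decide) (by decide +kernel)] at hr
    exact eq_zero_of_sgn_smul_sl h.even h.sq (by decide) hr
  have hG3 : ∀ g ∈ ([⟨⟨4, 1, -17, -4⟩, (false, false)⟩, ⟨⟨5, 3, -17, -10⟩, (false, false)⟩, ⟨⟨2,
    -1, -17, 9⟩, (false, false)⟩, ⟨⟨1, 1, 0, 1⟩, (false, false)⟩, ⟨⟨0, -1, 17, 0⟩, (false,
    true)⟩] : List SignedMat),
      Fixes k e f g :=
    List.forall_mem_cons.2 ⟨fixes_of_defect (by decide) hd2, hG2⟩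
  exact invariant_of_coversGamma0 h.even h.sq hG3
    (tbl := [
      (⟨1, 0, 0, 1⟩, [(1, []), (0, [4]), (0, [-4])]),
      (⟨0, 1, -1, 0⟩, [(0, []), (2, []), (3, [])]),
      (⟨0, 1, -1, -1⟩, [(3, [-4]), (4, []), (1, [])]),
      (⟨0, 1, -1, 1⟩, [(2, [4]), (1, []), (5, [])]),
      (⟨0, 1, -1, -2⟩, [(6, []), (7, []), (2, [])]),
      (⟨0, 1, -1, 2⟩, [(8, []), (3, []), (9, [])]),
      (⟨1, 0, -2, 1⟩, [(4, []), (8, [-4]), (10, [])]),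
      (⟨0, 1, -1, -3⟩, [(11, []), (12, []), (4, [])]),
      (⟨1, 0, 2, 1⟩, [(5, []), (13, []), (6, [4])]),
      (⟨0, 1, -1, 3⟩, [(14, []), (5, []), (15, [])]),
      (⟨1, -1, -2, 3⟩, [(16, []), (6, []), (14, [-4, -3, 1, 2, -4])]),
      (⟨1, 0, -3, 1⟩, [(7, []), (16, []), (13, [2, -4])]),
      (⟨0, 1, -1, -4⟩, [(12, [1]), (17, []), (7, [])]),
      (⟨1, 1, 2, 3⟩, [(17, [4, -2, 1]), (11, [4, -2]), (8, [])]),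
      (⟨1, 0, 3, 1⟩, [(9, []), (10, [5, 1, 2, -4, -3, 5, 4]), (17, [4, -2, 1])]),
      (⟨0, 1, -1, 4⟩, [(15, [5, 1, 5]), (9, []), (16, [5, 2, -4, -3, 5, 4])]),
      (⟨1, 1, -3, -2⟩, [(10, []), (15, [2, -4, -3, 5, 4, 5]), (11, [])]),
      (⟨0, 1, -1, -5⟩, [(13, [1, 2, -4]), (14, [1, 2, -4]), (12, [])])])
    ⟨_, List.mem_cons_self, rfl⟩ (by decide +kernel)

/-- Invariance under `Γ₀(23)`. -/
theorem HeckeForm.invariant_twentyThree {k : ℤ} {e : ℂ} {f : ℍ → ℂ} (h : HeckeForm 23 k e f) :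
    ∀ γ ∈ CongruenceSubgroup.Gamma0 23, slash k (sl2ToReal γ) f = f := by
  have hG0 : ∀ g ∈ ([⟨⟨1, 1, 0, 1⟩, (false, false)⟩, ⟨⟨0, -1, 23, 0⟩, (false,
    true)⟩] : List SignedMat),
      Fixes k e f g := by
    simp only [List.forall_mem_cons]
    exact ⟨h.translation, h.fricke, by simp⟩
  have hd0 : defect k f ⟨2, -1, -23, 12⟩ = 0 := by
    obtain ⟨u, hu⟩ := h.hecke_two (by decide)
    have hr := sum_sub_eq_zero_of_hecke hu (by decide)
      (fixes_of_wordLinks h.even h.sq hG0 [2] (A := ⟨0, -1, 23, 0⟩) (s := (false, true))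
        (by decide +kernel))
      (P := [(⟨2, 0, 0, 1⟩, ⟨1, 0, 0, 2⟩), (⟨1, 0, 0, 2⟩, ⟨2, 0, 0, 1⟩), (⟨1, 1, 0, 2⟩, ⟨1, 1, 0,
        2⟩)]) rfl (by decide)
    simp only [List.map_cons, List.map_nil, List.sum_cons, List.sum_nil, add_zero, zero_add,
      row_zero h.even h.sq hG0 [2] (s := (false, true)) (A := (⟨2, 0, 0, 1⟩ * ⟨0, -1, 23, 0⟩))
        (B := ⟨1, 0, 0, 2⟩) (by decide +kernel),
      row_zero h.even h.sq hG0 [2] (s := (false, true)) (A := (⟨1, 0, 0, 2⟩ * ⟨0, -1, 23, 0⟩))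
        (B := ⟨2, 0, 0, 1⟩) (by decide +kernel),
      row_neg_defect h.even h.sq hG0 [] [2] (s := (false, true)) (t := (true, false)) (A := (⟨1, 1,
        0, 2⟩ * ⟨0, -1, 23, 0⟩)) (B := ⟨1, 1, 0, 2⟩)
        ⟨2, -1, -23, 12⟩ ⟨23, -1, 46, 0⟩ (by decide) (by decide +kernel)] at hr
    exact eq_zero_of_sgn_smul_sl h.even h.sq (by decide) hr
  have hG1 : ∀ g ∈ ([⟨⟨2, -1, -23, 12⟩, (false, false)⟩, ⟨⟨1, 1, 0, 1⟩, (false, false)⟩, ⟨⟨0, -1,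
    23, 0⟩, (false, true)⟩] : List SignedMat),
      Fixes k e f g :=
    List.forall_mem_cons.2 ⟨fixes_of_defect (by decide) hd0, hG0⟩
  have hc1_0 : Carries k e (⟨1, -3, 0, 3⟩ * ⟨11, 8, 23, 17⟩) (false, false)
      (defect k f ⟨6, 5, -23, -19⟩) (defect k f ⟨4, 3, -23, -17⟩) := by
    obtain ⟨u, hu⟩ := h.hecke_three (by decide)
    have hr := sum_sub_eq_zero_of_hecke hu (by decide)
      (fixes_of_wordLinks h.even h.sq hG1 [-1, 3] (A := ⟨23, -12, 46, -23⟩) (s := (false, true))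
        (by decide +kernel))
      (P := [(⟨3, 0, 0, 1⟩, ⟨1, 1, 0, 3⟩), (⟨1, 0, 0, 3⟩, ⟨1, 0, 0, 3⟩), (⟨1, 1, 0, 3⟩, ⟨3, 0, 0,
        1⟩), (⟨1, 2, 0, 3⟩, ⟨1, 2, 0, 3⟩)]) rfl (by decide)
    simp only [List.map_cons, List.map_nil, List.sum_cons, List.sum_nil, add_zero, zero_add,
      row_zero h.even h.sq hG1 [2, -1, 3] (s := (false, true)) (A := (⟨3, 0, 0, 1⟩ * ⟨23, -12, 46,
        -23⟩)) (B := ⟨1, 1, 0, 3⟩) (by decide +kernel),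
      row_defect h.even h.sq hG1 [3] [2] (s := (false, true)) (t := (false, true)) (A := (⟨1, 0, 0,
        3⟩ * ⟨23, -12, 46, -23⟩)) (B := ⟨1, 0, 0, 3⟩)
        ⟨6, 5, -23, -19⟩ ⟨1, -3, 0, 3⟩ (by decide) (by decide +kernel),
      row_zero h.even h.sq hG1 [-1, 3, -2] (s := (false, true)) (A := (⟨1, 1, 0, 3⟩ * ⟨23, -12, 46,
        -23⟩)) (B := ⟨3, 0, 0, 1⟩) (by decide +kernel),
      row_neg_defect h.even h.sq hG1 [2, 3, 2] [2] (s := (false, true)) (t := (true, true)) (A :=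
        (⟨1, 2, 0, 3⟩ * ⟨23, -12, 46, -23⟩)) (B := ⟨1, 2, 0, 3⟩)
        ⟨4, 3, -23, -17⟩ ⟨17, -8, -23, 11⟩ (by decide) (by decide +kernel)] at hr
    exact carries_of_sum_eq_zero h.even h.sq (by decide) (by decide) hr
  have hc1_1 : Carries k e (⟨1, -2, 0, 2⟩ * ⟨11, 9, 23, 19⟩) (false, false)
      (defect k f ⟨4, 3, -23, -17⟩) (defect k f ⟨6, 5, -23, -19⟩) := by
    obtain ⟨u, hu⟩ := h.hecke_two (by decide)
    have hr := sum_sub_eq_zero_of_hecke hu (by decide)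
      (fixes_of_wordLinks h.even h.sq hG1 [1] (A := ⟨2, -1, -23, 12⟩) (s := (false, false))
        (by decide +kernel))
      (P := [(⟨2, 0, 0, 1⟩, ⟨1, 0, 0, 2⟩), (⟨1, 0, 0, 2⟩, ⟨2, 0, 0, 1⟩), (⟨1, 1, 0, 2⟩, ⟨1, 1, 0,
        2⟩)]) rfl (by decide)
    simp only [List.map_cons, List.map_nil, List.sum_cons, List.sum_nil, add_zero, zero_add,
      row_defect h.even h.sq hG1 [] [2] (s := (false, false)) (t := (false, false)) (A := (⟨2, 0,
        0, 1⟩ * ⟨2, -1, -23, 12⟩)) (B := ⟨1, 0, 0, 2⟩)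
        ⟨4, 3, -23, -17⟩ ⟨1, -2, 0, 2⟩ (by decide) (by decide +kernel),
      row_zero h.even h.sq hG1 [3, 2, 3, -2] (s := (false, false)) (A := (⟨1, 0, 0, 2⟩ * ⟨2, -1,
        -23, 12⟩)) (B := ⟨2, 0, 0, 1⟩) (by decide +kernel),
      row_neg_defect h.even h.sq hG1 [-1, 3, 2, 3, 2] [2] (s := (false, false)) (t := (true,
        false)) (A := (⟨1, 1, 0, 2⟩ * ⟨2, -1, -23, 12⟩)) (B := ⟨1, 1, 0, 2⟩)
        ⟨6, 5, -23, -19⟩ ⟨19, -9, -23, 11⟩ (by decide) (by decide +kernel)] at hr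
    exact carries_of_sum_eq_zero h.even h.sq (by decide) (by decide) hr
  have hd1 : defect k f ⟨6, 5, -23, -19⟩ = 0 :=
    defect_eq_zero_of_carries h.even h.pos h.sq h.hol (by decide) (hc1_0.trans h.sq hc1_1)
      (by decide +kernel)
  have hG2 : ∀ g ∈ ([⟨⟨6, 5, -23, -19⟩, (false, false)⟩, ⟨⟨2, -1, -23, 12⟩, (false, false)⟩, ⟨⟨1,
    1, 0, 1⟩, (false, false)⟩, ⟨⟨0, -1, 23, 0⟩, (false, true)⟩] : List SignedMat),
      Fixes k e f g :=
    List.forall_mem_cons.2 ⟨fixes_of_defect (by decide) hd1, hG1⟩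
  have hd2 : defect k f ⟨4, 3, -23, -17⟩ = 0 := by
    obtain ⟨u, hu⟩ := h.hecke_two (by decide)
    have hr := sum_sub_eq_zero_of_hecke hu (by decide)
      (fixes_of_wordLinks h.even h.sq hG2 [2] (A := ⟨2, -1, -23, 12⟩) (s := (false, false))
        (by decide +kernel))
      (P := [(⟨2, 0, 0, 1⟩, ⟨1, 0, 0, 2⟩), (⟨1, 0, 0, 2⟩, ⟨2, 0, 0, 1⟩), (⟨1, 1, 0, 2⟩, ⟨1, 1, 0,
        2⟩)]) rfl (by decide)
    simp only [List.map_cons, List.map_nil, List.sum_cons, List.sum_nil, add_zero,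
      row_defect h.even h.sq hG2 [] [3] (s := (false, false)) (t := (false, false)) (A := (⟨2, 0,
        0, 1⟩ * ⟨2, -1, -23, 12⟩)) (B := ⟨1, 0, 0, 2⟩)
        ⟨4, 3, -23, -17⟩ ⟨1, -2, 0, 2⟩ (by decide) (by decide +kernel),
      row_zero h.even h.sq hG2 [4, 3, 4, -3] (s := (false, false)) (A := (⟨1, 0, 0, 2⟩ * ⟨2, -1,
        -23, 12⟩)) (B := ⟨2, 0, 0, 1⟩) (by decide +kernel),
      row_zero h.even h.sq hG2 [-2, 4, 3, 1, -3, 4, -3] (s := (false, false)) (A := (⟨1, 1, 0,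
        2⟩ * ⟨2, -1, -23, 12⟩)) (B := ⟨1, 1, 0, 2⟩) (by decide +kernel)] at hr
    exact eq_zero_of_sgn_smul_sl h.even h.sq (by decide) hr
  have hG3 : ∀ g ∈ ([⟨⟨4, 3, -23, -17⟩, (false, false)⟩, ⟨⟨6, 5, -23, -19⟩, (false, false)⟩, ⟨⟨2,
    -1, -23, 12⟩, (false, false)⟩, ⟨⟨1, 1, 0, 1⟩, (false, false)⟩, ⟨⟨0, -1, 23, 0⟩, (false,
    true)⟩] : List SignedMat),
      Fixes k e f g :=
    List.forall_mem_cons.2 ⟨fixes_of_defect (by decide) hd2, hG2⟩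
  have hc3_0 : Carries k e (⟨4, 1, -23, -5⟩ * ⟨-4, -1, 23, 5⟩) (false, false)
      (defect k f ⟨9, 2, -23, -5⟩) (defect k f ⟨9, 2, -23, -5⟩) := by
    obtain ⟨u, hu⟩ := h.hecke_three (by decide)
    have hr := sum_sub_eq_zero_of_hecke hu (by decide)
      (fixes_of_wordLinks h.even h.sq hG3 [5] (A := ⟨0, 1, -23, 0⟩) (s := (false, true))
        (by decide +kernel))
      (P := [(⟨3, 0, 0, 1⟩, ⟨1, 0, 0, 3⟩), (⟨1, 0, 0, 3⟩, ⟨3, 0, 0, 1⟩), (⟨1, 1, 0, 3⟩, ⟨1, 1, 0,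
        3⟩), (⟨1, 2, 0, 3⟩, ⟨1, 2, 0, 3⟩)]) rfl (by decide)
    simp only [List.map_cons, List.map_nil, List.sum_cons, List.sum_nil, add_zero, zero_add,
      row_zero h.even h.sq hG3 [5] (s := (false, true)) (A := (⟨3, 0, 0, 1⟩ * ⟨0, 1, -23, 0⟩))
        (B := ⟨1, 0, 0, 3⟩) (by decide +kernel),
      row_zero h.even h.sq hG3 [5] (s := (false, true)) (A := (⟨1, 0, 0, 3⟩ * ⟨0, 1, -23, 0⟩))
        (B := ⟨3, 0, 0, 1⟩) (by decide +kernel),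
      row_defect h.even h.sq hG3 [-3, 5, 4] [4, -1] (s := (false, true)) (t := (false, true))
        (A := (⟨1, 1, 0, 3⟩ * ⟨0, 1, -23, 0⟩)) (B := ⟨1, 1, 0, 3⟩)
        ⟨9, 2, -23, -5⟩ ⟨4, 1, -23, -5⟩ (by decide) (by decide +kernel),
      row_neg_defect h.even h.sq hG3 [4, 2, -4, 5] [4] (s := (false, true)) (t := (true, true))
        (A := (⟨1, 2, 0, 3⟩ * ⟨0, 1, -23, 0⟩)) (B := ⟨1, 2, 0, 3⟩)
        ⟨9, 2, -23, -5⟩ ⟨5, 1, -23, -4⟩ (by decide) (by decide +kernel)] at hr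
    exact carries_of_sum_eq_zero h.even h.sq (by decide) (by decide) hr
  have hd3 : defect k f ⟨9, 2, -23, -5⟩ = 0 :=
    defect_eq_zero_of_carries h.even h.pos h.sq h.hol (by decide) (hc3_0.symm h.even h.sq)
      (by decide +kernel)
  have hG4 : ∀ g ∈ ([⟨⟨9, 2, -23, -5⟩, (false, false)⟩, ⟨⟨4, 3, -23, -17⟩, (false, false)⟩, ⟨⟨6, 5,
    -23, -19⟩, (false, false)⟩, ⟨⟨2, -1, -23, 12⟩, (false, false)⟩, ⟨⟨1, 1, 0, 1⟩, (false, false)⟩,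
    ⟨⟨0, -1, 23, 0⟩, (false, true)⟩] : List SignedMat),
      Fixes k e f g :=
    List.forall_mem_cons.2 ⟨fixes_of_defect (by decide) hd3, hG3⟩
  exact invariant_of_coversGamma0 h.even h.sq hG4
    (tbl := [
      (⟨1, 0, 0, 1⟩, [(1, []), (0, [5]), (0, [-5])]),
      (⟨0, 1, -1, 0⟩, [(0, []), (2, []), (3, [])]),
      (⟨0, 1, -1, -1⟩, [(3, [-5]), (4, []), (1, [])]),
      (⟨0, 1, -1, 1⟩, [(2, [5]), (1, []), (5, [])]),
      (⟨0, 1, -1, -2⟩, [(6, []), (7, []), (2, [])]),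
      (⟨0, 1, -1, 2⟩, [(8, []), (3, []), (9, [])]),
      (⟨1, 0, -2, 1⟩, [(4, []), (8, [-5]), (10, [])]),
      (⟨0, 1, -1, -3⟩, [(11, []), (12, []), (4, [])]),
      (⟨1, 0, 2, 1⟩, [(5, []), (13, []), (6, [5])]),
      (⟨0, 1, -1, 3⟩, [(14, []), (5, []), (15, [])]),
      (⟨1, -1, -2, 3⟩, [(16, []), (6, []), (17, [])]),
      (⟨1, 0, -3, 1⟩, [(7, []), (16, []), (18, [])]),
      (⟨0, 1, -1, -4⟩, [(19, []), (20, []), (7, [])]),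
      (⟨1, 1, 2, 3⟩, [(21, []), (18, [-4, 6, 5, 1, 3, -5, 6]), (8, [])]),
      (⟨1, 0, 3, 1⟩, [(9, []), (17, [5, -2, -1]), (21, [])]),
      (⟨0, 1, -1, 4⟩, [(22, []), (9, []), (23, [])]),
      (⟨1, 1, -3, -2⟩, [(10, []), (19, [1]), (11, [])]),
      (⟨1, -2, -2, 5⟩, [(20, [1]), (10, []), (14, [1, 2, -5])]),
      (⟨1, -1, -3, 4⟩, [(23, [3, -5]), (11, []), (13, [3, -5, 6, -1, -5, -4, 6])]),
      (⟨1, 0, -4, 1⟩, [(12, []), (23, [3, -5]), (16, [-1])]),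
      (⟨0, 1, -1, -5⟩, [(17, [-1]), (22, [2, -5]), (12, [])]),
      (⟨1, -1, 3, -2⟩, [(13, []), (14, []), (22, [6, 4, 5, 1, 6])]),
      (⟨1, 0, 4, 1⟩, [(15, []), (21, [6, -1, -5, -4, 6]), (20, [5, -2])]),
      (⟨0, 1, -1, 5⟩, [(18, [6, 3, -5, 6]), (15, []), (19, [6, 3, -5, 6])])])
    ⟨_, List.mem_cons_self, rfl⟩ (by decide +kernel)

lemma natCast_pow_mul_zpow_eq_one {h p : ℕ} (hh : 0 < h) (hp : p ≠ 0) :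
    (p : ℂ) ^ (2 * h - 1) * (p : ℂ) ^ (1 - 2 * h : ℤ) = 1 := by
  rw [← zpow_natCast, ← zpow_add₀ (by exact_mod_cast hp), Nat.cast_sub (by omega)]
  simp

lemma heckeForm_fourierSeries {N h : ℕ} (hN : 0 < N) (hh : 0 < h) {a : ℕ → ℂ} {K C : ℝ}
    (ha : ∀ n, ‖a (n + 1)‖ ≤ K * ((n : ℝ) + 1) ^ C) {x₀ : ℝ} {e : ℂ} (he : e ^ 2 = 1)
    (hfricke : sl (2 * h : ℕ) ⟨0, -1, N, 0⟩ (fourierSeries a) = e • fourierSeries a)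
    (hEuler : ∀ s : ℂ, x₀ < s.re →
      dirichletSeries a s = ∏' p : Nat.Primes, localFactor a N ((2 * h : ℕ) : ℤ) (p : ℕ) s) :
    HeckeForm N (2 * h : ℕ) e (fourierSeries a) where
  even := by exact_mod_cast even_two_mul h
  pos := by exact_mod_cast Nat.mul_pos two_pos hh
  sq := he
  hol := hol_fourierSeries ha
  translation := ⟨by decide, by rw [sl_translation, sgn_one, one_smul]⟩
  fricke := ⟨by simpa [IntMat.det] using hN, by rw [hfricke]; simp [sgn]⟩
  hecke_two hp := by
    have h2 := hecke_of_eulerProduct hh ha hEuler Nat.prime_two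
    refine ⟨_, Eq.trans ?_ h2⟩
    have hq : eulerQuad N h 2 * ((2 : ℕ) : ℂ) ^ (1 - 2 * h : ℤ) = 1 := by
      rw [eulerQuad, if_neg hp]; exact natCast_pow_mul_zpow_eq_one hh two_ne_zero
    rw [hq, one_smul]
    simp [Finset.sum_range_succ, add_comm, add_left_comm]
  hecke_three hp := by
    have h3 := hecke_of_eulerProduct hh ha hEuler Nat.prime_three
    refine ⟨_, Eq.trans ?_ h3⟩
    have hq : eulerQuad N h 3 * ((3 : ℕ) : ℂ) ^ (1 - 2 * h : ℤ) = 1 := by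
      rw [eulerQuad, if_neg hp]; exact natCast_pow_mul_zpow_eq_one hh three_ne_zero
    rw [hq, one_smul]
    simp [Finset.sum_range_succ, add_comm, add_left_comm]
  atkin_two hp := by
    have h2 := hecke_of_eulerProduct hh ha hEuler Nat.prime_two
    have hq : eulerQuad N h 2 = 0 := by rw [eulerQuad, if_pos hp]
    rw [hq, zero_mul, zero_smul, add_zero] at h2
    have hs : (∑ b ∈ Finset.range 2, sl (2 * h : ℕ) ⟨1, b, 0, (2 : ℕ)⟩ (fourierSeries a)) =
        sl (2 * h : ℕ) ⟨1, 0, 0, 2⟩ (fourierSeries a) +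
          sl (2 * h : ℕ) ⟨1, 1, 0, 2⟩ (fourierSeries a) := by
      simp [Finset.sum_range_succ]
    rw [← hs, h2, eulerLin, if_pos hp]
    by_cases h4 : 4 ∣ N
    · rw [if_pos h4, if_pos (by norm_num; exact h4), zero_mul, zero_smul]
    · rw [if_neg h4, if_neg (by norm_num; exact h4)]
      have : ((2 : ℕ) : ℂ) ^ (h - 1) * ((2 : ℕ) : ℂ) ^ (1 - h : ℤ) = 1 := by
        rw [← zpow_natCast, ← zpow_add₀ (by norm_num), Nat.cast_sub hh]
        simp
      rw [this, one_smul]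

/-- **Theorem 1.** For `5 ≤ N ≤ 12`, `14 ≤ N ≤ 17`, or `N = 23`: a functional
equation together with an Euler product of degree 2, level `N`, and weight `k`
for `F(s) = Σ a_n n^{-s}` forces `f(z) = Σ a_n e^{2πinz}` to be invariant
under `Γ₀(N)`. -/
theorem extension_of_hecke_converse_theorem
    (N : ℕ) (hN : (5 ≤ N ∧ N ≤ 12) ∨ (14 ≤ N ∧ N ≤ 17) ∨ N = 23)
    (k : ℤ) (hkpos : 0 < k) (hkeven : Even k)
    (a : ℕ → ℂ) (ha1 : a 1 = 1) (C : ℝ) (hC : 0 < C)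
    (hgrowth : (fun n : ℕ => a n) =O[atTop] fun n : ℕ => (n : ℝ) ^ C)
    (ε : ℝ) (hε : ε = 1 ∨ ε = -1)
    (Φ : ℂ → ℂ)
    (hΦentire : Differentiable ℂ Φ)
    (hΦeq : ∀ s : ℂ, C + 2 < s.re →
      Φ s = ((Real.sqrt N : ℂ) / (2 * (Real.pi : ℂ))) ^ s * Complex.Gamma s *
        dirichletSeries a s)
    (hΦbdd : ∀ σ₁ σ₂ : ℝ, ∃ M : ℝ, ∀ s : ℂ, σ₁ ≤ s.re → s.re ≤ σ₂ → ‖Φ s‖ ≤ M)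
    (hΦfe : ∀ s : ℂ, Φ s = (ε : ℂ) * (-1 : ℂ) ^ (k / 2) * Φ ((k : ℂ) - s))
    (hEuler : ∀ s : ℂ, C + 2 < s.re →
      Multipliable (fun p : Nat.Primes => localFactor a N k (p : ℕ) s) ∧
      dirichletSeries a s = ∏' p : Nat.Primes, localFactor a N k (p : ℕ) s) :
    ∀ γ ∈ CongruenceSubgroup.Gamma0 N,
      slash k (sl2ToReal γ) (fourierSeries a) = fourierSeries a := by
  obtain ⟨K, ha⟩ := exists_coeff_bound hgrowth
  have hN0 : 0 < N := by omega
  have hfr := fricke_eigenfunction hN0 hkpos hkeven ha1 hC ha hε hΦentire hΦeq hΦbdd hΦfe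
  obtain ⟨h, rfl⟩ : ∃ h : ℕ, k = (2 * h : ℕ) := by
    obtain ⟨j, hj⟩ := hkeven
    exact ⟨j.toNat, by omega⟩
  have hh : 0 < h := by omega
  have he : (ε : ℂ) ^ 2 = 1 := by rcases hε with rfl | rfl <;> norm_num
  have hF := heckeForm_fourierSeries hN0 hh ha he hfr fun s hs => (hEuler s hs).2
  obtain rfl | rfl | rfl | rfl | rfl | rfl | rfl | rfl | rfl | rfl | rfl | rfl | rfl :
      N = 5 ∨ N = 6 ∨ N = 7 ∨ N = 8 ∨ N = 9 ∨ N = 10 ∨ N = 11 ∨ N = 12 ∨ N = 14 ∨ N = 15 ∨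
        N = 16 ∨ N = 17 ∨ N = 23 := by omega
  · exact hF.invariant_five
  · exact hF.invariant_six
  · exact hF.invariant_seven
  · exact hF.invariant_eight
  · exact hF.invariant_nine
  · exact hF.invariant_ten
  · exact hF.invariant_eleven
  · exact hF.invariant_twelve
  · exact hF.invariant_fourteen
  · exact hF.invariant_fifteen
  · exact hF.invariant_sixteen
  · exact hF.invariant_seventeen
  · exact hF.invariant_twentyThree
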